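/- Let α ∈ (0,1], let s ∈ [1,∞) satisfy s·(1−α) ≤ 3, let s' be its conjugate exponent (1/s + 1/s' = 1), and let C₀ ≥ 1. For every ε > 0 there exists A > 0 such that for every δ ∈ (0,1), every Katz–Tao (δ,α,C₀)-set X ⊆ δℤ² ∩ B(0,1/4), every integer m ≥ 1, and every family (R_x)_{x∈X} of sets R_x ⊆ [1,2] ∩ δℤ with #R_x = m, one has ‖ Σ_{x∈X} Σ_{r∈R_x} 1_{S_{10δ}(x,r)} ‖_{L^{3/2}(ℝ²)} ≤ A·δ^{−ε}·(mδ)^{1/s'}·δ^{−α/3}·(#X)^{2/3}. -/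

import Mathlib

open MeasureTheory Metric Set

/-- The `δ`-annulus `S_δ(x,r) = {y : ||y - x| - r| ≤ δ}`. -/
def annulus (δ : ℝ) (x : EuclideanSpace ℝ (Fin 2)) (r : ℝ) :
    Set (EuclideanSpace ℝ (Fin 2)) :=
  {y | |dist y x - r| ≤ δ}

/-- `X ⊆ δℤ²`: every coordinate of every point of `X` is an integer multiple of `δ`. -/
def InLattice (δ : ℝ) (X : Finset (EuclideanSpace ℝ (Fin 2))) : Prop :=
  ∀ z ∈ X, ∀ i : Fin 2, ∃ k : ℤ, z i = δ * k

/-- `X` is a Katz–Tao `(δ,α,C)`-set: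
`#(X ∩ B(x,r)) ≤ C·(r/δ)^α` for all `x` and all `r ∈ [δ,1]`. -/
def IsKatzTao (δ α C : ℝ) (X : Finset (EuclideanSpace ℝ (Fin 2))) : Prop :=
  ∀ (x : EuclideanSpace ℝ (Fin 2)) (r : ℝ), δ ≤ r → r ≤ 1 →
    (((X : Set (EuclideanSpace ℝ (Fin 2))) ∩ Metric.closedBall x r).ncard : ℝ)
      ≤ C * (r / δ) ^ α

/-- The sum of indicator functions of the `10δ`-annuli `S_{10δ}(x,r)`,
`x ∈ X`, `r ∈ R x`. -/
noncomputable def annSum (δ : ℝ) (X : Finset (EuclideanSpace ℝ (Fin 2)))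
    (R : EuclideanSpace ℝ (Fin 2) → Finset ℝ) (y : EuclideanSpace ℝ (Fin 2)) : ℝ :=
  ∑ x ∈ X, ∑ r ∈ R x, (annulus (10 * δ) x r).indicator (fun _ => (1 : ℝ)) y

namespace CircleTangency

section MarcusTardos

open Classical in
/-- The vertices `c` joined to both `a` and `b` whose two tangency parameters are separated. -/
noncomputable def sepCommon {α β : Type*} (B : Finset β) (E : α → β → Prop) (T : α → β → ℝ)
    (ϑ : ℝ) (a b : α) : Finset β :=
  {c ∈ B | E a c ∧ E b c ∧ ϑ ≤ |T a c - T b c|}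

lemma sign_mul_sign_of_prod_neg {w x y z : ℝ} (h : w * x * y * z < 0) :
    (SignType.sign w : ℝ) * SignType.sign x = -(SignType.sign y * SignType.sign z) := by
  have hw : w ≠ 0 := by rintro rfl; simp at h
  have hx : x ≠ 0 := by rintro rfl; simp at h
  have hy : y ≠ 0 := by rintro rfl; simp at h
  have hz : z ≠ 0 := by rintro rfl; simp at h
  have := sign_neg h
  rw [sign_mul, sign_mul, sign_mul] at this
  rcases lt_or_gt_of_ne hw with hw | hw <;> rcases lt_or_gt_of_ne hx with hx | hx <;>
  rcases lt_or_gt_of_ne hy with hy | hy <;> rcases lt_or_gt_of_ne hz with hz | hz <;>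
  simp [hw, hx, hy, hz, sign_neg, sign_pos] at this ⊢ 

lemma sign_prod_le_one (x y : ℝ) : (SignType.sign x : ℝ) * SignType.sign y ≤ 1 := by
  rcases lt_trichotomy x 0 with h | h | h <;> rcases lt_trichotomy y 0 with h' | h' | h' <;>
  simp [h, h', sign_neg, sign_pos]

open Classical in
/-- The sum-of-squares inequality for one partition of the parameter line into cells. -/
lemma sum_cells_le {α β γ : Type*} [DecidableEq γ] (A : Finset α) (B : Finset β) (E : α → β → Prop)
    (T : α → β → ℝ) (ϑ : ℝ) (D : ℝ) (hD : 0 ≤ D) (q : ℝ → γ)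
    (H : ∀ a b c d, E a c → E a d → E b c → E b d → ϑ ≤ |T a c - T a d| → ϑ ≤ |T b c - T b d| →
      ϑ ≤ |T a c - T b c| → ϑ ≤ |T a d - T b d| →
      (T a c - T a d) * (T b c - T b d) * (T a c - T b c) * (T a d - T b d) < 0)
    (nA : ∀ a ∈ A, ∀ c ∈ B, E a c → (({b ∈ A | E b c ∧ |T a c - T b c| < ϑ}).card : ℝ) ≤ D)
    (nB : ∀ a ∈ A, ∀ c ∈ B, E a c → (({d ∈ B | E a d ∧ |T a c - T a d| < ϑ}).card : ℝ) ≤ D) :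
    ∑ a ∈ A, ∑ b ∈ A, ∑ c ∈ sepCommon B E T ϑ a b, ∑ d ∈ sepCommon B E T ϑ a b,
      (if q (T a c) = q (T a d) ∧ q (T b c) = q (T b d) then
        (SignType.sign (T a c - T b c) : ℝ) * SignType.sign (T a d - T b d) else 0)
      ≤ 2 * D * ∑ a ∈ A, (({c ∈ B | E a c}).card : ℝ) ^ 2
        + 2 * D * ∑ a ∈ A, ∑ b ∈ A, ((sepCommon B E T ϑ a b).card : ℝ) := by
  set s : α → β → β → ℝ := fun a c d =>
    if E a c ∧ E a d ∧ q (T a c) = q (T a d) ∧ ϑ ≤ |T a c - T a d| then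
      (SignType.sign (T a c - T a d) : ℝ) else 0 with hs
  set g : α → α → β → β → ℝ := fun a b c d =>
    if (E a c ∧ E b c ∧ ϑ ≤ |T a c - T b c|) ∧ (E a d ∧ E b d ∧ ϑ ≤ |T a d - T b d|) ∧
      (q (T a c) = q (T a d) ∧ q (T b c) = q (T b d)) then
      (SignType.sign (T a c - T b c) : ℝ) * SignType.sign (T a d - T b d) else 0 with hg
  set n1 : α → α → β → β → ℝ := fun a b c d =>
    if (E a c ∧ E a d) ∧ (E b c ∧ |T a c - T b c| < ϑ) then 1 else 0 with hn1
  set n2 : α → α → β → β → ℝ := fun a b c d =>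
    if (E a c ∧ E a d) ∧ (E b d ∧ |T a d - T b d| < ϑ) then 1 else 0 with hn2
  set n3 : α → α → β → β → ℝ := fun a b c d =>
    if (E a c ∧ E b c ∧ ϑ ≤ |T a c - T b c|) ∧ (E a d ∧ |T a c - T a d| < ϑ) then 1 else 0 with hn3
  set n4 : α → α → β → β → ℝ := fun a b c d =>
    if (E a c ∧ E b c ∧ ϑ ≤ |T a c - T b c|) ∧ (E b d ∧ |T b c - T b d| < ϑ) then 1 else 0 with hn4
  have hLHS : ∑ a ∈ A, ∑ b ∈ A, ∑ c ∈ sepCommon B E T ϑ a b, ∑ d ∈ sepCommon B E T ϑ a b,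
      (if q (T a c) = q (T a d) ∧ q (T b c) = q (T b d) then
        (SignType.sign (T a c - T b c) : ℝ) * SignType.sign (T a d - T b d) else 0)
      = ∑ a ∈ A, ∑ b ∈ A, ∑ c ∈ B, ∑ d ∈ B, g a b c d := by
    refine Finset.sum_congr rfl fun a _ => Finset.sum_congr rfl fun b _ => ?_
    unfold sepCommon
    rw [Finset.sum_filter]
    refine Finset.sum_congr rfl fun c _ => ?_
    split_ifs with hc
    · rw [Finset.sum_filter]
      refine Finset.sum_congr rfl fun d _ => ?_
      simp only [hg, hc, ite_and]
      simp
    · symm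
      apply Finset.sum_eq_zero
      intro d _
      simp only [hg, hc, false_and, if_false]
  have hsq : 0 ≤ ∑ a ∈ A, ∑ b ∈ A, ∑ c ∈ B, ∑ d ∈ B, s a c d * s b c d := by
    have : ∑ a ∈ A, ∑ b ∈ A, ∑ c ∈ B, ∑ d ∈ B, s a c d * s b c d
        = ∑ c ∈ B, ∑ d ∈ B, (∑ a ∈ A, s a c d) * (∑ b ∈ A, s b c d) := by
      simp_rw [Finset.sum_mul_sum]
      calc _ = ∑ a ∈ A, ∑ c ∈ B, ∑ b ∈ A, ∑ d ∈ B, s a c d * s b c d :=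
            Finset.sum_congr rfl fun a _ => Finset.sum_comm
        _ = ∑ c ∈ B, ∑ a ∈ A, ∑ b ∈ A, ∑ d ∈ B, s a c d * s b c d := Finset.sum_comm
        _ = ∑ c ∈ B, ∑ a ∈ A, ∑ d ∈ B, ∑ b ∈ A, s a c d * s b c d :=
            Finset.sum_congr rfl fun c _ => Finset.sum_congr rfl fun a _ => Finset.sum_comm
        _ = _ := Finset.sum_congr rfl fun c _ => Finset.sum_comm
    rw [this]
    exact Finset.sum_nonneg fun c _ => Finset.sum_nonneg fun d _ => mul_self_nonneg _
  have hpt : ∀ a b c d, g a b c d + s a c d * s b c d ≤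
      n1 a b c d + n2 a b c d + n3 a b c d + n4 a b c d := by
    intro a b c d
    have i1 : 0 ≤ n1 a b c d := by simp only [hn1]; split_ifs <;> norm_num
    have i2 : 0 ≤ n2 a b c d := by simp only [hn2]; split_ifs <;> norm_num
    have i3 : 0 ≤ n3 a b c d := by simp only [hn3]; split_ifs <;> norm_num
    have i4 : 0 ≤ n4 a b c d := by simp only [hn4]; split_ifs <;> norm_num
    by_cases hE : E a c ∧ E b c ∧ E a d ∧ E b d
    swap
    · have e1 : g a b c d = 0 := by simp only [hg]; rw [if_neg]; tauto
      have e2 : s a c d * s b c d = 0 := by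
        simp only [hs]
        by_cases h1 : E a c ∧ E a d
        · rw [mul_eq_zero]; right; rw [if_neg]; tauto
        · rw [mul_eq_zero]; left; rw [if_neg]; tauto
      linarith
    obtain ⟨h1, h2, h3, h4⟩ := hE
    by_cases hc : ϑ ≤ |T a c - T b c|
    swap
    · have e1 : g a b c d = 0 := by simp only [hg]; rw [if_neg]; tauto
      have e2 : s a c d * s b c d ≤ 1 := by
        simp only [hs]; split_ifs <;> simp [sign_prod_le_one]
      have e3 : n1 a b c d = 1 := by
        simp only [hn1]; rw [if_pos]; exact ⟨⟨h1, h3⟩, h2, not_le.1 hc⟩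
      linarith
    by_cases hd : ϑ ≤ |T a d - T b d|
    swap
    · have e1 : g a b c d = 0 := by simp only [hg]; rw [if_neg]; tauto
      have e2 : s a c d * s b c d ≤ 1 := by
        simp only [hs]; split_ifs <;> simp [sign_prod_le_one]
      have e3 : n2 a b c d = 1 := by
        simp only [hn2]; rw [if_pos]; exact ⟨⟨h1, h3⟩, h4, not_le.1 hd⟩
      linarith
    by_cases hq : q (T a c) = q (T a d) ∧ q (T b c) = q (T b d)
    swap
    · have e1 : g a b c d = 0 := by simp only [hg]; rw [if_neg]; tauto
      have e2 : s a c d * s b c d = 0 := by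
        simp only [hs]
        by_cases h1 : q (T a c) = q (T a d)
        · rw [mul_eq_zero]; right; rw [if_neg]; tauto
        · rw [mul_eq_zero]; left; rw [if_neg]; tauto
      linarith
    have eg : g a b c d = (SignType.sign (T a c - T b c) : ℝ) * SignType.sign (T a d - T b d) := by
      simp only [hg]; rw [if_pos]; tauto
    have eg1 := sign_prod_le_one (T a c - T b c) (T a d - T b d)
    by_cases ha : ϑ ≤ |T a c - T a d|
    swap
    · have e2 : s a c d * s b c d = 0 := by
        simp only [hs]; rw [mul_eq_zero]; left; rw [if_neg]; tauto
      have e3 : n3 a b c d = 1 := by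
        simp only [hn3]; rw [if_pos]; exact ⟨⟨h1, h2, hc⟩, h3, not_le.1 ha⟩
      linarith
    by_cases hb : ϑ ≤ |T b c - T b d|
    swap
    · have e2 : s a c d * s b c d = 0 := by
        simp only [hs]; rw [mul_eq_zero]; right; rw [if_neg]; tauto
      have e3 : n4 a b c d = 1 := by
        simp only [hn4]; rw [if_pos]; exact ⟨⟨h1, h2, hc⟩, h4, not_le.1 hb⟩
      linarith
    have e2 : s a c d * s b c d =
        (SignType.sign (T a c - T a d) : ℝ) * SignType.sign (T b c - T b d) := by
      simp only [hs]; rw [if_pos ⟨h1, h3, hq.1, ha⟩, if_pos ⟨h2, h4, hq.2, hb⟩]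
    rw [sign_mul_sign_of_prod_neg (H a b c d h1 h3 h2 h4 ha hb hc hd)] at e2
    linarith
  have b1 : ∑ a ∈ A, ∑ b ∈ A, ∑ c ∈ B, ∑ d ∈ B, n1 a b c d ≤
      D * ∑ a ∈ A, (({c ∈ B | E a c}).card : ℝ) ^ 2 := by
    rw [Finset.mul_sum]
    refine Finset.sum_le_sum fun a ha => ?_
    calc ∑ b ∈ A, ∑ c ∈ B, ∑ d ∈ B, n1 a b c d
        = ∑ c ∈ B, ∑ d ∈ B, ∑ b ∈ A, n1 a b c d := by
          rw [Finset.sum_comm]; exact Finset.sum_congr rfl fun c _ => Finset.sum_comm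
      _ ≤ ∑ c ∈ B, ∑ d ∈ B, (if E a c then (if E a d then D else 0) else 0) := by
          refine Finset.sum_le_sum fun c hc => Finset.sum_le_sum fun d hd => ?_
          split_ifs with h1 h2
          · refine le_trans (le_of_eq ?_) (nA a ha c hc h1)
            simp [hn1, h1, h2]
          · simp [hn1, h2]
          · simp [hn1, h1]
      _ = _ := by
          simp_rw [Finset.sum_ite_irrel, Finset.sum_const_zero]
          simp only [← Finset.sum_filter, Finset.sum_const, nsmul_eq_mul]
          ring
  have b2 : ∑ a ∈ A, ∑ b ∈ A, ∑ c ∈ B, ∑ d ∈ B, n2 a b c d ≤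
      D * ∑ a ∈ A, (({c ∈ B | E a c}).card : ℝ) ^ 2 := by
    rw [Finset.mul_sum]
    refine Finset.sum_le_sum fun a ha => ?_
    calc ∑ b ∈ A, ∑ c ∈ B, ∑ d ∈ B, n2 a b c d
        = ∑ c ∈ B, ∑ d ∈ B, ∑ b ∈ A, n2 a b c d := by
          rw [Finset.sum_comm]; exact Finset.sum_congr rfl fun c _ => Finset.sum_comm
      _ ≤ ∑ c ∈ B, ∑ d ∈ B, (if E a c then (if E a d then D else 0) else 0) := by
          refine Finset.sum_le_sum fun c hc => Finset.sum_le_sum fun d hd => ?_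
          split_ifs with h1 h2
          · refine le_trans (le_of_eq ?_) (nA a ha d hd h2)
            simp [hn2, h1, h2]
          · simp [hn2, h2]
          · simp [hn2, h1]
      _ = _ := by
          simp_rw [Finset.sum_ite_irrel, Finset.sum_const_zero]
          simp only [← Finset.sum_filter, Finset.sum_const, nsmul_eq_mul]
          ring
  have b3 : ∑ a ∈ A, ∑ b ∈ A, ∑ c ∈ B, ∑ d ∈ B, n3 a b c d ≤
      D * ∑ a ∈ A, ∑ b ∈ A, ((sepCommon B E T ϑ a b).card : ℝ) := by
    simp_rw [Finset.mul_sum]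
    refine Finset.sum_le_sum fun a ha => Finset.sum_le_sum fun b hb => ?_
    calc ∑ c ∈ B, ∑ d ∈ B, n3 a b c d
        ≤ ∑ c ∈ B, (if (E a c ∧ E b c ∧ ϑ ≤ |T a c - T b c|) then D else 0) := by
          refine Finset.sum_le_sum fun c hc => ?_
          split_ifs with h1
          · refine le_trans (le_of_eq ?_) (nB a ha c hc h1.1)
            simp [hn3, h1]
          · simp only [hn3, h1, false_and, if_false, Finset.sum_const_zero, le_refl]
      _ = _ := by
          simp only [← Finset.sum_filter, Finset.sum_const, nsmul_eq_mul, sepCommon]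
          ring
  have b4 : ∑ a ∈ A, ∑ b ∈ A, ∑ c ∈ B, ∑ d ∈ B, n4 a b c d ≤
      D * ∑ a ∈ A, ∑ b ∈ A, ((sepCommon B E T ϑ a b).card : ℝ) := by
    simp_rw [Finset.mul_sum]
    refine Finset.sum_le_sum fun a ha => Finset.sum_le_sum fun b hb => ?_
    calc ∑ c ∈ B, ∑ d ∈ B, n4 a b c d
        ≤ ∑ c ∈ B, (if (E a c ∧ E b c ∧ ϑ ≤ |T a c - T b c|) then D else 0) := by
          refine Finset.sum_le_sum fun c hc => ?_
          split_ifs with h1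
          · refine le_trans (le_of_eq ?_) (nB b hb c hc h1.2.1)
            simp [hn4, h1]
          · simp only [hn4, h1, false_and, if_false, Finset.sum_const_zero, le_refl]
      _ = _ := by
          simp only [← Finset.sum_filter, Finset.sum_const, nsmul_eq_mul, sepCommon]
          ring
  have htot : ∑ a ∈ A, ∑ b ∈ A, ∑ c ∈ B, ∑ d ∈ B, (g a b c d + s a c d * s b c d) ≤
      ∑ a ∈ A, ∑ b ∈ A, ∑ c ∈ B, ∑ d ∈ B,
        (n1 a b c d + n2 a b c d + n3 a b c d + n4 a b c d) :=
    Finset.sum_le_sum fun a _ => Finset.sum_le_sum fun b _ => Finset.sum_le_sum fun c _ =>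
      Finset.sum_le_sum fun d _ => hpt a b c d
  simp only [Finset.sum_add_distrib] at htot
  rw [hLHS]
  linarith

end MarcusTardos

lemma floor_two_mul_ediv (x : ℝ) : ⌊2 * x⌋ / 2 = ⌊x⌋ := by
  have h1 := Int.floor_le x
  have h2 := Int.lt_floor_add_one x
  have h3 : 2 * ⌊x⌋ ≤ ⌊2 * x⌋ := by
    rw [Int.le_floor]; push_cast; linarith
  have h4 : ⌊2 * x⌋ < 2 * ⌊x⌋ + 2 := by
    rw [Int.floor_lt]; push_cast; linarith
  omega

lemma eq_of_siblings {p₁ p₂ q₁ q₂ : ℤ} (hp : p₁ / 2 = p₂ / 2 ∧ p₁ ≠ p₂)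
    (hq : q₁ / 2 = q₂ / 2 ∧ q₁ ≠ q₂) (h : p₁ / 2 = q₁ / 2) (h' : p₁ % 2 = q₁ % 2) :
    p₁ = q₁ ∧ p₂ = q₂ := by
  omega

set_option maxHeartbeats 400000 in
open Classical in
/-- A signed count of pairs in common cells dominates the squared number of elements whose two
parameters get separated at the given dyadic level. -/
lemma card_level_sq_le {β : Type*} (C : Finset β) (u v : β → ℝ) (l : ℕ)
    (H2 : ∀ c₁ ∈ C, ∀ c₂ ∈ C, ∀ c₃ ∈ C, Disjoint (uIcc (u c₁) (v c₁)) (uIcc (u c₂) (v c₂)) →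
      Disjoint (uIcc (u c₁) (v c₁)) (uIcc (u c₃) (v c₃)) →
      Disjoint (uIcc (u c₂) (v c₂)) (uIcc (u c₃) (v c₃)) → False) :
    (({c ∈ C | ⌊2 ^ l * u c⌋ = ⌊2 ^ l * v c⌋ ∧
        ⌊2 ^ (l + 1) * u c⌋ ≠ ⌊2 ^ (l + 1) * v c⌋}).card : ℝ) ^ 2 ≤
      4 * ∑ c ∈ C, ∑ d ∈ C, (if ⌊2 ^ (l + 1) * u c⌋ = ⌊2 ^ (l + 1) * u d⌋ ∧
        ⌊2 ^ (l + 1) * v c⌋ = ⌊2 ^ (l + 1) * v d⌋ then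
          (SignType.sign (u c - v c) : ℝ) * SignType.sign (u d - v d) else 0) := by
  set P : β → ℤ × ℤ := fun c => (⌊2 ^ (l + 1) * u c⌋, ⌊2 ^ (l + 1) * v c⌋) with hP
  set C' := {c ∈ C | ⌊2 ^ l * u c⌋ = ⌊2 ^ l * v c⌋ ∧
        ⌊2 ^ (l + 1) * u c⌋ ≠ ⌊2 ^ (l + 1) * v c⌋} with hC'
  have par : ∀ x : ℝ, ⌊2 ^ (l + 1) * x⌋ / 2 = ⌊2 ^ l * x⌋ := by
    intro x
    rw [← floor_two_mul_ediv (2 ^ l * x), show 2 ^ (l + 1) * x = 2 * (2 ^ l * x) by ring]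
  have hsum : ∑ c ∈ C, ∑ d ∈ C, (if ⌊2 ^ (l + 1) * u c⌋ = ⌊2 ^ (l + 1) * u d⌋ ∧
        ⌊2 ^ (l + 1) * v c⌋ = ⌊2 ^ (l + 1) * v d⌋ then
          (SignType.sign (u c - v c) : ℝ) * SignType.sign (u d - v d) else 0)
      = ∑ z ∈ C.image P, (∑ c ∈ C with P c = z, (SignType.sign (u c - v c) : ℝ)) ^ 2 := by
    have e1 : ∀ z, (∑ c ∈ C with P c = z, (SignType.sign (u c - v c) : ℝ)) ^ 2 =
        ∑ c ∈ C with P c = z, ∑ d ∈ C with P d = P c,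
          (SignType.sign (u c - v c) : ℝ) * SignType.sign (u d - v d) := by
      intro z
      rw [sq, Finset.sum_mul_sum]
      refine Finset.sum_congr rfl fun c hc => ?_
      rw [(Finset.mem_filter.1 hc).2]
    simp_rw [e1]
    rw [Finset.sum_fiberwise_of_maps_to (fun c hc => Finset.mem_image_of_mem P hc)]
    refine Finset.sum_congr rfl fun c _ => ?_
    rw [Finset.sum_filter]
    refine Finset.sum_congr rfl fun d _ => ?_
    congr 1
    simp only [hP, Prod.mk.injEq, eq_iff_iff]
    constructor <;> rintro ⟨h1, h2⟩ <;> exact ⟨h1.symm, h2.symm⟩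
  rw [hsum]
  have hsgn : ∀ c d, P c = P d → ⌊2 ^ (l + 1) * u d⌋ ≠ ⌊2 ^ (l + 1) * v d⌋ →
      (SignType.sign (u c - v c) : ℝ) = if (P d).1 < (P d).2 then -1 else 1 := by
    intro c d h hne
    rw [← h]
    have h1 : (P c).1 ≠ (P c).2 := by rw [h]; exact hne
    have pos : (0:ℝ) < 2 ^ (l + 1) := by positivity
    split_ifs with hlt
    · have : u c < v c := by
        by_contra hcon
        have := Int.floor_le_floor (mul_le_mul_of_nonneg_left (not_lt.1 hcon) pos.le)
        exact absurd hlt (not_lt.2 this)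
      simp [sign_neg (sub_neg.2 this)]
    · have : v c < u c := by
        by_contra hcon
        have := Int.floor_le_floor (mul_le_mul_of_nonneg_left (not_lt.1 hcon) pos.le)
        exact h1 (le_antisymm this (not_lt.1 hlt))
      simp [sign_pos (sub_pos.2 this)]
  have hcell : ∀ z ∈ C'.image P, (({c ∈ C' | P c = z}).card : ℝ) ^ 2 ≤
      (∑ c ∈ C with P c = z, (SignType.sign (u c - v c) : ℝ)) ^ 2 := by
    intro z hz
    obtain ⟨d, hd, rfl⟩ := Finset.mem_image.1 hz
    have hd' := (Finset.mem_filter.1 hd).2.2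
    have e : ∑ c ∈ C with P c = P d, (SignType.sign (u c - v c) : ℝ) =
        ∑ c ∈ C with P c = P d, if (P d).1 < (P d).2 then (-1 : ℝ) else 1 :=
      Finset.sum_congr rfl fun c hc => hsgn c d (Finset.mem_filter.1 hc).2 hd'
    rw [e, Finset.sum_const, nsmul_eq_mul, mul_pow]
    have : ((if (P d).1 < (P d).2 then (-1 : ℝ) else 1)) ^ 2 = 1 := by split_ifs <;> norm_num
    rw [this, mul_one]
    have : ({c ∈ C' | P c = P d}).card ≤ ({c ∈ C | P c = P d}).card :=
      Finset.card_le_card (Finset.filter_subset_filter _ (Finset.filter_subset _ _))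
    gcongr
  have hdisj : ∀ c ∈ C', ∀ d ∈ C', ⌊2 ^ l * u c⌋ ≠ ⌊2 ^ l * u d⌋ →
      Disjoint (uIcc (u c) (v c)) (uIcc (u d) (v d)) := by
    intro c hc d hd hne
    have key : ∀ c ∈ C', ∀ x ∈ uIcc (u c) (v c), ⌊2 ^ l * x⌋ = ⌊2 ^ l * u c⌋ := by
      intro c hc x hx
      have h := (Finset.mem_filter.1 hc).2.1
      have pos : (0:ℝ) < 2 ^ l := by positivity
      have mono : ∀ {y z : ℝ}, y ≤ z → ⌊2 ^ l * y⌋ ≤ ⌊2 ^ l * z⌋ := fun h =>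
        Int.floor_le_floor (mul_le_mul_of_nonneg_left h pos.le)
      rcases mem_uIcc.1 hx with h1 | h1
      · have := mono h1.1; have := mono h1.2; omega
      · have := mono h1.1; have := mono h1.2; omega
    rw [Set.disjoint_left]
    intro x hx hx'
    exact hne ((key c hc x hx).symm.trans (key d hd x hx'))
  have hpar : (C'.image fun c => ⌊2 ^ l * u c⌋).card ≤ 2 := by
    by_contra hcon
    obtain ⟨x, y, z, hx, hy, hz, hxy, hxz, hyz⟩ := Finset.two_lt_card_iff.1 (not_le.1 hcon)
    simp only [Finset.mem_image] at hx hy hz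
    obtain ⟨c₁, h1, rfl⟩ := hx
    obtain ⟨c₂, h2, rfl⟩ := hy
    obtain ⟨c₃, h3, rfl⟩ := hz
    exact H2 c₁ (Finset.mem_filter.1 h1).1 c₂ (Finset.mem_filter.1 h2).1 c₃
      (Finset.mem_filter.1 h3).1 (hdisj _ h1 _ h2 hxy) (hdisj _ h1 _ h3 hxz) (hdisj _ h2 _ h3 hyz)
  have hcard : (C'.image P).card ≤ 4 := by
    have : (C'.image P).card ≤
        ((C'.image fun c => ⌊2 ^ l * u c⌋) ×ˢ ({0, 1} : Finset ℤ)).card := by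
      refine Finset.card_le_card_of_injOn (fun z => (z.1 / 2, z.1 % 2)) ?_ ?_
      · intro z hz
        obtain ⟨c, hc, rfl⟩ := Finset.mem_image.1 (Finset.mem_coe.1 hz)
        simp only [hP, Finset.coe_product, Set.mem_prod, Finset.mem_coe]
        refine ⟨Finset.mem_image.2 ⟨c, hc, (par _).symm⟩, ?_⟩
        have := Int.emod_two_eq_zero_or_one ⌊2 ^ (l + 1) * u c⌋
        simpa using this
      · intro z hz w hw hzw
        obtain ⟨c, hc, rfl⟩ := Finset.mem_image.1 (Finset.mem_coe.1 hz)
        obtain ⟨d, hd, rfl⟩ := Finset.mem_image.1 (Finset.mem_coe.1 hw)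
        have h1 := (Finset.mem_filter.1 hc).2
        have h2 := (Finset.mem_filter.1 hd).2
        rw [← par (u c), ← par (v c)] at h1
        rw [← par (u d), ← par (v d)] at h2
        have e1 : ⌊2 ^ (l + 1) * u c⌋ / 2 = ⌊2 ^ (l + 1) * u d⌋ / 2 := congrArg Prod.fst hzw
        have e2 : ⌊2 ^ (l + 1) * u c⌋ % 2 = ⌊2 ^ (l + 1) * u d⌋ % 2 := congrArg Prod.snd hzw
        obtain ⟨f1, f2⟩ := eq_of_siblings h1 h2 e1 e2
        exact Prod.ext f1 f2
    refine this.trans ?_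
    rw [Finset.card_product]
    have : ({0, 1} : Finset ℤ).card = 2 := by simp
    rw [this]; omega
  have hsub : ∑ z ∈ C'.image P, (({c ∈ C' | P c = z}).card : ℝ) ^ 2 ≤
      ∑ z ∈ C.image P, (∑ c ∈ C with P c = z, (SignType.sign (u c - v c) : ℝ)) ^ 2 :=
    (Finset.sum_le_sum hcell).trans (Finset.sum_le_sum_of_subset_of_nonneg
      (Finset.image_subset_image (Finset.filter_subset _ _)) fun _ _ _ => sq_nonneg _)
  have hC'card : (C'.card : ℝ) = ∑ z ∈ C'.image P, (({c ∈ C' | P c = z}).card : ℝ) := by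
    rw [Finset.card_eq_sum_card_image P C']; push_cast; rfl
  rw [hC'card]
  refine (sq_sum_le_card_mul_sum_sq).trans ?_
  have h0 : 0 ≤ ∑ z ∈ C'.image P, (({c ∈ C' | P c = z}).card : ℝ) ^ 2 :=
    Finset.sum_nonneg fun _ _ => sq_nonneg _
  calc ((C'.image P).card : ℝ) * ∑ z ∈ C'.image P, (({c ∈ C' | P c = z}).card : ℝ) ^ 2
      ≤ 4 * ∑ z ∈ C'.image P, (({c ∈ C' | P c = z}).card : ℝ) ^ 2 := by
        refine mul_le_mul_of_nonneg_right ?_ h0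
        rw [← Nat.cast_ofNat (R := ℝ) (n := 4)]
        exact Nat.cast_le.2 hcard
    _ ≤ _ := mul_le_mul_of_nonneg_left hsub (by norm_num)

open Classical in
lemma card_sq_le_sum_levels {β : Type*} (C : Finset β) (u v : β → ℝ) (ϑ : ℝ) (J : ℕ)
    (hJ : 1 ≤ 2 ^ J * ϑ) (hu : ∀ c ∈ C, u c ∈ Ico (0 : ℝ) 1) (hv : ∀ c ∈ C, v c ∈ Ico (0 : ℝ) 1)
    (hsep : ∀ c ∈ C, ϑ ≤ |u c - v c|)
    (H2 : ∀ c₁ ∈ C, ∀ c₂ ∈ C, ∀ c₃ ∈ C, Disjoint (uIcc (u c₁) (v c₁)) (uIcc (u c₂) (v c₂)) →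
      Disjoint (uIcc (u c₁) (v c₁)) (uIcc (u c₃) (v c₃)) →
      Disjoint (uIcc (u c₂) (v c₂)) (uIcc (u c₃) (v c₃)) → False) :
    (C.card : ℝ) ^ 2 ≤ 4 * J * ∑ l ∈ Finset.range J,
      ∑ c ∈ C, ∑ d ∈ C, (if ⌊2 ^ (l + 1) * u c⌋ = ⌊2 ^ (l + 1) * u d⌋ ∧
        ⌊2 ^ (l + 1) * v c⌋ = ⌊2 ^ (l + 1) * v d⌋ then
          (SignType.sign (u c - v c) : ℝ) * SignType.sign (u d - v d) else 0) := by
  set Cl : ℕ → Finset β := fun l => {c ∈ C | ⌊2 ^ l * u c⌋ = ⌊2 ^ l * v c⌋ ∧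
        ⌊2 ^ (l + 1) * u c⌋ ≠ ⌊2 ^ (l + 1) * v c⌋} with hCl
  have hcov : C ⊆ (Finset.range J).biUnion Cl := by
    intro c hc
    have hex : ∃ l, ⌊2 ^ l * u c⌋ ≠ ⌊2 ^ l * v c⌋ := by
      refine ⟨J, fun h => ?_⟩
      have := Int.abs_sub_lt_one_of_floor_eq_floor h
      rw [← mul_sub, abs_mul, abs_of_pos (by positivity)] at this
      have := mul_le_mul_of_nonneg_left (hsep c hc) (show (0:ℝ) ≤ 2 ^ J by positivity)
      linarith
    have hJ' : ⌊2 ^ J * u c⌋ ≠ ⌊2 ^ J * v c⌋ := by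
      intro h
      have := Int.abs_sub_lt_one_of_floor_eq_floor h
      rw [← mul_sub, abs_mul, abs_of_pos (by positivity)] at this
      have := mul_le_mul_of_nonneg_left (hsep c hc) (show (0:ℝ) ≤ 2 ^ J by positivity)
      linarith
    have hle := Nat.find_min' hex hJ'
    have hsp := Nat.find_spec hex
    have hmin : ∀ m < Nat.find hex, _ := fun m hm => Nat.find_min hex hm
    set L := Nat.find hex
    have hL : L ≠ 0 := by
      intro h0
      rw [h0] at hsp
      apply hsp
      have h1 : ⌊u c⌋ = 0 := Int.floor_eq_zero_iff.2 (hu c hc)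
      have h2 : ⌊v c⌋ = 0 := Int.floor_eq_zero_iff.2 (hv c hc)
      simp [h1, h2]
    obtain ⟨l, hl⟩ := Nat.exists_eq_succ_of_ne_zero hL
    rw [Finset.mem_biUnion]
    refine ⟨l, Finset.mem_range.2 (by omega), Finset.mem_filter.2 ⟨hc, ?_, ?_⟩⟩
    · exact not_not.1 (hmin l (by omega))
    · rw [hl] at hsp; exact hsp
  have h1 : (C.card : ℝ) ≤ ∑ l ∈ Finset.range J, ((Cl l).card : ℝ) := by
    exact_mod_cast (Finset.card_le_card hcov).trans Finset.card_biUnion_le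
  calc (C.card : ℝ) ^ 2 ≤ (∑ l ∈ Finset.range J, ((Cl l).card : ℝ)) ^ 2 := by gcongr
    _ ≤ J * ∑ l ∈ Finset.range J, ((Cl l).card : ℝ) ^ 2 := by
        have := sq_sum_le_card_mul_sum_sq (s := Finset.range J) (f := fun l => ((Cl l).card : ℝ))
        simpa using this
    _ ≤ J * ∑ l ∈ Finset.range J, (4 * ∑ c ∈ C, ∑ d ∈ C,
        (if ⌊2 ^ (l + 1) * u c⌋ = ⌊2 ^ (l + 1) * u d⌋ ∧
        ⌊2 ^ (l + 1) * v c⌋ = ⌊2 ^ (l + 1) * v d⌋ then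
          (SignType.sign (u c - v c) : ℝ) * SignType.sign (u d - v d) else 0)) := by
        gcongr with l hl
        exact card_level_sq_le C u v l H2
    _ = _ := by rw [← Finset.mul_sum]; ring

open Classical in
lemma sum_sq_degree_le {α β : Type*} (A : Finset α) (B : Finset β) (E : α → β → Prop)
    (T : α → β → ℝ) (ϑ D n X : ℝ) (J : ℕ) (hD : 0 ≤ D) (hJ : 1 ≤ 2 ^ J * ϑ)
    (hT : ∀ a c, E a c → T a c ∈ Ico (0 : ℝ) 1)
    (H : ∀ a b c d, E a c → E a d → E b c → E b d → ϑ ≤ |T a c - T a d| → ϑ ≤ |T b c - T b d| →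
      ϑ ≤ |T a c - T b c| → ϑ ≤ |T a d - T b d| →
      (T a c - T a d) * (T b c - T b d) * (T a c - T b c) * (T a d - T b d) < 0)
    (H2 : ∀ a b c₁ c₂ c₃, E a c₁ → E b c₁ → ϑ ≤ |T a c₁ - T b c₁| →
      E a c₂ → E b c₂ → ϑ ≤ |T a c₂ - T b c₂| → E a c₃ → E b c₃ → ϑ ≤ |T a c₃ - T b c₃| →
      Disjoint (uIcc (T a c₁) (T b c₁)) (uIcc (T a c₂) (T b c₂)) →
      Disjoint (uIcc (T a c₁) (T b c₁)) (uIcc (T a c₃) (T b c₃)) →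
      Disjoint (uIcc (T a c₂) (T b c₂)) (uIcc (T a c₃) (T b c₃)) → False)
    (nA : ∀ a ∈ A, ∀ c ∈ B, E a c → (({b ∈ A | E b c ∧ |T a c - T b c| < ϑ}).card : ℝ) ≤ D)
    (nB : ∀ a ∈ A, ∀ c ∈ B, E a c → (({d ∈ B | E a d ∧ |T a c - T a d| < ϑ}).card : ℝ) ≤ D)
    (hn : (A.card : ℝ) ≤ n) (hXA : ∑ a ∈ A, (({c ∈ B | E a c}).card : ℝ) ^ 2 ≤ X)
    (hXB : ∑ c ∈ B, (({a ∈ A | E a c}).card : ℝ) ^ 2 ≤ X) :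
    ∑ c ∈ B, (({a ∈ A | E a c}).card : ℝ) ^ 2 ≤
      4 * n * J * √(D * X) + (∑ c ∈ B, (({a ∈ A | E a c}).card : ℝ)) * D := by
  set P := ∑ a ∈ A, ∑ b ∈ A, ((sepCommon B E T ϑ a b).card : ℝ) with hP
  have hn0 : 0 ≤ n := (Nat.cast_nonneg _).trans hn
  have hX0 : 0 ≤ X := (Finset.sum_nonneg fun _ _ => sq_nonneg _).trans hXA
  have hP0 : 0 ≤ P := Finset.sum_nonneg fun _ _ => Finset.sum_nonneg fun _ _ => Nat.cast_nonneg _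
  have heB : ∑ c ∈ B, (({a ∈ A | E a c}).card : ℝ) ^ 2 =
      ∑ a ∈ A, ∑ b ∈ A, (({c ∈ B | E a c ∧ E b c}).card : ℝ) := by
    have : ∀ a b, (({c ∈ B | E a c ∧ E b c}).card : ℝ) =
        ∑ c ∈ B, (if E a c then 1 else 0) * (if E b c then 1 else 0) := by
      intro a b
      rw [Finset.card_filter]; push_cast
      refine Finset.sum_congr rfl fun c _ => ?_
      by_cases h1 : E a c <;> by_cases h2 : E b c <;> simp [h1, h2]
    simp_rw [this]
    have : ∀ c, (({a ∈ A | E a c}).card : ℝ) = ∑ a ∈ A, (if E a c then 1 else 0) := by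
      intro c; rw [Finset.card_filter]; push_cast; rfl
    simp_rw [this, sq, Finset.sum_mul_sum]
    rw [Finset.sum_comm]
    exact Finset.sum_congr rfl fun a _ => Finset.sum_comm
  have hPX : P ≤ X := by
    refine le_trans ?_ (heB ▸ hXB)
    refine Finset.sum_le_sum fun a _ => Finset.sum_le_sum fun b _ => ?_
    refine Nat.cast_le.2 (Finset.card_le_card ?_)
    intro c hc
    have := Finset.mem_filter.1 hc
    exact Finset.mem_filter.2 ⟨this.1, this.2.1, this.2.2.1⟩
  have hcomm : ∀ f : ℕ → α → α → ℝ, ∑ a ∈ A, ∑ b ∈ A, ∑ l ∈ Finset.range J, f l a b =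
      ∑ l ∈ Finset.range J, ∑ a ∈ A, ∑ b ∈ A, f l a b := fun f => by
    calc _ = ∑ a ∈ A, ∑ l ∈ Finset.range J, ∑ b ∈ A, f l a b :=
          Finset.sum_congr rfl fun a _ => Finset.sum_comm
      _ = _ := Finset.sum_comm
  have hm2 : ∑ a ∈ A, ∑ b ∈ A, ((sepCommon B E T ϑ a b).card : ℝ) ^ 2 ≤
      16 * J ^ 2 * (D * X) := by
    calc ∑ a ∈ A, ∑ b ∈ A, ((sepCommon B E T ϑ a b).card : ℝ) ^ 2
        ≤ ∑ a ∈ A, ∑ b ∈ A, (4 * J * ∑ l ∈ Finset.range J,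
            ∑ c ∈ sepCommon B E T ϑ a b, ∑ d ∈ sepCommon B E T ϑ a b,
            (if ⌊2 ^ (l + 1) * T a c⌋ = ⌊2 ^ (l + 1) * T a d⌋ ∧
              ⌊2 ^ (l + 1) * T b c⌋ = ⌊2 ^ (l + 1) * T b d⌋ then
              (SignType.sign (T a c - T b c) : ℝ) * SignType.sign (T a d - T b d) else 0)) := by
          refine Finset.sum_le_sum fun a _ => Finset.sum_le_sum fun b _ => ?_
          have hmem : ∀ c ∈ sepCommon B E T ϑ a b, E a c ∧ E b c ∧ ϑ ≤ |T a c - T b c| :=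
            fun c hc => (Finset.mem_filter.1 hc).2
          refine card_sq_le_sum_levels _ (T a) (T b) ϑ J hJ
            (fun c hc => hT a c (hmem c hc).1) (fun c hc => hT b c (hmem c hc).2.1)
            (fun c hc => (hmem c hc).2.2) ?_
          intro c₁ h1 c₂ h2 c₃ h3 d1 d2 d3
          have h1 := hmem c₁ h1
          have h2 := hmem c₂ h2
          have h3 := hmem c₃ h3
          exact H2 a b c₁ c₂ c₃ h1.1 h1.2.1 h1.2.2 h2.1 h2.2.1 h2.2.2 h3.1 h3.2.1 h3.2.2 d1 d2 d3
      _ = 4 * J * ∑ l ∈ Finset.range J, ∑ a ∈ A, ∑ b ∈ A, 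
            ∑ c ∈ sepCommon B E T ϑ a b, ∑ d ∈ sepCommon B E T ϑ a b,
            (if ⌊2 ^ (l + 1) * T a c⌋ = ⌊2 ^ (l + 1) * T a d⌋ ∧
              ⌊2 ^ (l + 1) * T b c⌋ = ⌊2 ^ (l + 1) * T b d⌋ then
              (SignType.sign (T a c - T b c) : ℝ) * SignType.sign (T a d - T b d) else 0) := by
          simp_rw [← Finset.mul_sum]
          congr 1
          exact hcomm _
      _ ≤ 4 * J * ∑ l ∈ Finset.range J, (4 * D * X) := by
          refine mul_le_mul_of_nonneg_left (Finset.sum_le_sum fun l hl => ?_) (by positivity)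
          refine (sum_cells_le A B E T ϑ D hD (fun x => ⌊2 ^ (l + 1) * x⌋) H nA nB).trans ?_
          have hD2 : 0 ≤ 2 * D := mul_nonneg zero_le_two hD
          refine (add_le_add (mul_le_mul_of_nonneg_left hXA hD2)
            (mul_le_mul_of_nonneg_left hPX hD2)).trans (le_of_eq ?_)
          ring
      _ = _ := by rw [Finset.sum_const, Finset.card_range, nsmul_eq_mul]; ring
  have hPsq : P ^ 2 ≤ (4 * n * J) ^ 2 * (D * X) := by
    have h1 : P ^ 2 ≤ (A ×ˢ A).card * ∑ p ∈ A ×ˢ A, ((sepCommon B E T ϑ p.1 p.2).card : ℝ) ^ 2 := by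
      rw [hP, ← Finset.sum_product']
      exact sq_sum_le_card_mul_sum_sq
    rw [Finset.sum_product, Finset.card_product] at h1
    push_cast at h1
    calc P ^ 2 ≤ _ := h1
      _ ≤ (n * n) * (16 * J ^ 2 * (D * X)) :=
        mul_le_mul (mul_le_mul hn hn (Nat.cast_nonneg _) hn0) hm2
          (Finset.sum_nonneg fun _ _ => Finset.sum_nonneg fun _ _ => sq_nonneg _)
          (mul_nonneg hn0 hn0)
      _ = _ := by ring
  have hPle : P ≤ 4 * n * J * √(D * X) := by
    have : √((4 * n * J) ^ 2 * (D * X)) = 4 * n * J * √(D * X) := by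
      rw [Real.sqrt_mul (by positivity), Real.sqrt_sq (by positivity)]
    rw [← this]
    exact Real.le_sqrt_of_sq_le hPsq
  have hnear : ∑ a ∈ A, ∑ b ∈ A, (({c ∈ B | E a c ∧ E b c}).card : ℝ) ≤
      P + ∑ a ∈ A, ∑ b ∈ A, (({c ∈ B | E a c ∧ E b c ∧ |T a c - T b c| < ϑ}).card : ℝ) := by
    rw [hP, ← Finset.sum_add_distrib]
    simp_rw [← Finset.sum_add_distrib]
    refine Finset.sum_le_sum fun a _ => Finset.sum_le_sum fun b _ => ?_
    rw [← Nat.cast_add]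
    refine Nat.cast_le.2 ((Finset.card_le_card ?_).trans (Finset.card_union_le _ _))
    intro c hc
    rw [Finset.mem_union]
    have := Finset.mem_filter.1 hc
    rcases le_or_gt ϑ |T a c - T b c| with h | h
    · exact Or.inl (Finset.mem_filter.2 ⟨this.1, this.2.1, this.2.2, h⟩)
    · exact Or.inr (Finset.mem_filter.2 ⟨this.1, this.2.1, this.2.2, h⟩)
  have hnear2 : ∑ a ∈ A, ∑ b ∈ A, (({c ∈ B | E a c ∧ E b c ∧ |T a c - T b c| < ϑ}).card : ℝ) ≤
      (∑ c ∈ B, (({a ∈ A | E a c}).card : ℝ)) * D := by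
    calc _ = ∑ a ∈ A, ∑ c ∈ B, ∑ b ∈ A,
          (if E a c ∧ E b c ∧ |T a c - T b c| < ϑ then (1 : ℝ) else 0) := by
          refine Finset.sum_congr rfl fun a _ => ?_
          rw [Finset.sum_comm]
          refine Finset.sum_congr rfl fun b _ => ?_
          rw [Finset.card_filter]; push_cast; rfl
      _ ≤ ∑ a ∈ A, ∑ c ∈ B, (if E a c then D else 0) := by
          refine Finset.sum_le_sum fun a ha => Finset.sum_le_sum fun c hc => ?_
          split_ifs with h
          · refine le_trans (le_of_eq ?_) (nA a ha c hc h)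
            simp [h]
          · simp [h]
      _ = ∑ c ∈ B, ∑ a ∈ A, (if E a c then D else 0) := Finset.sum_comm
      _ = _ := by
          rw [Finset.sum_mul]
          refine Finset.sum_congr rfl fun c _ => ?_
          rw [← Finset.sum_filter, Finset.sum_const, nsmul_eq_mul]
  rw [heB]
  linarith

lemma le_of_self_bounding {N X D n J : ℝ} (hD : 0 ≤ D) (hDn : D ≤ n) (hJ' : 1 ≤ J) (hX0 : 0 ≤ X)
    (hXle : X ≤ 4 * n * J * √(D * X) + N * D) (hN2 : N ^ 2 ≤ n * X) :
    N ≤ 5 * J * n * √(n * D) := by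
  have hn0 : 0 ≤ n := hD.trans hDn
  have hNle : N ≤ √n * √X := by
    rw [← Real.sqrt_mul hn0]; exact Real.le_sqrt_of_sq_le hN2
  have h1 : √X ≤ 5 * n * J * √D := by
    by_cases hXz : √X = 0
    · rw [hXz]; positivity
    have hpos : 0 < √X := lt_of_le_of_ne (Real.sqrt_nonneg _) (Ne.symm hXz)
    have h2 : √X * √X ≤ (5 * n * J * √D) * √X := by
      have e1 : √n * D ≤ n * J * √D := by
        have : √D ≤ √n := Real.sqrt_le_sqrt hDn
        calc √n * D = √n * √D * √D := by rw [mul_assoc, Real.mul_self_sqrt hD]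
          _ ≤ √n * √n * √D := by gcongr
          _ = n * 1 * √D := by rw [Real.mul_self_sqrt hn0, mul_one]
          _ ≤ n * J * √D := by gcongr
      calc √X * √X = X := Real.mul_self_sqrt hX0
        _ ≤ 4 * n * J * √(D * X) + N * D := hXle
        _ ≤ 4 * n * J * (√D * √X) + √n * √X * D := by
          rw [Real.sqrt_mul hD]
          exact add_le_add le_rfl (mul_le_mul_of_nonneg_right hNle hD)
        _ = 4 * n * J * (√D * √X) + (√n * D) * √X := by ring
        _ ≤ 4 * n * J * (√D * √X) + (n * J * √D) * √X := by gcongr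
        _ = _ := by ring
    exact le_of_mul_le_mul_right h2 hpos
  calc N ≤ √n * √X := hNle
    _ ≤ √n * (5 * n * J * √D) := by gcongr
    _ = _ := by rw [Real.sqrt_mul hn0]; ring

open Classical in
/-- A quantitative Marcus–Tardos type bound for the number of edges of a tangency graph. -/
theorem card_edges_le {α β : Type*} (A : Finset α) (B : Finset β) (E : α → β → Prop)
    (T : α → β → ℝ) (ϑ D n : ℝ) (J : ℕ) (hD : 0 ≤ D) (hDn : D ≤ n) (hJ : 1 ≤ 2 ^ J * ϑ)
    (hJ1 : 1 ≤ J)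
    (hT : ∀ a c, E a c → T a c ∈ Ico (0 : ℝ) 1)
    (H : ∀ a b c d, E a c → E a d → E b c → E b d → ϑ ≤ |T a c - T a d| → ϑ ≤ |T b c - T b d| →
      ϑ ≤ |T a c - T b c| → ϑ ≤ |T a d - T b d| →
      (T a c - T a d) * (T b c - T b d) * (T a c - T b c) * (T a d - T b d) < 0)
    (H2 : ∀ a b c₁ c₂ c₃, E a c₁ → E b c₁ → ϑ ≤ |T a c₁ - T b c₁| →
      E a c₂ → E b c₂ → ϑ ≤ |T a c₂ - T b c₂| → E a c₃ → E b c₃ → ϑ ≤ |T a c₃ - T b c₃| →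
      Disjoint (uIcc (T a c₁) (T b c₁)) (uIcc (T a c₂) (T b c₂)) →
      Disjoint (uIcc (T a c₁) (T b c₁)) (uIcc (T a c₃) (T b c₃)) →
      Disjoint (uIcc (T a c₂) (T b c₂)) (uIcc (T a c₃) (T b c₃)) → False)
    (H2' : ∀ a b c₁ c₂ c₃, E c₁ a → E c₁ b → ϑ ≤ |T c₁ a - T c₁ b| →
      E c₂ a → E c₂ b → ϑ ≤ |T c₂ a - T c₂ b| → E c₃ a → E c₃ b → ϑ ≤ |T c₃ a - T c₃ b| →
      Disjoint (uIcc (T c₁ a) (T c₁ b)) (uIcc (T c₂ a) (T c₂ b)) →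
      Disjoint (uIcc (T c₁ a) (T c₁ b)) (uIcc (T c₃ a) (T c₃ b)) →
      Disjoint (uIcc (T c₂ a) (T c₂ b)) (uIcc (T c₃ a) (T c₃ b)) → False)
    (nA : ∀ a ∈ A, ∀ c ∈ B, E a c → (({b ∈ A | E b c ∧ |T a c - T b c| < ϑ}).card : ℝ) ≤ D)
    (nB : ∀ a ∈ A, ∀ c ∈ B, E a c → (({d ∈ B | E a d ∧ |T a c - T a d| < ϑ}).card : ℝ) ≤ D)
    (hnA : (A.card : ℝ) ≤ n) (hnB : (B.card : ℝ) ≤ n) :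
    ∑ a ∈ A, (({c ∈ B | E a c}).card : ℝ) ≤ 5 * J * n * √(n * D) := by
  set N := ∑ a ∈ A, (({c ∈ B | E a c}).card : ℝ) with hN
  have hN' : N = ∑ c ∈ B, (({a ∈ A | E a c}).card : ℝ) := by
    have := Finset.sum_card_bipartiteAbove_eq_sum_card_bipartiteBelow (s := A) (t := B) E
    rw [hN]
    exact_mod_cast this
  set X := max (∑ a ∈ A, (({c ∈ B | E a c}).card : ℝ) ^ 2)
    (∑ c ∈ B, (({a ∈ A | E a c}).card : ℝ) ^ 2) with hX
  have hB := sum_sq_degree_le A B E T ϑ D n X J hD hJ hT H H2 nA nB hnA (le_max_left _ _)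
    (le_max_right _ _)
  have hA := sum_sq_degree_le B A (fun c a => E a c) (fun c a => T a c) ϑ D n X J hD hJ
    (fun c a h => hT a c h)
    (fun c d a b h1 h2 h3 h4 h5 h6 h7 h8 => by
      have := H a b c d h1 h3 h2 h4 h7 h8 h5 h6
      linarith)
    H2' (fun c hc a ha h => nB a ha c hc h) (fun c hc a ha h => nA a ha c hc h) hnB
    (le_max_right _ _) (le_max_left _ _)
  rw [← hN'] at hB
  rw [← hN] at hA
  have hn0 : 0 ≤ n := hD.trans hDn
  have hX0 : 0 ≤ X := (Finset.sum_nonneg fun _ _ => sq_nonneg _).trans (le_max_left _ _)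
  have hXle : X ≤ 4 * n * J * √(D * X) + N * D := max_le hA hB
  have hN2 : N ^ 2 ≤ n * X := by
    calc N ^ 2 ≤ A.card * ∑ a ∈ A, (({c ∈ B | E a c}).card : ℝ) ^ 2 := sq_sum_le_card_mul_sum_sq
      _ ≤ n * X := mul_le_mul hnA (le_max_left _ _) (Finset.sum_nonneg fun _ _ => sq_nonneg _) hn0
  exact le_of_self_bounding hD hDn (by exact_mod_cast hJ1) hX0 hXle hN2

lemma quad_sign_configuration {f₀ f₁ f₂ h₀ h₁ h₂ w x y z : ℝ}
    (fw : 0 < f₀ + f₁ * w + f₂ * w ^ 2) (fx : f₀ + f₁ * x + f₂ * x ^ 2 < 0)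
    (fy : 0 < f₀ + f₁ * y + f₂ * y ^ 2) (fz : f₀ + f₁ * z + f₂ * z ^ 2 < 0)
    (hw : 0 < h₀ + h₁ * w + h₂ * w ^ 2) (hx : 0 < h₀ + h₁ * x + h₂ * x ^ 2)
    (hy : h₀ + h₁ * y + h₂ * y ^ 2 < 0) (hz : h₀ + h₁ * z + h₂ * z ^ 2 < 0) :
    (w - x) * (y - z) * (w - y) * (x - z) < 0 := by
  by_contra hcon
  have nwx : w - x ≠ 0 := by intro h; rw [sub_eq_zero.1 h] at fw; linarith
  have nyz : y - z ≠ 0 := by intro h; rw [sub_eq_zero.1 h] at fy; linarith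
  have nwy : w - y ≠ 0 := by intro h; rw [sub_eq_zero.1 h] at hw; linarith
  have nxz : x - z ≠ 0 := by intro h; rw [sub_eq_zero.1 h] at hx; linarith
  have hpos : 0 < (w - x) * (y - z) * (w - y) * (x - z) :=
    lt_of_le_of_ne (not_lt.1 hcon) (by positivity)
  have ef : (x - y) * ((f₀ + f₁ * w + f₂ * w ^ 2) * ((x - z) * (y - z))
        - (f₀ + f₁ * z + f₂ * z ^ 2) * ((w - x) * (w - y))) =
      (w - z) * ((f₀ + f₁ * x + f₂ * x ^ 2) * ((w - y) * (y - z))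
        - (f₀ + f₁ * y + f₂ * y ^ 2) * ((w - x) * (x - z))) := by ring
  have eh : (x - y) * ((h₀ + h₁ * w + h₂ * w ^ 2) * ((x - z) * (y - z))
        - (h₀ + h₁ * z + h₂ * z ^ 2) * ((w - x) * (w - y))) =
      (w - z) * ((h₀ + h₁ * x + h₂ * x ^ 2) * ((w - y) * (y - z))
        - (h₀ + h₁ * y + h₂ * y ^ 2) * ((w - x) * (x - z))) := by ring
  set F1 := f₀ + f₁ * w + f₂ * w ^ 2
  set F2 := f₀ + f₁ * x + f₂ * x ^ 2 with hF2
  set F3 := f₀ + f₁ * y + f₂ * y ^ 2 with hF3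
  set F4 := f₀ + f₁ * z + f₂ * z ^ 2
  set H1 := h₀ + h₁ * w + h₂ * w ^ 2
  set H2 := h₀ + h₁ * x + h₂ * x ^ 2
  set H3 := h₀ + h₁ * y + h₂ * y ^ 2
  set H4 := h₀ + h₁ * z + h₂ * z ^ 2
  have hA : 0 < (F1 * ((x - z) * (y - z)) - F4 * ((w - x) * (w - y))) *
      (H1 * ((x - z) * (y - z)) - H4 * ((w - x) * (w - y))) := by
    have hp : 0 < ((x - z) * (y - z)) * ((w - x) * (w - y)) := by
      calc 0 < _ := hpos
        _ = _ := by ring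
    rcases (mul_pos_iff.1 hp) with ⟨p1, p2⟩ | ⟨p1, p2⟩
    · apply mul_pos
      · linarith [mul_pos fw p1, mul_pos_of_neg_of_neg fz (neg_neg_of_pos p2)]
      · linarith [mul_pos hw p1, mul_pos_of_neg_of_neg hz (neg_neg_of_pos p2)]
    · apply mul_pos_of_neg_of_neg
      · linarith [mul_neg_of_pos_of_neg fw p1, mul_pos_of_neg_of_neg fz p2]
      · linarith [mul_neg_of_pos_of_neg hw p1, mul_pos_of_neg_of_neg hz p2]
  have hB : (F2 * ((w - y) * (y - z)) - F3 * ((w - x) * (x - z))) *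
      (H2 * ((w - y) * (y - z)) - H3 * ((w - x) * (x - z))) < 0 := by
    have hp : 0 < ((w - y) * (y - z)) * ((w - x) * (x - z)) := by
      calc 0 < _ := hpos
        _ = _ := by ring
    rcases (mul_pos_iff.1 hp) with ⟨p1, p2⟩ | ⟨p1, p2⟩
    · apply mul_neg_of_neg_of_pos
      · linarith [mul_neg_of_neg_of_pos fx p1, mul_pos fy p2]
      · linarith [mul_pos hx p1, mul_neg_of_neg_of_pos hy p2]
    · apply mul_neg_of_pos_of_neg
      · linarith [mul_pos_of_neg_of_neg fx p1, mul_neg_of_pos_of_neg fy p2]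
      · linarith [mul_neg_of_pos_of_neg hx p1, mul_pos_of_neg_of_neg hy p2]
  set A1 := F1 * ((x - z) * (y - z)) - F4 * ((w - x) * (w - y))
  set A2 := H1 * ((x - z) * (y - z)) - H4 * ((w - x) * (w - y))
  set B1 := F2 * ((w - y) * (y - z)) - F3 * ((w - x) * (x - z))
  set B2 := H2 * ((w - y) * (y - z)) - H3 * ((w - x) * (x - z))
  have key : (x - y) ^ 2 * (A1 * A2) = (w - z) ^ 2 * (B1 * B2) := by
    calc _ = ((x - y) * A1) * ((x - y) * A2) := by ring
      _ = ((w - z) * B1) * ((w - z) * B2) := by rw [ef, eh]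
      _ = _ := by ring
  have hxy : x ≠ y := by
    intro h; rw [hF2, h] at fx; rw [hF3] at fy; linarith
  have h1 : 0 < (x - y) ^ 2 * (A1 * A2) := mul_pos (by have := sub_ne_zero.2 hxy; positivity) hA
  have h2 : (w - z) ^ 2 * (B1 * B2) ≤ 0 := mul_nonpos_of_nonneg_of_nonpos (sq_nonneg _) hB.le
  linarith

lemma quad_no_three_sign_changes {h₀ h₁ h₂ u₁ v₁ u₂ v₂ u₃ v₃ : ℝ}
    (hu₁ : 0 < h₀ + h₁ * u₁ + h₂ * u₁ ^ 2) (hv₁ : h₀ + h₁ * v₁ + h₂ * v₁ ^ 2 < 0)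
    (hu₂ : 0 < h₀ + h₁ * u₂ + h₂ * u₂ ^ 2) (hv₂ : h₀ + h₁ * v₂ + h₂ * v₂ ^ 2 < 0)
    (hu₃ : 0 < h₀ + h₁ * u₃ + h₂ * u₃ ^ 2) (hv₃ : h₀ + h₁ * v₃ + h₂ * v₃ ^ 2 < 0)
    (d₁₂ : Disjoint (uIcc u₁ v₁) (uIcc u₂ v₂)) (d₁₃ : Disjoint (uIcc u₁ v₁) (uIcc u₃ v₃))
    (d₂₃ : Disjoint (uIcc u₂ v₂) (uIcc u₃ v₃)) : False := by
  have root : ∀ u v, 0 < h₀ + h₁ * u + h₂ * u ^ 2 → h₀ + h₁ * v + h₂ * v ^ 2 < 0 →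
      ∃ x ∈ uIcc u v, h₀ + h₁ * x + h₂ * x ^ 2 = 0 := by
    intro u v hu hv
    have hc : ContinuousOn (fun x : ℝ => h₀ + h₁ * x + h₂ * x ^ 2) (uIcc u v) := by fun_prop
    exact intermediate_value_uIcc hc (mem_uIcc.2 (Or.inr ⟨hv.le, hu.le⟩))
  obtain ⟨x, hx, ex⟩ := root _ _ hu₁ hv₁
  obtain ⟨y, hy, ey⟩ := root _ _ hu₂ hv₂
  obtain ⟨z, hz, ez⟩ := root _ _ hu₃ hv₃
  have nxy : x - y ≠ 0 := fun h => Set.disjoint_left.1 d₁₂ hx (sub_eq_zero.1 h ▸ hy)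
  have nxz : x - z ≠ 0 := fun h => Set.disjoint_left.1 d₁₃ hx (sub_eq_zero.1 h ▸ hz)
  have nyz : y - z ≠ 0 := fun h => Set.disjoint_left.1 d₂₃ hy (sub_eq_zero.1 h ▸ hz)
  have key : (h₀ + h₁ * u₁ + h₂ * u₁ ^ 2) * ((x - y) * (x - z) * (y - z)) =
      (h₀ + h₁ * x + h₂ * x ^ 2) * ((u₁ - y) * (u₁ - z) * (y - z))
      - (h₀ + h₁ * y + h₂ * y ^ 2) * ((u₁ - x) * (u₁ - z) * (x - z))
      + (h₀ + h₁ * z + h₂ * z ^ 2) * ((u₁ - x) * (u₁ - y) * (x - y)) := by ring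
  rw [ex, ey, ez] at key
  have : (h₀ + h₁ * u₁ + h₂ * u₁ ^ 2) * ((x - y) * (x - z) * (y - z)) ≠ 0 := by positivity
  apply this
  rw [key]; ring

open Classical in
/-- The Marcus–Tardos bound for families of quadratics, pairs of which are almost tangent. -/
theorem card_tangent_pairs_le {W : Type*} (p₀ p₁ p₂ : W → ℝ) (A B : Finset W) (E : W → W → Prop)
    (T lam η : W → W → ℝ) (ϑ D n L Δ lmin : ℝ) (J : ℕ) (hD : 0 ≤ D) (hDn : D ≤ n)
    (hL : 0 < L) (hJ : 2 * L ≤ 2 ^ J * ϑ) (hJ1 : 1 ≤ J) (hϑ : 0 ≤ ϑ)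
    (hT : ∀ a c, E a c → |T a c| < L) (hlam : ∀ a c, E a c → lmin ≤ lam a c)
    (hη : ∀ a c, E a c → |η a c| ≤ Δ) (hϑΔ : 2 * Δ < lmin * ϑ ^ 2) (hlmin : 0 < lmin)
    (hp : ∀ a c, E a c → ∀ t, (p₀ c + p₁ c * t + p₂ c * t ^ 2) - (p₀ a + p₁ a * t + p₂ a * t ^ 2) =
      lam a c * (t - T a c) ^ 2 + η a c)
    (nA : ∀ a ∈ A, ∀ c ∈ B, E a c → (({b ∈ A | E b c ∧ |T a c - T b c| < ϑ}).card : ℝ) ≤ D)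
    (nB : ∀ a ∈ A, ∀ c ∈ B, E a c → (({d ∈ B | E a d ∧ |T a c - T a d| < ϑ}).card : ℝ) ≤ D)
    (hnA : (A.card : ℝ) ≤ n) (hnB : (B.card : ℝ) ≤ n) :
    ∑ a ∈ A, (({c ∈ B | E a c}).card : ℝ) ≤ 5 * J * n * √(n * D) := by
  have hsub : ∀ x y : ℝ, (x + L) / (2 * L) - (y + L) / (2 * L) = (x - y) / (2 * L) := by
    intro x y; ring
  have habs : ∀ x y : ℝ, |(x + L) / (2 * L) - (y + L) / (2 * L)| = |x - y| / (2 * L) := by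
    intro x y; rw [hsub, abs_div, abs_of_pos (show 0 < 2 * L by positivity)]
  have hle : ∀ x y : ℝ, ϑ / (2 * L) ≤ |(x + L) / (2 * L) - (y + L) / (2 * L)| ↔ ϑ ≤ |x - y| := by
    intro x y; rw [habs, div_le_div_iff_of_pos_right (by positivity)]
  have hlt : ∀ x y : ℝ, |(x + L) / (2 * L) - (y + L) / (2 * L)| < ϑ / (2 * L) ↔ |x - y| < ϑ := by
    intro x y; rw [habs, div_lt_div_iff_of_pos_right (by positivity)]
  have big : ∀ {a c : W} {t : ℝ}, E a c → ϑ ≤ |t - T a c| → 2 * Δ < lam a c * (t - T a c) ^ 2 := by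
    intro a c t h ht
    have h1 : ϑ ^ 2 ≤ (t - T a c) ^ 2 := by
      rw [← sq_abs (t - T a c)]; gcongr
    calc 2 * Δ < lmin * ϑ ^ 2 := hϑΔ
      _ ≤ lam a c * (t - T a c) ^ 2 := by
        exact mul_le_mul (hlam a c h) h1 (by positivity) (hlmin.le.trans (hlam a c h))
  have pos : ∀ {a c d : W}, E a c → E a d → ϑ ≤ |T a c - T a d| →
      0 < (p₀ d - p₀ c) + (p₁ d - p₁ c) * T a c + (p₂ d - p₂ c) * T a c ^ 2 := by
    intro a c d h1 h2 h3
    have := big h2 h3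
    have e1 := hp a c h1 (T a c)
    have e2 := hp a d h2 (T a c)
    rw [sub_self] at e1
    have := abs_le.1 (hη a c h1)
    have := abs_le.1 (hη a d h2)
    linarith
  have pos' : ∀ {a b c : W}, E a c → E b c → ϑ ≤ |T a c - T b c| →
      0 < (p₀ a - p₀ b) + (p₁ a - p₁ b) * T a c + (p₂ a - p₂ b) * T a c ^ 2 := by
    intro a b c h1 h2 h3
    have := big h2 h3
    have e1 := hp a c h1 (T a c)
    have e2 := hp b c h2 (T a c)
    rw [sub_self] at e1
    have := abs_le.1 (hη a c h1)
    have := abs_le.1 (hη b c h2)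
    linarith
  have hdis : ∀ x y z w : ℝ, Disjoint (uIcc ((x + L) / (2 * L)) ((y + L) / (2 * L)))
      (uIcc ((z + L) / (2 * L)) ((w + L) / (2 * L))) → Disjoint (uIcc x y) (uIcc z w) := by
    intro x y z w h
    have mono : Monotone fun x : ℝ => (x + L) / (2 * L) := by
      intro x y hxy; dsimp only; gcongr
    have key : ∀ {x y s : ℝ}, s ∈ uIcc x y →
        (s + L) / (2 * L) ∈ uIcc ((x + L) / (2 * L)) ((y + L) / (2 * L)) := by
      intro x y s hs
      rcases mem_uIcc.1 hs with h | h
      · exact mem_uIcc.2 (Or.inl ⟨mono h.1, mono h.2⟩)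
      · exact mem_uIcc.2 (Or.inr ⟨mono h.1, mono h.2⟩)
    rw [Set.disjoint_left]
    intro s h1 h2
    exact Set.disjoint_left.1 h (key h1) (key h2)
  refine card_edges_le A B E (fun a c => (T a c + L) / (2 * L)) (ϑ / (2 * L)) D n J hD hDn ?_ hJ1
    ?_ ?_ ?_ ?_ ?_ ?_ hnA hnB
  · rw [← mul_div_assoc, le_div_iff₀ (by positivity)]; linarith
  · intro a c h
    have := abs_lt.1 (hT a c h)
    constructor
    · apply div_nonneg <;> linarith
    · rw [div_lt_one (by positivity)]; linarith
  · intro a b c d h1 h2 h3 h4 s1 s2 s3 s4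
    simp only [hle] at s1 s2 s3 s4
    simp only [hsub]
    have := quad_sign_configuration (w := T a c) (x := T a d) (y := T b c) (z := T b d) (pos h1 h2 s1)
      (by have := pos h2 h1 (by rwa [abs_sub_comm]); linarith)
      (pos h3 h4 s2) (by have := pos h4 h3 (by rwa [abs_sub_comm]); linarith)
      (pos' h1 h3 s3) (pos' h2 h4 s4)
      (by have := pos' h3 h1 (by rwa [abs_sub_comm]); linarith)
      (by have := pos' h4 h2 (by rwa [abs_sub_comm]); linarith)
    have e : (T a c - T a d) / (2 * L) * ((T b c - T b d) / (2 * L)) *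
        ((T a c - T b c) / (2 * L)) * ((T a d - T b d) / (2 * L)) =
        ((T a c - T a d) * (T b c - T b d) * (T a c - T b c) * (T a d - T b d)) / (2 * L) ^ 4 := by
      field_simp
    rw [e]
    exact div_neg_of_neg_of_pos this (by positivity)
  · intro a b c₁ c₂ c₃ h1 h1' s1 h2 h2' s2 h3 h3' s3 d1 d2 d3
    simp only [hle] at s1 s2 s3
    exact quad_no_three_sign_changes (v₁ := T b c₁) (v₂ := T b c₂) (v₃ := T b c₃) (pos' h1 h1' s1)
      (by have := pos' h1' h1 (by rwa [abs_sub_comm]); linarith)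
      (pos' h2 h2' s2) (by have := pos' h2' h2 (by rwa [abs_sub_comm]); linarith)
      (pos' h3 h3' s3) (by have := pos' h3' h3 (by rwa [abs_sub_comm]); linarith)
      (hdis _ _ _ _ d1) (hdis _ _ _ _ d2) (hdis _ _ _ _ d3)
  · intro a b c₁ c₂ c₃ h1 h1' s1 h2 h2' s2 h3 h3' s3 d1 d2 d3
    simp only [hle] at s1 s2 s3
    exact quad_no_three_sign_changes (v₁ := T c₁ b) (v₂ := T c₂ b) (v₃ := T c₃ b) (pos h1 h1' s1)
      (by have := pos h1' h1 (by rwa [abs_sub_comm]); linarith)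
      (pos h2 h2' s2) (by have := pos h2' h2 (by rwa [abs_sub_comm]); linarith)
      (pos h3 h3' s3) (by have := pos h3' h3 (by rwa [abs_sub_comm]); linarith)
      (hdis _ _ _ _ d1) (hdis _ _ _ _ d2) (hdis _ _ _ _ d3)
  · intro a ha c hc h
    simp only [hlt]
    exact nA a ha c hc h
  · intro a ha c hc h
    simp only [hlt]
    exact nB a ha c hc h

open Classical in
lemma sum_rich_class_le {W ι : Type*} (p₀ p₁ p₂ : W → ℝ) (A B : Finset W) (I : Finset ι)
    (𝒜 𝒞 : ι → Finset W) (τ : ι → ℝ) (T lam η : W → W → ℝ) (ϑ ρ n L Δ lmin M : ℝ) (J u : ℕ)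
    (hM1 : 1 ≤ M) (hL : 0 < L) (hJ : 2 * L ≤ 2 ^ J * ϑ) (hJ1 : 1 ≤ J) (hϑ : 0 ≤ ϑ)
    (hϑΔ : 2 * Δ < lmin * ϑ ^ 2) (hlmin : 0 < lmin)
    (hA : ∀ κ ∈ I, 𝒜 κ ⊆ A) (hB : ∀ κ ∈ I, 𝒞 κ ⊆ B)
    (hgood : ∀ κ ∈ I, ∀ a ∈ 𝒜 κ, ∀ c ∈ 𝒞 κ, |T a c - τ κ| ≤ ρ ∧ lmin ≤ lam a c ∧ |η a c| ≤ Δ ∧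
      |T a c| < L ∧ ∀ t, (p₀ c + p₁ c * t + p₂ c * t ^ 2) - (p₀ a + p₁ a * t + p₂ a * t ^ 2) =
      lam a c * (t - T a c) ^ 2 + η a c)
    (hMA : ∀ a t, (({κ ∈ I | a ∈ 𝒜 κ ∧ |τ κ - t| ≤ ρ + ϑ}).card : ℝ) ≤ M)
    (hMC : ∀ c t, (({κ ∈ I | c ∈ 𝒞 κ ∧ |τ κ - t| ≤ ρ + ϑ}).card : ℝ) ≤ M)
    (hnA : (A.card : ℝ) ≤ n) (hnB : (B.card : ℝ) ≤ n) (hun : (2 : ℝ) ^ u ≤ n)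
    (hcA : ∀ κ ∈ I, (𝒜 κ).card ≤ 2 ^ (u + 1)) (hcC : ∀ κ ∈ I, (𝒞 κ).card ≤ 2 ^ (u + 1)) :
    ∑ κ ∈ I, ((𝒜 κ).card * (𝒞 κ).card : ℝ) ≤ 20 * M ^ 3 * J * n * √n * √(2 ^ u) := by
  have hM0 : 0 ≤ M := by linarith
  have hn0 : 0 ≤ n := (Nat.cast_nonneg _).trans hnA
  obtain ⟨E, hE⟩ : ∃ E : W → W → Prop, ∀ a c, E a c ↔ ∃ κ ∈ I, a ∈ 𝒜 κ ∧ c ∈ 𝒞 κ :=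
    ⟨_, fun _ _ => Iff.rfl⟩
  have hedge : ∑ a ∈ A, (({c ∈ B | E a c}).card : ℝ) ≤
      5 * J * (2 * M * n) * √((2 * M * n) * (M * 2 ^ (u + 1))) := by
    refine card_tangent_pairs_le p₀ p₁ p₂ A B E T lam η ϑ (M * 2 ^ (u + 1)) (2 * M * n) L Δ lmin J
      (by positivity) ?_ hL hJ hJ1 hϑ ?_ ?_ ?_ hϑΔ hlmin ?_ ?_ ?_ ?_ ?_
    · rw [pow_succ]
      calc M * (2 ^ u * 2) = 2 * M * 2 ^ u := by ring
        _ ≤ _ := by gcongr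
    · intro a c hac; obtain ⟨κ, h1, h2, h3⟩ := (hE a c).1 hac; exact (hgood κ h1 a h2 c h3).2.2.2.1
    · intro a c hac; obtain ⟨κ, h1, h2, h3⟩ := (hE a c).1 hac; exact (hgood κ h1 a h2 c h3).2.1
    · intro a c hac; obtain ⟨κ, h1, h2, h3⟩ := (hE a c).1 hac; exact (hgood κ h1 a h2 c h3).2.2.1
    · intro a c hac; obtain ⟨κ, h1, h2, h3⟩ := (hE a c).1 hac; exact (hgood κ h1 a h2 c h3).2.2.2.2
    · intro a _ c _ hac
      have hsub : {b ∈ A | E b c ∧ |T a c - T b c| < ϑ} ⊆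
          ({κ ∈ I | c ∈ 𝒞 κ ∧ |τ κ - T a c| ≤ ρ + ϑ}).biUnion 𝒜 := by
        intro b hb
        obtain ⟨hbA, hbE, h4⟩ := Finset.mem_filter.1 hb
        obtain ⟨κ, h1, h2, h3⟩ := (hE _ _).1 hbE
        refine Finset.mem_biUnion.2 ⟨κ, Finset.mem_filter.2 ⟨h1, h3, ?_⟩, h2⟩
        have := (hgood κ h1 b h2 c h3).1
        rw [abs_le] at this ⊢
        rw [abs_lt] at h4
        constructor <;> linarith
      have h1 := (Finset.card_le_card hsub).trans (Finset.card_biUnion_le_card_mul _ _ (2 ^ (u + 1))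
        fun κ hκ => hcA κ (Finset.mem_filter.1 hκ).1)
      have h2 : (({b ∈ A | E b c ∧ |T a c - T b c| < ϑ}).card : ℝ) ≤
        (({κ ∈ I | c ∈ 𝒞 κ ∧ |τ κ - T a c| ≤ ρ + ϑ}).card : ℝ) * 2 ^ (u + 1) := by exact_mod_cast h1
      exact h2.trans (mul_le_mul_of_nonneg_right (hMC c _) (by positivity))
    · intro a _ c _ hac
      have hsub : {d ∈ B | E a d ∧ |T a c - T a d| < ϑ} ⊆
          ({κ ∈ I | a ∈ 𝒜 κ ∧ |τ κ - T a c| ≤ ρ + ϑ}).biUnion 𝒞 := by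
        intro b hb
        obtain ⟨hbA, hbE, h4⟩ := Finset.mem_filter.1 hb
        obtain ⟨κ, h1, h2, h3⟩ := (hE _ _).1 hbE
        refine Finset.mem_biUnion.2 ⟨κ, Finset.mem_filter.2 ⟨h1, h2, ?_⟩, h3⟩
        have := (hgood κ h1 a h2 b h3).1
        rw [abs_le] at this ⊢
        rw [abs_lt] at h4
        constructor <;> linarith
      have h1 := (Finset.card_le_card hsub).trans (Finset.card_biUnion_le_card_mul _ _ (2 ^ (u + 1))
        fun κ hκ => hcC κ (Finset.mem_filter.1 hκ).1)
      have h2 : (({d ∈ B | E a d ∧ |T a c - T a d| < ϑ}).card : ℝ) ≤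
        (({κ ∈ I | a ∈ 𝒜 κ ∧ |τ κ - T a c| ≤ ρ + ϑ}).card : ℝ) * 2 ^ (u + 1) := by exact_mod_cast h1
      exact h2.trans (mul_le_mul_of_nonneg_right (hMA a _) (by positivity))
    · nlinarith
    · nlinarith
  have hcount : ∑ κ ∈ I, ((𝒜 κ).card * (𝒞 κ).card : ℝ) ≤
      M * ∑ a ∈ A, (({c ∈ B | E a c}).card : ℝ) := by
    calc ∑ κ ∈ I, ((𝒜 κ).card * (𝒞 κ).card : ℝ)
        = ∑ κ ∈ I, ∑ a ∈ A, ∑ c ∈ B, (if a ∈ 𝒜 κ ∧ c ∈ 𝒞 κ then (1 : ℝ) else 0) := by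
          refine Finset.sum_congr rfl fun κ hκ => ?_
          have e1 : ∀ a, ∑ c ∈ B, (if a ∈ 𝒜 κ ∧ c ∈ 𝒞 κ then (1 : ℝ) else 0) =
              if a ∈ 𝒜 κ then ((𝒞 κ).card : ℝ) else 0 := by
            intro a
            by_cases h : a ∈ 𝒜 κ
            · simp only [h, true_and, if_true, Finset.sum_boole]
              rw [Finset.filter_mem_eq_inter, Finset.inter_eq_right.2 (hB κ hκ)]
            · simp [h]
          simp_rw [e1]
          rw [← Finset.sum_filter, Finset.sum_const, Finset.filter_mem_eq_inter,
            Finset.inter_eq_right.2 (hA κ hκ), nsmul_eq_mul]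
      _ = ∑ a ∈ A, ∑ c ∈ B, ∑ κ ∈ I, (if a ∈ 𝒜 κ ∧ c ∈ 𝒞 κ then (1 : ℝ) else 0) := by
          rw [Finset.sum_comm]
          exact Finset.sum_congr rfl fun a _ => Finset.sum_comm
      _ ≤ ∑ a ∈ A, ∑ c ∈ B, (if E a c then M else 0) := by
          refine Finset.sum_le_sum fun a _ => Finset.sum_le_sum fun c _ => ?_
          split_ifs with h
          · rw [Finset.sum_boole]
            refine le_trans (Nat.cast_le.2 (Finset.card_le_card ?_)) (hMA a (T a c))
            intro κ hκ
            obtain ⟨h1, h2, h3⟩ := Finset.mem_filter.1 hκ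
            refine Finset.mem_filter.2 ⟨h1, h2, ?_⟩
            rw [abs_sub_comm]
            linarith [(hgood κ h1 a h2 c h3).1]
          · refine le_of_eq (Finset.sum_eq_zero fun κ hκ => if_neg fun hh => h ((hE a c).2 ⟨κ, hκ, hh⟩))
      _ = _ := by
          rw [Finset.mul_sum]
          refine Finset.sum_congr rfl fun a _ => ?_
          rw [← Finset.sum_filter, Finset.sum_const, nsmul_eq_mul, mul_comm]
  have hs : √((2 * M * n) * (M * 2 ^ (u + 1))) = 2 * M * (√n * √(2 ^ u)) := by
    rw [show (2 * M * n) * (M * 2 ^ (u + 1)) = (2 * M) ^ 2 * (n * 2 ^ u) by rw [pow_succ]; ring,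
      Real.sqrt_mul (by positivity), Real.sqrt_sq (by positivity), Real.sqrt_mul hn0]
  calc _ ≤ _ := hcount
    _ ≤ M * (5 * J * (2 * M * n) * √((2 * M * n) * (M * 2 ^ (u + 1)))) :=
      mul_le_mul_of_nonneg_left hedge hM0
    _ = _ := by rw [hs]; ring

open Classical in
/-- Summing the Marcus–Tardos bound over dyadic richness classes. -/
theorem sum_rich_le {W ι : Type*} (p₀ p₁ p₂ : W → ℝ) (A B : Finset W) (I : Finset ι)
    (𝒜 𝒞 : ι → Finset W) (τ : ι → ℝ) (T lam η : W → W → ℝ) (ϑ ρ n L Δ lmin M : ℝ) (J U : ℕ)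
    (hM1 : 1 ≤ M) (hL : 0 < L) (hJ : 2 * L ≤ 2 ^ J * ϑ) (hJ1 : 1 ≤ J) (hϑ : 0 ≤ ϑ)
    (hϑΔ : 2 * Δ < lmin * ϑ ^ 2) (hlmin : 0 < lmin)
    (hA : ∀ κ ∈ I, 𝒜 κ ⊆ A) (hB : ∀ κ ∈ I, 𝒞 κ ⊆ B)
    (hgood : ∀ κ ∈ I, ∀ a ∈ 𝒜 κ, ∀ c ∈ 𝒞 κ, |T a c - τ κ| ≤ ρ ∧ lmin ≤ lam a c ∧ |η a c| ≤ Δ ∧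
      |T a c| < L ∧ ∀ t, (p₀ c + p₁ c * t + p₂ c * t ^ 2) - (p₀ a + p₁ a * t + p₂ a * t ^ 2) =
      lam a c * (t - T a c) ^ 2 + η a c)
    (hMA : ∀ a t, (({κ ∈ I | a ∈ 𝒜 κ ∧ |τ κ - t| ≤ ρ + ϑ}).card : ℝ) ≤ M)
    (hMC : ∀ c t, (({κ ∈ I | c ∈ 𝒞 κ ∧ |τ κ - t| ≤ ρ + ϑ}).card : ℝ) ≤ M)
    (hnA : (A.card : ℝ) ≤ n) (hnB : (B.card : ℝ) ≤ n) (hnU : n < 2 ^ U) :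
    ∑ κ ∈ I, ((𝒜 κ).card * (𝒞 κ).card : ℝ) / √(max (𝒜 κ).card (𝒞 κ).card : ℕ) ≤
      20 * M ^ 3 * J * U * (n * √n) := by
  have hM0 : 0 ≤ M := by linarith
  have hn0 : 0 ≤ n := (Nat.cast_nonneg _).trans hnA
  set m : ι → ℕ := fun κ => max (𝒜 κ).card (𝒞 κ).card with hm
  have hmU : ∀ κ ∈ I, (m κ : ℝ) ≤ n := by
    intro κ hκ
    have h1 : ((𝒜 κ).card : ℝ) ≤ n := le_trans (Nat.cast_le.2 (Finset.card_le_card (hA κ hκ))) hnA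
    have h2 : ((𝒞 κ).card : ℝ) ≤ n := le_trans (Nat.cast_le.2 (Finset.card_le_card (hB κ hκ))) hnB
    simp only [hm, Nat.cast_max]
    exact max_le h1 h2
  have hclass : ∀ u ∈ Finset.range U, ∑ κ ∈ I with (m κ ≠ 0 ∧ Nat.log 2 (m κ) = u),
      ((𝒜 κ).card * (𝒞 κ).card : ℝ) / √(m κ : ℕ) ≤ 20 * M ^ 3 * J * (n * √n) := by
    intro u _
    set Iu := {κ ∈ I | m κ ≠ 0 ∧ Nat.log 2 (m κ) = u} with hIu
    rcases Iu.eq_empty_or_nonempty with h0 | ⟨κ₀, hκ₀⟩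
    · rw [h0, Finset.sum_empty]; positivity
    have hlow : ∀ κ ∈ Iu, 2 ^ u ≤ m κ := by
      intro κ hκ
      obtain ⟨_, h1, h2⟩ := Finset.mem_filter.1 hκ
      rw [← h2]; exact Nat.pow_log_le_self 2 h1
    have hup : ∀ κ ∈ Iu, m κ ≤ 2 ^ (u + 1) := by
      intro κ hκ
      obtain ⟨_, h1, h2⟩ := Finset.mem_filter.1 hκ
      rw [← h2]; exact (Nat.lt_pow_succ_log_self (by norm_num) _).le
    have hun : (2 : ℝ) ^ u ≤ n :=
      le_trans (by exact_mod_cast hlow κ₀ hκ₀) (hmU κ₀ (Finset.mem_filter.1 hκ₀).1)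
    have hIuI : ∀ κ ∈ Iu, κ ∈ I := fun κ hκ => (Finset.mem_filter.1 hκ).1
    have key := sum_rich_class_le p₀ p₁ p₂ A B Iu 𝒜 𝒞 τ T lam η ϑ ρ n L Δ lmin M J u hM1 hL hJ hJ1
      hϑ hϑΔ hlmin (fun κ hκ => hA κ (hIuI κ hκ)) (fun κ hκ => hB κ (hIuI κ hκ))
      (fun κ hκ => hgood κ (hIuI κ hκ))
      (fun a t => le_trans (Nat.cast_le.2 (Finset.card_le_card
        (Finset.filter_subset_filter _ (Finset.filter_subset _ _)))) (hMA a t))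
      (fun a t => le_trans (Nat.cast_le.2 (Finset.card_le_card
        (Finset.filter_subset_filter _ (Finset.filter_subset _ _)))) (hMC a t))
      hnA hnB hun (fun κ hκ => (le_max_left _ _).trans (hup κ hκ))
      (fun κ hκ => (le_max_right _ _).trans (hup κ hκ))
    have hs : 0 < √((2:ℝ) ^ u) := by positivity
    calc ∑ κ ∈ Iu, ((𝒜 κ).card * (𝒞 κ).card : ℝ) / √(m κ : ℕ)
        ≤ ∑ κ ∈ Iu, ((𝒜 κ).card * (𝒞 κ).card : ℝ) / √(2 ^ u) := by
          refine Finset.sum_le_sum fun κ hκ => ?_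
          have : √((2:ℝ) ^ u) ≤ √(m κ : ℕ) := Real.sqrt_le_sqrt (by exact_mod_cast hlow κ hκ)
          gcongr
      _ = (∑ κ ∈ Iu, ((𝒜 κ).card * (𝒞 κ).card : ℝ)) / √(2 ^ u) := by rw [Finset.sum_div]
      _ ≤ _ := by
          rw [div_le_iff₀ hs]
          refine key.trans (le_of_eq ?_)
          ring
  have hzero : ∑ κ ∈ I, ((𝒜 κ).card * (𝒞 κ).card : ℝ) / √(m κ : ℕ) =
      ∑ κ ∈ I with m κ ≠ 0, ((𝒜 κ).card * (𝒞 κ).card : ℝ) / √(m κ : ℕ) := by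
    rw [Finset.sum_filter]
    refine Finset.sum_congr rfl fun κ _ => ?_
    split_ifs with h
    · rfl
    · rw [not_not.1 h]; simp
  rw [hzero, ← Finset.sum_fiberwise_of_maps_to (s := {κ ∈ I | m κ ≠ 0}) (t := Finset.range U)
    (g := fun κ => Nat.log 2 (m κ))]
  · calc _ ≤ ∑ u ∈ Finset.range U, 20 * M ^ 3 * J * (n * √n) := by
          refine Finset.sum_le_sum fun u hu => ?_
          rw [Finset.filter_filter]
          exact hclass u hu
      _ = _ := by rw [Finset.sum_const, Finset.card_range, nsmul_eq_mul]; ring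
  · intro κ hκ
    obtain ⟨h1, h2⟩ := Finset.mem_filter.1 hκ
    rw [Finset.mem_range]
    refine Nat.log_lt_of_lt_pow h2 ?_
    have : (m κ : ℝ) < 2 ^ U := (hmU κ h1).trans_lt hnU
    exact_mod_cast this

/-- The rotation of the plane taking `(u, v)` to the first basis vector. -/
noncomputable def rotation (u v : ℝ) (huv : u ^ 2 + v ^ 2 = 1) :
    EuclideanSpace ℝ (Fin 2) →ₗᵢ[ℝ] EuclideanSpace ℝ (Fin 2) where
  toFun y := !₂[u * y 0 + v * y 1, -v * y 0 + u * y 1]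
  map_add' x y := by
    ext i; fin_cases i <;> simp <;> ring
  map_smul' c y := by
    ext i; fin_cases i <;> simp <;> ring
  norm_map' y := by
    simp only [EuclideanSpace.norm_eq, Fin.sum_univ_two, Real.norm_eq_abs, sq_abs]
    congr 1
    simp
    linear_combination (y 0 ^ 2 + y 1 ^ 2) * huv

lemma volume_prod_le_of_slices (S : Set (ℝ × ℝ)) (hS : MeasurableSet S) (a l₁ l₂ : ℝ)
    (h1 : ∀ p ∈ S, a ≤ p.1 ∧ p.1 ≤ a + l₁)
    (h2 : ∀ x y z, (x, y) ∈ S → (x, z) ∈ S → |y - z| ≤ l₂) :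
    volume S ≤ ENNReal.ofReal (l₁ * l₂) := by
  rcases S.eq_empty_or_nonempty with h0 | ⟨p₀, hp₀⟩
  · simp [h0]
  have hl1 : 0 ≤ l₁ := by linarith [(h1 p₀ hp₀).1, (h1 p₀ hp₀).2]
  rw [Measure.volume_eq_prod, Measure.prod_apply hS]
  calc ∫⁻ x, volume (Prod.mk x ⁻¹' S) ≤
        ∫⁻ x, (Icc a (a + l₁)).indicator (fun _ => ENNReal.ofReal l₂) x := by
        refine lintegral_mono fun x => ?_
        by_cases hx : x ∈ Icc a (a + l₁)
        · rw [indicator_of_mem hx]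
          refine (Real.volume_le_diam _).trans ?_
          refine Metric.ediam_le fun y hy z hz => ?_
          rw [edist_dist, Real.dist_eq]
          exact ENNReal.ofReal_le_ofReal (h2 x y z hy hz)
        · rw [indicator_of_notMem hx]
          have : Prod.mk x ⁻¹' S = ∅ := by
            ext y
            simp only [mem_preimage, mem_empty_iff_false, iff_false]
            exact fun hy => hx (h1 _ hy)
          simp [this]
    _ ≤ ENNReal.ofReal l₂ * volume (Icc a (a + l₁)) := lintegral_indicator_const_le _ _
    _ = _ := by
        rw [Real.volume_Icc, add_sub_cancel_left, mul_comm, ENNReal.ofReal_mul hl1]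

/-- A planar set of width `l₁`, all of whose slices have length at most `l₂`, has area at most
`l₁ * l₂`. -/
lemma volume_le_of_slices (S : Set (EuclideanSpace ℝ (Fin 2))) (hS : MeasurableSet S)
    (u v a l₁ l₂ : ℝ) (huv : u ^ 2 + v ^ 2 = 1)
    (h1 : ∀ p ∈ S, a ≤ u * p 0 + v * p 1 ∧ u * p 0 + v * p 1 ≤ a + l₁)
    (h2 : ∀ p ∈ S, ∀ q ∈ S, u * p 0 + v * p 1 = u * q 0 + v * q 1 →
      |(-v * p 0 + u * p 1) - (-v * q 0 + u * q 1)| ≤ l₂) :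
    volume S ≤ ENNReal.ofReal (l₁ * l₂) := by
  set L := (rotation u v huv).toLinearIsometryEquiv rfl with hL
  have hL0 : ∀ y, L y = !₂[u * y 0 + v * y 1, -v * y 0 + u * y 1] := fun _ => rfl
  have m1 : MeasurePreserving L.symm := L.symm.measurePreserving
  have m2 := (PiLp.volume_preserving_toLp (Fin 2)).comp (volume_preserving_finTwoArrow ℝ).symm
  have m3 := m1.comp m2
  set φ : ℝ × ℝ → EuclideanSpace ℝ (Fin 2) := L.symm ∘ (WithLp.toLp 2 ∘
    (MeasurableEquiv.finTwoArrow (α := ℝ)).symm) with hφ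
  have hL1 : ∀ x y, L (φ (x, y)) = !₂[x, y] := by
    intro x y
    simp only [hφ, Function.comp, LinearIsometryEquiv.apply_symm_apply]
    rfl
  have hc0 : ∀ x y, u * φ (x, y) 0 + v * φ (x, y) 1 = x := by
    intro x y
    have := congrArg (fun z : EuclideanSpace ℝ (Fin 2) => z 0) ((hL0 (φ (x, y))).symm.trans (hL1 x y))
    simpa using this
  have hc1 : ∀ x y, -v * φ (x, y) 0 + u * φ (x, y) 1 = y := by
    intro x y
    have := congrArg (fun z : EuclideanSpace ℝ (Fin 2) => z 1) ((hL0 (φ (x, y))).symm.trans (hL1 x y))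
    simpa using this
  rw [← m3.measure_preimage hS.nullMeasurableSet]
  refine volume_prod_le_of_slices _ (m3.measurable hS) a l₁ l₂ ?_ ?_
  · rintro ⟨x, y⟩ hp
    have := h1 _ hp
    rw [hc0] at this
    exact this
  · intro x y z hy hz
    have := h2 (φ (x, y)) hy (φ (x, z)) hz (by rw [hc0, hc0])
    rwa [hc1, hc1] at this

lemma dist_sq_eq (x y : EuclideanSpace ℝ (Fin 2)) :
    dist x y ^ 2 = (x 0 - y 0) ^ 2 + (x 1 - y 1) ^ 2 := by
  rw [EuclideanSpace.dist_eq, Real.sq_sqrt (by positivity), Fin.sum_univ_two, Real.dist_eq,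
    Real.dist_eq, sq_abs, sq_abs]

lemma isClosed_annulus (δ : ℝ) (x : EuclideanSpace ℝ (Fin 2)) (r : ℝ) :
    IsClosed (annulus δ x r) :=
  isClosed_le (f := fun y => |dist y x - r|) (by fun_prop) continuous_const

lemma volume_annulus_le (δ : ℝ) (hδ : 0 < δ) (hδ1 : δ < 1) (x : EuclideanSpace ℝ (Fin 2)) (r : ℝ)
    (hr : 1 ≤ r) (hr2 : r ≤ 2) : volume (annulus (10 * δ) x r) ≤ ENNReal.ofReal (4800 * δ) := by
  have hsub : annulus (10 * δ) x r ⊆ closedBall x (r + 10 * δ) := by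
    intro y hy
    have hy' : |dist y x - r| ≤ 10 * δ := hy
    have := (abs_le.1 hy').2
    rw [mem_closedBall]; linarith
  have hpi := Real.pi_lt_d2
  have hpi0 := Real.pi_pos
  rcases le_or_gt (10 * δ) 1 with h | h
  · have hd : Disjoint (annulus (10 * δ) x r) (ball x (r - 10 * δ)) := by
      rw [Set.disjoint_left]
      intro y hy hy2
      have hy' : |dist y x - r| ≤ 10 * δ := hy
      have := (abs_le.1 hy').1
      rw [mem_ball] at hy2; linarith
    have h1 : volume (annulus (10 * δ) x r) + volume (ball x (r - 10 * δ)) ≤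
        volume (closedBall x (r + 10 * δ)) := by
      rw [← measure_union hd measurableSet_ball]
      refine measure_mono (union_subset hsub ?_)
      exact (ball_subset_closedBall).trans (closedBall_subset_closedBall (by linarith))
    rw [EuclideanSpace.volume_ball_fin_two, EuclideanSpace.volume_closedBall_fin_two,
      ← ENNReal.ofReal_pow (by linarith), ← ENNReal.ofReal_pow (by linarith),
      ← ENNReal.ofReal_mul (by positivity), ← ENNReal.ofReal_mul (by positivity)] at h1
    have h2 := (ENNReal.le_sub_of_add_le_right (by simp) h1)
    rw [← ENNReal.ofReal_sub _ (by positivity)] at h2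
    refine h2.trans (ENNReal.ofReal_le_ofReal ?_)
    have h3 : δ * Real.pi ≤ δ * 3.15 := mul_le_mul_of_nonneg_left hpi.le hδ.le
    have h4 : r * (δ * Real.pi) ≤ 2 * (δ * Real.pi) :=
      mul_le_mul_of_nonneg_right hr2 (by positivity)
    linarith
  · refine (measure_mono hsub).trans ?_
    rw [EuclideanSpace.volume_closedBall_fin_two,
      ← ENNReal.ofReal_pow (by linarith),
      ← ENNReal.ofReal_mul (by positivity)]
    refine (ENNReal.ofReal_le_ofReal ?_)
    have : (r + 10 * δ) ^ 2 ≤ 144 := by nlinarith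
    nlinarith

/-- The part of an annulus within `κ` of the point of its circle in direction `(U, V)`. -/
def sector (δ κ : ℝ) (x : EuclideanSpace ℝ (Fin 2)) (r U V : ℝ) :
    Set (EuclideanSpace ℝ (Fin 2)) :=
  {y | y ∈ annulus (10 * δ) x r ∧ (y 0 - x 0 - r * U) ^ 2 + (y 1 - x 1 - r * V) ^ 2 ≤ κ ^ 2}

lemma isClosed_sector (δ κ : ℝ) (x : EuclideanSpace ℝ (Fin 2)) (r U V : ℝ) :
    IsClosed (sector δ κ x r U V) :=
  (isClosed_annulus _ _ _).inter (isClosed_le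
    (f := fun y : EuclideanSpace ℝ (Fin 2) => (y 0 - x 0 - r * U) ^ 2 + (y 1 - x 1 - r * V) ^ 2) (by fun_prop) continuous_const)

lemma sector_coordinates {a b r U V ρ δ κ : ℝ} (hUV : U ^ 2 + V ^ 2 = 1) (hr : 1 ≤ r) (hr2 : r ≤ 2)
    (hκ : 0 ≤ κ) (hκ2 : κ ≤ 1 / 2) (hδ : 0 ≤ δ) (hρ0 : 0 ≤ ρ) (hρ : ρ ^ 2 = a ^ 2 + b ^ 2)
    (hρr : |ρ - r| ≤ 10 * δ) (h : (a - r * U) ^ 2 + (b - r * V) ^ 2 ≤ κ ^ 2) :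
    |(-V * a + U * b)| ≤ κ ∧ 1 / 2 ≤ U * a + V * b ∧
      |(U * a + V * b) ^ 2 + (-V * a + U * b) ^ 2 - r ^ 2| ≤ 45 * δ := by
  have e : (a - r * U) ^ 2 + (b - r * V) ^ 2 =
      (-V * a + U * b) ^ 2 + (U * a + V * b - r) ^ 2 := by
    linear_combination (r ^ 2 - a ^ 2 - b ^ 2) * hUV
  have e2 : ρ ^ 2 = (U * a + V * b) ^ 2 + (-V * a + U * b) ^ 2 := by
    linear_combination hρ - (a ^ 2 + b ^ 2) * hUV
  rw [← e2]
  rw [e] at h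
  generalize U * a + V * b = P at *
  generalize -V * a + U * b = Q at *
  have hκ4 : κ ^ 2 ≤ 1 / 4 := by nlinarith
  have h1 : (P - r) ^ 2 ≤ (1 / 2) ^ 2 := by linarith [sq_nonneg Q]
  have h1 := abs_le.1 (abs_le_of_sq_le_sq h1 (by norm_num))
  have h2 : Q ^ 2 ≤ κ ^ 2 := by linarith [sq_nonneg (P - r)]
  refine ⟨abs_le_of_sq_le_sq h2 hκ, by linarith [h1.1], ?_⟩
  have h5 : ρ ^ 2 ≤ (5 / 2) ^ 2 := by
    have : P ^ 2 + Q ^ 2 = ((P - r) ^ 2 + Q ^ 2) + 2 * r * (P - r) + r ^ 2 := by ring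
    rw [e2, this]
    nlinarith [h1.2]
  have h5 := abs_le_of_sq_le_sq h5 (by norm_num)
  rw [abs_of_nonneg hρ0] at h5
  rw [show ρ ^ 2 - r ^ 2 = (ρ - r) * (ρ + r) by ring, abs_mul,
    abs_of_nonneg (show 0 ≤ ρ + r by linarith)]
  calc |ρ - r| * (ρ + r) ≤ (10 * δ) * (9 / 2) :=
        mul_le_mul hρr (by linarith) (by linarith) (by linarith)
    _ = _ := by ring

lemma volume_sector_le (δ κ : ℝ) (hδ : 0 < δ) (hδ1 : δ < 1) (hκ : 0 ≤ κ)
    (x : EuclideanSpace ℝ (Fin 2)) (r U V : ℝ) (hUV : U ^ 2 + V ^ 2 = 1)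
    (hr : 1 ≤ r) (hr2 : r ≤ 2) :
    volume (sector δ κ x r U V) ≤ ENNReal.ofReal (9600 * δ * κ) := by
  rcases le_or_gt κ (1 / 2) with h | h
  · have main : ∀ p ∈ sector δ κ x r U V, _ := fun p hp =>
      sector_coordinates hUV hr hr2 hκ h hδ.le dist_nonneg (dist_sq_eq p x) hp.1 hp.2
    refine (volume_le_of_slices _ (isClosed_sector δ κ x r U V).measurableSet (-V) U
      (-V * x 0 + U * x 1 - κ) (2 * κ) (90 * δ) (by linarith) ?_ ?_).trans
      (ENNReal.ofReal_le_ofReal (by nlinarith))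
    · intro p hp
      have := abs_le.1 (main p hp).1
      constructor <;> linarith [this.1, this.2]
    · intro p hp q hq hpq
      obtain ⟨-, a1, a2⟩ := main p hp
      obtain ⟨-, b1, b2⟩ := main q hq
      have hQ : -V * (p 0 - x 0) + U * (p 1 - x 1) = -V * (q 0 - x 0) + U * (q 1 - x 1) := by linarith
      rw [hQ] at a2
      rw [show (- U * p 0 + -V * p 1) - (-U * q 0 + -V * q 1) =
        -((U * (p 0 - x 0) + V * (p 1 - x 1)) - (U * (q 0 - x 0) + V * (q 1 - x 1))) by ring, abs_neg]
      generalize U * (p 0 - x 0) + V * (p 1 - x 1) = P at *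
      generalize U * (q 0 - x 0) + V * (q 1 - x 1) = P' at *
      have h1 : |P - P'| * (P + P') ≤ 90 * δ := by
        rw [← abs_of_nonneg (show 0 ≤ P + P' by linarith), ← abs_mul]
        rw [show (P - P') * (P + P') = P ^ 2 - P' ^ 2 by ring]
        rw [abs_le] at a2 b2 ⊢
        constructor <;> linarith [a2.1, a2.2, b2.1, b2.2]
      nlinarith [abs_nonneg (P - P')]
  · refine (measure_mono (fun y hy => hy.1)).trans ((volume_annulus_le δ hδ hδ1 x r hr hr2).trans
      (ENNReal.ofReal_le_ofReal (by nlinarith)))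

lemma lens_coordinates {u v ρ σ r s D β δ : ℝ} (hr : 1 ≤ r) (hr2 : r ≤ 2) (hs : 1 ≤ s) (hs2 : s ≤ 2)
    (hδ : 0 < δ) (hD : 1000 * δ ≤ D) (hD1 : D ≤ 1 / 2) (hβ : 0 < β) (hβD : 82 * δ ≤ β ^ 2 * D)
    (hsep : β ^ 2 * D ^ 2 ≤ D ^ 2 - (s - r) ^ 2)
    (hρ0 : 0 ≤ ρ) (hσ0 : 0 ≤ σ) (hρ : ρ ^ 2 = u ^ 2 + v ^ 2) (hσ : σ ^ 2 = (u - D) ^ 2 + v ^ 2)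
    (hρr : |ρ - r| ≤ 10 * δ) (hσs : |σ - s| ≤ 10 * δ) :
    |u - (r ^ 2 - s ^ 2 + D ^ 2) / (2 * D)| ≤ 41 * δ / D ∧ β ^ 2 / 4 ≤ v ^ 2 ∧
      |u ^ 2 + v ^ 2 - r ^ 2| ≤ 41 * δ := by
  have hD0 : 0 < D := by linarith
  have a := abs_le.1 hρr
  have b := abs_le.1 hσs
  have h1 : |ρ ^ 2 - r ^ 2| ≤ 41 * δ := by
    rw [show ρ ^ 2 - r ^ 2 = (ρ - r) * (ρ + r) by ring, abs_mul,
      abs_of_nonneg (show 0 ≤ ρ + r by linarith)]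
    calc |ρ - r| * (ρ + r) ≤ (10 * δ) * (4.1) :=
          mul_le_mul hρr (by linarith) (by linarith) (by linarith)
      _ = _ := by ring
  have h2 : |σ ^ 2 - s ^ 2| ≤ 41 * δ := by
    rw [show σ ^ 2 - s ^ 2 = (σ - s) * (σ + s) by ring, abs_mul,
      abs_of_nonneg (show 0 ≤ σ + s by linarith)]
    calc |σ - s| * (σ + s) ≤ (10 * δ) * (4.1) :=
          mul_le_mul hσs (by linarith) (by linarith) (by linarith)
      _ = _ := by ring
  refine ⟨?_, ?_, by rwa [← hρ]⟩
  · have e : u - (r ^ 2 - s ^ 2 + D ^ 2) / (2 * D) =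
        ((ρ ^ 2 - r ^ 2) - (σ ^ 2 - s ^ 2)) / (2 * D) := by
      rw [hρ, hσ]; field_simp; ring
    rw [e, abs_div, abs_of_pos (show 0 < 2 * D by positivity), div_le_div_iff₀ (by positivity) hD0]
    have : |(ρ ^ 2 - r ^ 2) - (σ ^ 2 - s ^ 2)| ≤ 82 * δ := by
      refine (abs_sub _ _).trans (by linarith)
    nlinarith
  · have e : 4 * D ^ 2 * v ^ 2 = ((ρ + σ) ^ 2 - D ^ 2) * (D ^ 2 - (σ - ρ) ^ 2) := by
      have : (2 * D * u) = ρ ^ 2 - σ ^ 2 + D ^ 2 := by rw [hρ, hσ]; ring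
      have e3 : v ^ 2 = ρ ^ 2 - u ^ 2 := by linarith
      rw [e3]
      linear_combination (-(2 * D * u) - (ρ ^ 2 - σ ^ 2 + D ^ 2)) * this
    have h3 : 3 ≤ (ρ + σ) ^ 2 - D ^ 2 := by
      have h31 : (1.9 : ℝ) ^ 2 ≤ (ρ + σ) ^ 2 := pow_le_pow_left₀ (by norm_num) (by linarith) 2
      have h32 : D ^ 2 ≤ (1 / 2) ^ 2 := pow_le_pow_left₀ hD0.le hD1 2
      norm_num at h31 h32
      linarith
    have hpos : 0 < β ^ 2 * D ^ 2 := by positivity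
    have hR : |s - r| ≤ D := by
      refine abs_le_of_sq_le_sq ?_ hD0.le
      linarith
    have h4 : |(σ - ρ) - (s - r)| ≤ 20 * δ := by rw [abs_le]; constructor <;> linarith
    have h5 : |(σ - ρ) + (s - r)| ≤ 2 * D + 20 * δ := by
      rw [abs_le] at h4 hR ⊢; constructor <;> linarith
    have h6 : (σ - ρ) ^ 2 - (s - r) ^ 2 ≤ 41 * δ * D := by
      have : (σ - ρ) ^ 2 - (s - r) ^ 2 = ((σ - ρ) - (s - r)) * ((σ - ρ) + (s - r)) := by ring
      rw [this]
      refine (le_abs_self _).trans ?_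
      rw [abs_mul]
      refine (mul_le_mul h4 h5 (abs_nonneg _) (by positivity)).trans ?_
      have := mul_le_mul_of_nonneg_left hD hδ.le
      linarith [sq_nonneg δ]
    have h7 : β ^ 2 * D ^ 2 / 2 ≤ D ^ 2 - (σ - ρ) ^ 2 := by
      have := mul_le_mul_of_nonneg_right hβD hD0.le
      linarith
    have h8 : 3 * (β ^ 2 * D ^ 2 / 2) ≤ 4 * D ^ 2 * v ^ 2 := by
      rw [e]; exact mul_le_mul h3 h7 (by positivity) (by linarith)
    have h9 : D ^ 2 * (β ^ 2 / 4) ≤ D ^ 2 * v ^ 2 := by linarith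
    exact le_of_mul_le_mul_left h9 (by positivity)

/-- Two transversal annuli meet in a small area. -/
lemma volume_lens_le (δ β : ℝ) (x x' : EuclideanSpace ℝ (Fin 2)) (r s : ℝ)
    (hr : 1 ≤ r) (hr2 : r ≤ 2) (hs : 1 ≤ s) (hs2 : s ≤ 2)
    (hδ : 0 < δ) (hD : 1000 * δ ≤ dist x' x) (hD1 : dist x' x ≤ 1 / 2) (hβ : 0 < β)
    (hβD : 82 * δ ≤ β ^ 2 * dist x' x)
    (hsep : β ^ 2 * dist x' x ^ 2 ≤ dist x' x ^ 2 - (s - r) ^ 2) :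
    volume (annulus (10 * δ) x r ∩ annulus (10 * δ) x' s) ≤
      ENNReal.ofReal (13448 * δ ^ 2 / (dist x' x * β)) := by
  set D := dist x' x with hDdef
  have hD0 : 0 < D := by linarith
  have hDsq : D ^ 2 = (x' 0 - x 0) ^ 2 + (x' 1 - x 1) ^ 2 := dist_sq_eq x' x
  obtain ⟨U, hU⟩ : ∃ U, U = (x' 0 - x 0) / D := ⟨_, rfl⟩
  obtain ⟨V, hV⟩ : ∃ V, V = (x' 1 - x 1) / D := ⟨_, rfl⟩
  have hUV : U ^ 2 + V ^ 2 = 1 := by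
    rw [hU, hV, div_pow, div_pow, ← add_div, ← hDsq, div_self (by positivity)]
  have hUD : x' 0 - x 0 = D * U := by rw [hU]; field_simp
  have hVD : x' 1 - x 1 = D * V := by rw [hV]; field_simp
  have main : ∀ p ∈ annulus (10 * δ) x r ∩ annulus (10 * δ) x' s, _ := fun p hp =>
    lens_coordinates (u := U * (p 0 - x 0) + V * (p 1 - x 1)) (v := -V * (p 0 - x 0) + U * (p 1 - x 1))
      hr hr2 hs hs2 hδ hD hD1 hβ hβD hsep (dist_nonneg (x := p) (y := x))
      (dist_nonneg (x := p) (y := x'))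
      (by rw [dist_sq_eq]; linear_combination (-(p 0 - x 0) ^ 2 - (p 1 - x 1) ^ 2) * hUV)
      (by
        rw [dist_sq_eq, show p 0 - x' 0 = (p 0 - x 0) - D * U by rw [← hUD]; ring,
          show p 1 - x' 1 = (p 1 - x 1) - D * V by rw [← hVD]; ring]
        linear_combination (-(p 0 - x 0) ^ 2 - (p 1 - x 1) ^ 2 + D ^ 2) * hUV) hp.1 hp.2
  have half : ∀ c : ℝ, c ^ 2 = 1 → volume ((annulus (10 * δ) x r ∩ annulus (10 * δ) x' s) ∩
      {p | 0 ≤ c * (-V * (p 0 - x 0) + U * (p 1 - x 1))}) ≤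
      ENNReal.ofReal (6724 * δ ^ 2 / (D * β)) := by
    intro c hc
    refine (volume_le_of_slices _ (IsClosed.measurableSet
      (((isClosed_annulus _ _ _).inter (isClosed_annulus _ _ _)).inter
      (isClosed_le continuous_const (by fun_prop)))) U V
      (U * x 0 + V * x 1 + (r ^ 2 - s ^ 2 + D ^ 2) / (2 * D) - 41 * δ / D) (2 * (41 * δ / D))
      (82 * δ / β) hUV ?_ ?_).trans (ENNReal.ofReal_le_ofReal (le_of_eq (by field_simp; ring)))
    · rintro p ⟨hp, -⟩
      have := abs_le.1 (main p hp).1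
      constructor <;> linarith [this.1, this.2]
    · rintro p ⟨hp, hp2⟩ q ⟨hq, hq2⟩ hpq
      obtain ⟨-, a1, a2⟩ := main p hp
      obtain ⟨-, b1, b2⟩ := main q hq
      have hQ : U * (p 0 - x 0) + V * (p 1 - x 1) = U * (q 0 - x 0) + V * (q 1 - x 1) := by linarith
      rw [hQ] at a2
      rw [mem_ofPred_eq] at hp2 hq2
      rw [show (- V * p 0 + U * p 1) - (-V * q 0 + U * q 1) =
        (-V * (p 0 - x 0) + U * (p 1 - x 1)) - (-V * (q 0 - x 0) + U * (q 1 - x 1)) by ring]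
      generalize -V * (p 0 - x 0) + U * (p 1 - x 1) = P at *
      generalize -V * (q 0 - x 0) + U * (q 1 - x 1) = P' at *
      have hc1 : |c| = 1 := by rw [← abs_one, ← sq_eq_sq_iff_abs_eq_abs]; linarith
      have hP : β / 2 ≤ c * P := by
        refine le_of_sq_le_sq ?_ hp2
        rw [mul_pow, hc]; linarith
      have hP' : β / 2 ≤ c * P' := by
        refine le_of_sq_le_sq ?_ hq2
        rw [mul_pow, hc]; linarith
      have h1 : |c * P - c * P'| * (c * P + c * P') ≤ 82 * δ := by
        rw [← abs_of_nonneg (show 0 ≤ c * P + c * P' by linarith), ← abs_mul]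
        rw [show (c * P - c * P') * (c * P + c * P') = c ^ 2 * (P ^ 2 - P' ^ 2) by ring, hc, one_mul]
        rw [abs_le] at a2 b2 ⊢
        constructor <;> linarith [a2.1, a2.2, b2.1, b2.2]
      rw [← mul_sub, abs_mul, hc1, one_mul] at h1
      rw [le_div_iff₀ hβ]
      nlinarith [abs_nonneg (P - P')]
  have hcover : annulus (10 * δ) x r ∩ annulus (10 * δ) x' s ⊆
      ((annulus (10 * δ) x r ∩ annulus (10 * δ) x' s) ∩
        {p | 0 ≤ 1 * (-V * (p 0 - x 0) + U * (p 1 - x 1))}) ∪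
      ((annulus (10 * δ) x r ∩ annulus (10 * δ) x' s) ∩
        {p | 0 ≤ (-1) * (-V * (p 0 - x 0) + U * (p 1 - x 1))}) := by
    intro p hp
    rcases le_total 0 (-V * (p 0 - x 0) + U * (p 1 - x 1)) with h | h
    · exact Or.inl ⟨hp, by rw [mem_ofPred_eq]; linarith⟩
    · exact Or.inr ⟨hp, by rw [mem_ofPred_eq]; linarith⟩
  calc _ ≤ _ := (measure_mono hcover).trans (measure_union_le _ _)
    _ ≤ ENNReal.ofReal (6724 * δ ^ 2 / (D * β)) + ENNReal.ofReal (6724 * δ ^ 2 / (D * β)) :=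
      add_le_add (half 1 (by norm_num)) (half (-1) (by norm_num))
    _ = _ := by
      rw [← ENNReal.ofReal_add (by positivity) (by positivity)]
      congr 1; ring

/-- Two circles whose centres differ by `(ξ, ζ)` (a vector of length `D`, in the sector around the
negative first axis) and whose radii differ by `R`, the `10δ`-annuli around which meet. -/
structure CirclePair (δ ξ ζ R D lam T η : ℝ) : Prop where
  hδ : 0 < δ
  hD : 1000 * δ ≤ D
  hsq : D ^ 2 = ξ ^ 2 + ζ ^ 2
  hξ : ξ ≤ 0
  hζ : ζ ^ 2 ≤ ξ ^ 2
  hR0 : 0 ≤ R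
  hR : R ≤ D + 20 * δ
  hlam : lam = R - ξ
  hT : T * lam = -ζ
  hη : η = R + ξ + ζ * T

namespace CirclePair

variable {δ ξ ζ R D lam T η : ℝ}

lemma D_pos (h : CirclePair δ ξ ζ R D lam T η) : 0 < D := by linarith [h.hδ, h.hD]

lemma abs_xi_ge (h : CirclePair δ ξ ζ R D lam T η) : 0.7 * D ≤ -ξ := by
  have h1 := h.hsq
  have h2 := h.hζ
  refine le_of_sq_le_sq ?_ (by linarith [h.hξ])
  linarith [sq_nonneg D]

lemma abs_xi_le (h : CirclePair δ ξ ζ R D lam T η) : -ξ ≤ D := by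
  have h1 := h.hsq
  refine le_of_sq_le_sq ?_ h.D_pos.le
  linarith [sq_nonneg ζ]

lemma abs_zeta_le (h : CirclePair δ ξ ζ R D lam T η) : |ζ| ≤ D := by
  have h1 := h.hsq
  refine abs_le_of_sq_le_sq ?_ h.D_pos.le
  linarith [sq_nonneg ξ]

lemma R_le (h : CirclePair δ ξ ζ R D lam T η) : R ≤ 1.02 * D := by
  linarith [h.hR, h.hD]

lemma lam_ge (h : CirclePair δ ξ ζ R D lam T η) : R + 0.7 * D ≤ lam := by
  linarith [h.abs_xi_ge, h.hlam]

lemma lam_le (h : CirclePair δ ξ ζ R D lam T η) : lam ≤ 2.1 * D := by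
  linarith [h.abs_xi_le, h.hlam, h.R_le, h.D_pos]

lemma lam_pos (h : CirclePair δ ξ ζ R D lam T η) : 0 < lam := by
  linarith [h.lam_ge, h.D_pos, h.hR0]

lemma abs_T_le (h : CirclePair δ ξ ζ R D lam T η) : |T| ≤ 1 := by
  have h1 : |T| * lam = |ζ| := by
    rw [← abs_of_pos h.lam_pos, ← abs_mul, h.hT, abs_neg]
  have h2 : |ζ| ≤ -ξ := by
    refine abs_le_of_sq_le_sq ?_ (by linarith [h.hξ])
    linarith [h.hζ]
  have h3 : |T| * lam ≤ 1 * lam := by linarith [h.hlam, h.hR0]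
  exact le_of_mul_le_mul_right h3 h.lam_pos

lemma eta_mul_lam (h : CirclePair δ ξ ζ R D lam T η) : η * lam = R ^ 2 - D ^ 2 := by
  rw [h.hη, h.hsq]
  linear_combination ζ * h.hT + (R + ξ) * h.hlam

lemma abs_eta_mul_lam (h : CirclePair δ ξ ζ R D lam T η) : |η| * lam = |R - D| * (R + D) := by
  rw [← abs_of_pos h.lam_pos, ← abs_mul, h.eta_mul_lam,
    show R ^ 2 - D ^ 2 = (R - D) * (R + D) by ring, abs_mul,
    abs_of_nonneg (show 0 ≤ R + D by linarith [h.hR0, h.D_pos])]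

lemma abs_eta_le (h : CirclePair δ ξ ζ R D lam T η) : |η| ≤ 2 * D := by
  refine le_of_mul_le_mul_right ?_ h.lam_pos
  rw [h.abs_eta_mul_lam]
  have h1 : |R - D| ≤ D := by
    rw [abs_le]; constructor <;> linarith [h.hR0, h.R_le, h.D_pos]
  have h2 := h.lam_ge
  have h3 := h.D_pos
  have h4 := h.hR0
  calc |R - D| * (R + D) ≤ D * (R + D) := mul_le_mul_of_nonneg_right h1 (by linarith)
    _ ≤ D * (2 * lam) := mul_le_mul_of_nonneg_left (by linarith) h3.le
    _ = _ := by ring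

lemma abs_R_sub_D_le (h : CirclePair δ ξ ζ R D lam T η) : |R - D| ≤ 2.1 * |η| := by
  refine le_of_mul_le_mul_right ?_ h.D_pos
  calc |R - D| * D ≤ |R - D| * (R + D) :=
        mul_le_mul_of_nonneg_left (by linarith [h.hR0]) (abs_nonneg _)
    _ = |η| * lam := h.abs_eta_mul_lam.symm
    _ ≤ |η| * (2.1 * D) := mul_le_mul_of_nonneg_left h.lam_le (abs_nonneg _)
    _ = _ := by ring

lemma eta_le (h : CirclePair δ ξ ζ R D lam T η) : η ≤ 60 * δ := by
  refine le_of_mul_le_mul_right ?_ h.lam_pos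
  rw [h.eta_mul_lam]
  have h1 := h.hR
  have h2 := h.R_le
  have h3 := h.D_pos
  have h4 := h.hR0
  have h5 := h.hδ
  calc R ^ 2 - D ^ 2 = (R - D) * (R + D) := by ring
    _ ≤ (20 * δ) * (R + D) := mul_le_mul_of_nonneg_right (by linarith) (by linarith)
    _ ≤ (20 * δ) * (3 * lam) :=
      mul_le_mul_of_nonneg_left (by linarith [h.lam_ge]) (by linarith)
    _ = _ := by ring

/-- The direction of tangency is close to the direction between the centres. -/
lemma direction_sq_le (h : CirclePair δ ξ ζ R D lam T η) :
    (-ξ / D - (1 - T ^ 2) / (1 + T ^ 2)) ^ 2 + (-ζ / D - 2 * T / (1 + T ^ 2)) ^ 2 ≤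
      6.2 * |η| / D := by
  have hD := h.D_pos
  have h0 : 0 < 1 + T ^ 2 := by positivity
  have e1 : R + ξ * ((1 - T ^ 2) / (1 + T ^ 2)) + ζ * (2 * T / (1 + T ^ 2)) = η / (1 + T ^ 2) := by
    rw [h.hη]
    field_simp
    linear_combination -T ^ 2 * h.hlam + T * h.hT
  have e2 : (-ξ / D) ^ 2 + (-ζ / D) ^ 2 = 1 := by
    rw [div_pow, div_pow, ← add_div, neg_sq, neg_sq, ← h.hsq, div_self (by positivity)]
  have e3 : ((1 - T ^ 2) / (1 + T ^ 2)) ^ 2 + (2 * T / (1 + T ^ 2)) ^ 2 = 1 := by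
    field_simp; ring
  have e4 : (-ξ / D - (1 - T ^ 2) / (1 + T ^ 2)) ^ 2 + (-ζ / D - 2 * T / (1 + T ^ 2)) ^ 2 =
      2 * (D - R + η / (1 + T ^ 2)) / D := by
    rw [← e1]
    have : D - R + (R + ξ * ((1 - T ^ 2) / (1 + T ^ 2)) + ζ * (2 * T / (1 + T ^ 2))) =
      D * (1 - (-ξ / D) * ((1 - T ^ 2) / (1 + T ^ 2)) - (-ζ / D) * (2 * T / (1 + T ^ 2))) := by
      field_simp; ring
    rw [this, ← mul_assoc, mul_comm 2 D, mul_assoc, mul_div_cancel_left₀ _ hD.ne']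
    linear_combination e2 + e3
  rw [e4]
  have h1 : η / (1 + T ^ 2) ≤ |η| := by
    rw [div_le_iff₀ h0]
    have := le_abs_self η
    have := mul_nonneg (abs_nonneg η) (sq_nonneg T)
    linarith
  have h2 := (abs_le.1 h.abs_R_sub_D_le).1
  refine div_le_div_of_nonneg_right ?_ hD.le
  linarith

end CirclePair

lemma sq_add_four_le (a b c d : ℝ) :
    (a + b + c + d) ^ 2 ≤ 4 * (a ^ 2 + b ^ 2 + c ^ 2 + d ^ 2) := by
  nlinarith [sq_nonneg (a - b), sq_nonneg (a - c), sq_nonneg (a - d), sq_nonneg (b - c),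
    sq_nonneg (b - d), sq_nonneg (c - d)]

lemma direction_lipschitz (T T' : ℝ) :
    ((1 - T ^ 2) / (1 + T ^ 2) - (1 - T' ^ 2) / (1 + T' ^ 2)) ^ 2 +
      (2 * T / (1 + T ^ 2) - 2 * T' / (1 + T' ^ 2)) ^ 2 ≤ 4 * (T - T') ^ 2 := by
  have e : ((1 - T ^ 2) / (1 + T ^ 2) - (1 - T' ^ 2) / (1 + T' ^ 2)) ^ 2 +
      (2 * T / (1 + T ^ 2) - 2 * T' / (1 + T' ^ 2)) ^ 2 =
      4 * (T - T') ^ 2 / ((1 + T ^ 2) * (1 + T' ^ 2)) := by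
    field_simp; ring
  rw [e]
  refine div_le_self (by positivity) ?_
  nlinarith [sq_nonneg T, sq_nonneg T', mul_nonneg (sq_nonneg T) (sq_nonneg T')]

lemma sum_four_vectors_le {a₀ a₁ b₀ b₁ c₀ c₁ d₀ d₁ A B C D : ℝ} (ha : a₀ ^ 2 + a₁ ^ 2 ≤ A)
    (hb : b₀ ^ 2 + b₁ ^ 2 ≤ B) (hc : c₀ ^ 2 + c₁ ^ 2 ≤ C) (hd : d₀ ^ 2 + d₁ ^ 2 ≤ D) :
    (a₀ + b₀ + c₀ + d₀) ^ 2 + (a₁ + b₁ + c₁ + d₁) ^ 2 ≤ 4 * (A + B + C + D) := by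
  linarith [sq_add_four_le a₀ b₀ c₀ d₀, sq_add_four_le a₁ b₁ c₁ d₁]

/-- If a point at distance about `r` from a centre lies in direction `(p, q)` up to `O(θ)`,
it lies within `O(θ)` of the point of the circle in a nearby direction. -/
lemma near_direction {z₀ z₁ ρ r δ θ p q U V U' V' : ℝ} (hθ : 0 < θ) (hr : 0 ≤ r) (hr2 : r ≤ 2)
    (hpq : p ^ 2 + q ^ 2 = 1) (h1 : (z₀ - ρ * p) ^ 2 + (z₁ - ρ * q) ^ 2 ≤ 22 * θ ^ 2)
    (h2 : |ρ - r| ≤ 10 * δ) (hδ : 10 * δ ≤ θ) (h3 : (p - U) ^ 2 + (q - V) ^ 2 ≤ 6.2 * θ ^ 2)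
    (h4 : (U - U') ^ 2 + (V - V') ^ 2 ≤ 4 * θ ^ 2) :
    (z₀ - r * U') ^ 2 + (z₁ - r * V') ^ 2 ≤ (20 * θ) ^ 2 := by
  have hr4 : r ^ 2 ≤ 4 := by nlinarith
  have h5 : ((ρ - r) * p) ^ 2 + ((ρ - r) * q) ^ 2 ≤ θ ^ 2 := by
    have : ((ρ - r) * p) ^ 2 + ((ρ - r) * q) ^ 2 = (ρ - r) ^ 2 := by
      linear_combination (ρ - r) ^ 2 * hpq
    rw [this]
    exact sq_le_sq' (by linarith [(abs_le.1 h2).1]) (by linarith [(abs_le.1 h2).2])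
  have h6 : (r * (p - U)) ^ 2 + (r * (q - V)) ^ 2 ≤ 24.8 * θ ^ 2 := by
    have : (r * (p - U)) ^ 2 + (r * (q - V)) ^ 2 = r ^ 2 * ((p - U) ^ 2 + (q - V) ^ 2) := by ring
    rw [this]
    refine (mul_le_mul hr4 h3 (by positivity) (by norm_num)).trans (by linarith)
  have h7 : (r * (U - U')) ^ 2 + (r * (V - V')) ^ 2 ≤ 16 * θ ^ 2 := by
    have : (r * (U - U')) ^ 2 + (r * (V - V')) ^ 2 = r ^ 2 * ((U - U') ^ 2 + (V - V') ^ 2) := by ring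
    rw [this]
    refine (mul_le_mul hr4 h4 (by positivity) (by norm_num)).trans (by linarith)
  have := sum_four_vectors_le h1 h5 h6 h7
  have e0 : z₀ - r * U' = (z₀ - ρ * p) + (ρ - r) * p + r * (p - U) + r * (U - U') := by ring
  have e1 : z₁ - r * V' = (z₁ - ρ * q) + (ρ - r) * q + r * (q - V) + r * (V - V') := by ring
  rw [e0, e1]
  refine this.trans ?_
  nlinarith [sq_nonneg θ]

set_option maxHeartbeats 400000 in
/-- A point in both annuli of an almost tangent pair is near the point of tangency. -/
lemma CirclePair.near_tangency {δ ξ ζ R D lam T η t θ T' r s z₀ z₁ ρ σ : ℝ}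
    (h : CirclePair δ ξ ζ R D lam T η) (hD1 : D ≤ 1 / 2) (ht0 : 0 < t) (ht : t ≤ D) (hθ : 0 < θ)
    (hθ2 : θ ≤ 2)
    (hη : |η| ≤ t * θ ^ 2) (hδ : 1000 * δ ≤ t * θ ^ 2) (hT' : |T - T'| ≤ θ)
    (hr : 1 ≤ r) (hr2 : r ≤ 2) (hs : 1 ≤ s) (hs2 : s ≤ 2) (hRrs : R = s - r)
    (hρ0 : 0 ≤ ρ) (hσ0 : 0 ≤ σ) (hρ : ρ ^ 2 = z₀ ^ 2 + z₁ ^ 2)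
    (hσ : σ ^ 2 = (z₀ - ξ) ^ 2 + (z₁ - ζ) ^ 2)
    (hρr : |ρ - r| ≤ 10 * δ) (hσs : |σ - s| ≤ 10 * δ) :
    ((z₀ - r * ((1 - T' ^ 2) / (1 + T' ^ 2))) ^ 2 + (z₁ - r * (2 * T' / (1 + T' ^ 2))) ^ 2 ≤
      (20 * θ) ^ 2) ∧
    ((z₀ - ξ - s * ((1 - T' ^ 2) / (1 + T' ^ 2))) ^ 2 + (z₁ - ζ - s * (2 * T' / (1 + T' ^ 2))) ^ 2 ≤
      (20 * θ) ^ 2) := by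
  have hD := h.D_pos
  have hD' := h.hD
  have e2 : (-ξ / D) ^ 2 + (-ζ / D) ^ 2 = 1 := by
    rw [div_pow, div_pow, ← add_div, neg_sq, neg_sq, ← h.hsq, div_self (by positivity)]
  have htD : t * θ ^ 2 / D ≤ θ ^ 2 := by
    rw [div_le_iff₀ hD, mul_comm]
    exact mul_le_mul_of_nonneg_left ht (sq_nonneg θ)
  have hδθ : 10 * δ ≤ θ := by
    have : t * θ ^ 2 ≤ 1 / 2 * (2 * θ) := by
      refine mul_le_mul (by linarith) ?_ (sq_nonneg _) (by norm_num)
      nlinarith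
    linarith
  have h3 : (-ξ / D - (1 - T ^ 2) / (1 + T ^ 2)) ^ 2 + (-ζ / D - 2 * T / (1 + T ^ 2)) ^ 2 ≤
      6.2 * θ ^ 2 := by
    refine h.direction_sq_le.trans ?_
    calc 6.2 * |η| / D ≤ 6.2 * (t * θ ^ 2) / D := by gcongr
      _ = 6.2 * (t * θ ^ 2 / D) := by ring
      _ ≤ _ := by gcongr
  have h4 := (direction_lipschitz T T').trans
    (mul_le_mul_of_nonneg_left (sq_le_sq' (by linarith [(abs_le.1 hT').1]) (abs_le.1 hT').2)
      (by norm_num : (0:ℝ) ≤ 4))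
  have a := abs_le.1 hρr
  have b := abs_le.1 hσs
  have hgap : ρ - σ + D ≤ 2.2 * (t * θ ^ 2) := by
    have := (abs_le.1 h.abs_R_sub_D_le).1
    linarith [a.2, b.1]
  have hδ2 := h.hδ
  have gen : ∀ K, 0 ≤ K → K ≤ 4.6 → (ρ - σ + D) * K / D ≤ 10.12 * θ ^ 2 := by
    intro K h0 h1
    rw [div_le_iff₀ hD]
    have : t * θ ^ 2 ≤ D * θ ^ 2 := mul_le_mul_of_nonneg_right ht (sq_nonneg θ)
    calc (ρ - σ + D) * K ≤ (2.2 * (D * θ ^ 2)) * K := mul_le_mul_of_nonneg_right (by linarith) h0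
      _ ≤ (2.2 * (D * θ ^ 2)) * 4.6 := mul_le_mul_of_nonneg_left h1 (by positivity)
      _ = _ := by ring
  constructor
  · refine near_direction hθ (by linarith) hr2 e2 ?_ hρr hδθ h3 h4
    have e : (z₀ - ρ * (-ξ / D)) ^ 2 + (z₁ - ρ * (-ζ / D)) ^ 2 =
        ρ * ((ρ - σ + D) * (ρ + σ + D) / D) := by
      have : (z₀ - ρ * (-ξ / D)) ^ 2 + (z₁ - ρ * (-ζ / D)) ^ 2 =
        (z₀ ^ 2 + z₁ ^ 2) + ρ ^ 2 * ((-ξ / D) ^ 2 + (-ζ / D) ^ 2) + 2 * ρ * (z₀ * ξ + z₁ * ζ) / D := by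
        field_simp; ring
      rw [this, e2, ← hρ]
      have h5 : 2 * (z₀ * ξ + z₁ * ζ) = ρ ^ 2 + D ^ 2 - σ ^ 2 := by rw [hρ, hσ, h.hsq]; ring
      field_simp
      linear_combination ρ * h5
    rw [e]
    have := gen (ρ + σ + D) (by linarith) (by linarith)
    calc ρ * ((ρ - σ + D) * (ρ + σ + D) / D) ≤ ρ * (10.12 * θ ^ 2) :=
          mul_le_mul_of_nonneg_left this hρ0
      _ ≤ 2.1 * (10.12 * θ ^ 2) := mul_le_mul_of_nonneg_right (by linarith) (by positivity)
      _ ≤ _ := by nlinarith [sq_nonneg θ]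
  · refine near_direction hθ (by linarith) hs2 e2 ?_ hσs hδθ h3 h4
    have e : (z₀ - ξ - σ * (-ξ / D)) ^ 2 + (z₁ - ζ - σ * (-ζ / D)) ^ 2 =
        σ * ((ρ - σ + D) * (ρ + σ - D) / D) := by
      have : (z₀ - ξ - σ * (-ξ / D)) ^ 2 + (z₁ - ζ - σ * (-ζ / D)) ^ 2 =
        ((z₀ - ξ) ^ 2 + (z₁ - ζ) ^ 2) + σ ^ 2 * ((-ξ / D) ^ 2 + (-ζ / D) ^ 2) +
          2 * σ * ((z₀ - ξ) * ξ + (z₁ - ζ) * ζ) / D := by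
        field_simp; ring
      rw [this, e2, ← hσ]
      have h5 : 2 * ((z₀ - ξ) * ξ + (z₁ - ζ) * ζ) = ρ ^ 2 - D ^ 2 - σ ^ 2 := by
        rw [hρ, hσ, h.hsq]; ring
      field_simp
      linear_combination σ * h5
    rw [e]
    have := gen (ρ + σ - D) (by linarith) (by linarith)
    calc σ * ((ρ - σ + D) * (ρ + σ - D) / D) ≤ σ * (10.12 * θ ^ 2) :=
          mul_le_mul_of_nonneg_left this hσ0
      _ ≤ 2.1 * (10.12 * θ ^ 2) := mul_le_mul_of_nonneg_right (by linarith) (by positivity)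
      _ ≤ _ := by nlinarith [sq_nonneg θ]

lemma CirclePair.value_le {δ ξ ζ R D lam T η t θ τ : ℝ} (h : CirclePair δ ξ ζ R D lam T η)
    (ht0 : 0 < t) (ht2 : D ≤ 2 * t) (hθ : 0 < θ) (hη : |η| ≤ t * θ ^ 2) (hτ : |T - τ| ≤ θ) :
    |R + ξ + 2 * ζ * τ + lam * τ ^ 2| ≤ 5.2 * (t * θ ^ 2) ∧
      |2 * ζ + 2 * lam * τ| ≤ 8.4 * (t * θ) := by
  have e1 : R + ξ + 2 * ζ * τ + lam * τ ^ 2 = η + lam * (T - τ) ^ 2 := by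
    linear_combination (-T + 2 * τ) * h.hT - h.hη
  have e2 : 2 * ζ + 2 * lam * τ = -(2 * lam * (T - τ)) := by
    linear_combination 2 * h.hT
  have hl : lam ≤ 4.2 * t := by linarith [h.lam_le]
  have hl0 := h.lam_pos
  constructor
  · rw [e1]
    have h1 : lam * (T - τ) ^ 2 ≤ 4.2 * t * θ ^ 2 := by
      rw [← sq_abs (T - τ)]
      have : |T - τ| ^ 2 ≤ θ ^ 2 := pow_le_pow_left₀ (abs_nonneg _) hτ 2
      exact mul_le_mul hl this (sq_nonneg _) (by positivity)
    have h2 : |lam * (T - τ) ^ 2| ≤ 4.2 * t * θ ^ 2 := by rwa [abs_of_nonneg (by positivity)]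
    refine (abs_add_le _ _).trans (by linarith)
  · rw [e2, abs_neg, abs_mul, abs_of_pos (show 0 < 2 * lam by linarith)]
    calc 2 * lam * |T - τ| ≤ 2 * (4.2 * t) * θ :=
          mul_le_mul (by linarith) hτ (abs_nonneg _) (by positivity)
      _ = _ := by ring

/-- Almost tangency is stable under small changes of the two circles. -/
lemma CirclePair.stable {δ ξ ζ R D lam T η t θ τ ξ' ζ' R' lam' : ℝ}
    (h : CirclePair δ ξ ζ R D lam T η)
    (ht0 : 0 < t) (ht : t ≤ D) (ht2 : D ≤ 2 * t) (hθ : 0 < θ) (hθ2 : θ ≤ 2)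
    (hη : |η| ≤ t * θ ^ 2) (hτ : |T - τ| ≤ θ)
    (hf : |(R' + ξ' + 2 * ζ' * τ + lam' * τ ^ 2) - (R + ξ + 2 * ζ * τ + lam * τ ^ 2)| ≤
      2 * (t * θ ^ 2))
    (hg : |(2 * ζ' + 2 * lam' * τ) - (2 * ζ + 2 * lam * τ)| ≤ 2 * (t * θ))
    (hl : |lam' - lam| ≤ t / 8) :
    |-ζ' / lam' - τ| ≤ 11 * θ ∧ t / 2 ≤ lam' ∧
      |R' + ξ' + ζ' * (-ζ' / lam')| ≤ 62 * (t * θ ^ 2) ∧ |-ζ' / lam'| < 26 := by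
  obtain ⟨hf0, hg0⟩ := h.value_le ht0 ht2 hθ hη hτ
  have hlam : t / 2 ≤ lam' := by
    have := h.lam_ge
    linarith [(abs_le.1 hl).1, h.hR0]
  have hlam0 : 0 < lam' := by linarith
  have hf1 : |R' + ξ' + 2 * ζ' * τ + lam' * τ ^ 2| ≤ 7.2 * (t * θ ^ 2) := by
    rw [abs_le] at hf hf0 ⊢; constructor <;> linarith
  have hg1 : |2 * ζ' + 2 * lam' * τ| ≤ 10.4 * (t * θ) := by
    rw [abs_le] at hg hg0 ⊢; constructor <;> linarith
  have e1 : -ζ' / lam' - τ = -(2 * ζ' + 2 * lam' * τ) / (2 * lam') := by field_simp; ring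
  have h1 : |-ζ' / lam' - τ| ≤ 11 * θ := by
    rw [e1, abs_div, abs_neg, abs_of_pos (show 0 < 2 * lam' by positivity), div_le_iff₀ (by positivity)]
    have : θ * (t / 2) ≤ θ * lam' := mul_le_mul_of_nonneg_left hlam hθ.le
    linarith [mul_pos hθ ht0]
  refine ⟨h1, hlam, ?_, ?_⟩
  · have e2 : R' + ξ' + ζ' * (-ζ' / lam') = (R' + ξ' + 2 * ζ' * τ + lam' * τ ^ 2) -
        (2 * ζ' + 2 * lam' * τ) ^ 2 / (4 * lam') := by field_simp; ring
    rw [e2]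
    have h2 : (2 * ζ' + 2 * lam' * τ) ^ 2 / (4 * lam') ≤ 54.2 * (t * θ ^ 2) := by
      rw [div_le_iff₀ (by positivity)]
      have h3 : (2 * ζ' + 2 * lam' * τ) ^ 2 ≤ (10.4 * (t * θ)) ^ 2 := by
        rw [← sq_abs]; exact pow_le_pow_left₀ (abs_nonneg _) hg1 2
      have h4 : t * θ ^ 2 * (t / 2) ≤ t * θ ^ 2 * lam' :=
        mul_le_mul_of_nonneg_left hlam (by positivity)
      nlinarith [mul_pos (pow_pos ht0 2) (pow_pos hθ 2)]
    have h5 : 0 ≤ (2 * ζ' + 2 * lam' * τ) ^ 2 / (4 * lam') := by positivity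
    have h6 : 0 < t * θ ^ 2 := by positivity
    rw [abs_le] at hf1 ⊢; constructor <;> linarith
  · have h2 := h.abs_T_le
    rw [abs_le] at h1 h2 hτ
    rw [abs_lt]
    constructor <;> linarith

/-- A circle in the plane, given by its centre and its radius. -/
abbrev PlaneCircle := EuclideanSpace ℝ (Fin 2) × ℝ

/-- The coordinate of the centre along the direction `e`. -/
def along (e : ℝ × ℝ) (w : PlaneCircle) : ℝ := e.1 * w.1 0 + e.2 * w.1 1

/-- The coordinate of the centre across the direction `e`. -/
def across (e : ℝ × ℝ) (w : PlaneCircle) : ℝ := -e.2 * w.1 0 + e.1 * w.1 1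

/-- The leading coefficient of the difference of the quadratics of two circles. -/
def curv (e : ℝ × ℝ) (a c : PlaneCircle) : ℝ := (c.2 - a.2) - (along e c - along e a)

/-- The parameter of (almost) tangency of two circles. -/
noncomputable def tanParam (e : ℝ × ℝ) (a c : PlaneCircle) : ℝ :=
  -(across e c - across e a) / curv e a c

/-- The deviation from tangency of two circles. -/
noncomputable def defect (e : ℝ × ℝ) (a c : PlaneCircle) : ℝ :=
  (c.2 - a.2) + (along e c - along e a) + (across e c - across e a) * tanParam e a c

/-- The part of the annulus around the circle `w` near the direction of parameter `τ`. -/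
noncomputable def arcSector (δ θ : ℝ) (e : ℝ × ℝ) (τ : ℝ) (w : PlaneCircle) :
    Set (EuclideanSpace ℝ (Fin 2)) :=
  sector δ (20 * θ) w.1 w.2 (((1 - τ ^ 2) / (1 + τ ^ 2)) * e.1 - (2 * τ / (1 + τ ^ 2)) * e.2)
    (((1 - τ ^ 2) / (1 + τ ^ 2)) * e.2 + (2 * τ / (1 + τ ^ 2)) * e.1)

/-- A pair of circles at distance about `t`, tangent at scale `θ`. -/
structure TangentPair (δ t θ : ℝ) (e : ℝ × ℝ) (a c : PlaneCircle) : Prop where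
  pair : CirclePair δ (along e c - along e a) (across e c - across e a) (c.2 - a.2)
    (dist c.1 a.1) (curv e a c) (tanParam e a c) (defect e a c)
  dist_le_half : dist c.1 a.1 ≤ 1 / 2
  le_dist : t ≤ dist c.1 a.1
  dist_le : dist c.1 a.1 ≤ 2 * t
  defect_le : |defect e a c| ≤ t * θ ^ 2
  delta_le : 2000 * δ ≤ t * θ ^ 2
  le_defect : t * θ ^ 2 / 4 ≤ |defect e a c| ∨ t * θ ^ 2 ≤ 8000 * δ

lemma frame_sq {e : ℝ × ℝ} (he : e.1 ^ 2 + e.2 ^ 2 = 1) (p q : ℝ) :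
    (e.1 * p + e.2 * q) ^ 2 + (-e.2 * p + e.1 * q) ^ 2 = p ^ 2 + q ^ 2 := by
  linear_combination (p ^ 2 + q ^ 2) * he

lemma direction_unit {e : ℝ × ℝ} (he : e.1 ^ 2 + e.2 ^ 2 = 1) (τ : ℝ) :
    (((1 - τ ^ 2) / (1 + τ ^ 2)) * e.1 - (2 * τ / (1 + τ ^ 2)) * e.2) ^ 2 +
    (((1 - τ ^ 2) / (1 + τ ^ 2)) * e.2 + (2 * τ / (1 + τ ^ 2)) * e.1) ^ 2 = 1 := by
  have e3 : ((1 - τ ^ 2) / (1 + τ ^ 2)) ^ 2 + (2 * τ / (1 + τ ^ 2)) ^ 2 = 1 := by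
    field_simp; ring
  linear_combination e3 * (e.1 ^ 2 + e.2 ^ 2) + he

lemma volume_arcSector_le (δ θ : ℝ) (e : ℝ × ℝ) (τ : ℝ) (w : PlaneCircle) (hδ : 0 < δ) (hδ1 : δ < 1)
    (hθ : 0 < θ) (he : e.1 ^ 2 + e.2 ^ 2 = 1) (hw : 1 ≤ w.2 ∧ w.2 ≤ 2) :
    volume (arcSector δ θ e τ w) ≤ ENNReal.ofReal (192000 * δ * θ) :=
  (volume_sector_le δ _ hδ hδ1 (by positivity) _ _ _ _ (direction_unit he τ) hw.1 hw.2).trans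
    (ENNReal.ofReal_le_ofReal (by linarith))

lemma arcSector_of_frame {δ θ : ℝ} {e : ℝ × ℝ} {τ : ℝ} {w : PlaneCircle}
    {y : EuclideanSpace ℝ (Fin 2)} (he : e.1 ^ 2 + e.2 ^ 2 = 1)
    (hy : y ∈ annulus (10 * δ) w.1 w.2)
    (h : ((e.1 * y 0 + e.2 * y 1 - along e w) - w.2 * ((1 - τ ^ 2) / (1 + τ ^ 2))) ^ 2 +
      ((-e.2 * y 0 + e.1 * y 1 - across e w) - w.2 * (2 * τ / (1 + τ ^ 2))) ^ 2 ≤ (20 * θ) ^ 2) :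
    y ∈ arcSector δ θ e τ w := by
  refine ⟨hy, le_trans (le_of_eq ?_) h⟩
  rw [← frame_sq he]
  unfold along across
  congr 2
  · linear_combination (-w.2 * ((1 - τ ^ 2) / (1 + τ ^ 2))) * he
  · linear_combination (-w.2 * (2 * τ / (1 + τ ^ 2))) * he

namespace TangentPair

variable {δ t θ : ℝ} {e : ℝ × ℝ} {a c : PlaneCircle}

lemma t_pos (h : TangentPair δ t θ e a c) : 0 < t := by
  linarith [h.pair.D_pos, h.dist_le]

lemma mem_arcSector (h : TangentPair δ t θ e a c) (he : e.1 ^ 2 + e.2 ^ 2 = 1) (hθ : 0 < θ)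
    (hθ2 : θ ≤ 2) {τ : ℝ} (hτ : |tanParam e a c - τ| ≤ θ) (ha : 1 ≤ a.2 ∧ a.2 ≤ 2)
    (hc : 1 ≤ c.2 ∧ c.2 ≤ 2) {y : EuclideanSpace ℝ (Fin 2)} (hya : y ∈ annulus (10 * δ) a.1 a.2)
    (hyc : y ∈ annulus (10 * δ) c.1 c.2) :
    y ∈ arcSector δ θ e τ a ∧ y ∈ arcSector δ θ e τ c := by
  have := h.pair.near_tangency (z₀ := e.1 * y 0 + e.2 * y 1 - along e a)
    (z₁ := -e.2 * y 0 + e.1 * y 1 - across e a) (ρ := dist y a.1) (σ := dist y c.1)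
    (r := a.2) (s := c.2) h.dist_le_half h.t_pos h.le_dist hθ hθ2 h.defect_le
    (by linarith [h.delta_le, h.pair.hδ]) hτ ha.1 ha.2 hc.1 hc.2 rfl dist_nonneg dist_nonneg
    (by rw [dist_sq_eq, ← frame_sq he]; unfold along across; congr 2 <;> ring)
    (by rw [dist_sq_eq, ← frame_sq he]; unfold along across; congr 2 <;> ring) hya hyc
  refine ⟨arcSector_of_frame he hya this.1, arcSector_of_frame he hyc ?_⟩
  convert this.2 using 3 <;> ring

lemma volume_inter_le (h : TangentPair δ t θ e a c) (he : e.1 ^ 2 + e.2 ^ 2 = 1) (hδ1 : δ < 1)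
    (hθ : 0 < θ) (hθ2 : θ ≤ 2) (ha : 1 ≤ a.2 ∧ a.2 ≤ 2) (hc : 1 ≤ c.2 ∧ c.2 ≤ 2) :
    volume (annulus (10 * δ) a.1 a.2 ∩ annulus (10 * δ) c.1 c.2) ≤
      ENNReal.ofReal (192000 * 8000 * δ ^ 2 / (t * θ)) := by
  have ht := h.t_pos
  have hδ := h.pair.hδ
  rcases le_or_gt (t * θ ^ 2) (8000 * δ) with h1 | h1
  · refine (measure_mono fun y hy => (h.mem_arcSector he hθ hθ2 (τ := tanParam e a c)
      (by rw [sub_self, abs_zero]; exact hθ.le) ha hc hy.1 hy.2).1).trans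
      ((volume_arcSector_le δ θ e _ a hδ hδ1 hθ he ha).trans (ENNReal.ofReal_le_ofReal ?_))
    rw [le_div_iff₀ (by positivity)]
    calc 192000 * δ * θ * (t * θ) = 192000 * δ * (t * θ ^ 2) := by ring
      _ ≤ 192000 * δ * (8000 * δ) := by gcongr
      _ = _ := by ring
  · have h2 : t * θ ^ 2 / 4 ≤ |defect e a c| := h.le_defect.resolve_right (not_le.2 h1)
    have h3 : defect e a c < 0 := by
      by_contra h4
      rw [abs_of_nonneg (not_lt.1 h4)] at h2
      linarith [h.pair.eta_le]
    have h5 := h.pair.eta_mul_lam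
    have hD := h.pair.D_pos
    have hl := h.pair.lam_ge
    have hR0 := h.pair.hR0
    have htD := h.dist_le
    have ht2 := h.le_dist
    have hDhalf := h.dist_le_half
    have hD1000 := h.pair.hD
    rw [abs_of_neg h3] at h2
    generalize defect e a c = η at *
    generalize curv e a c = lam at *
    generalize hDD : dist c.1 a.1 = D at *
    have hθ0 : 0 < θ ^ 2 := by positivity
    have htDθ : D * θ ^ 2 ≤ 2 * t * θ ^ 2 := mul_le_mul_of_nonneg_right htD hθ0.le
    refine (volume_lens_le δ (θ / 4) a.1 c.1 a.2 c.2 ha.1 ha.2 hc.1 hc.2 hδ (by rw [hDD]; linarith)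
      (by rw [hDD]; exact hDhalf) (by positivity) ?_ ?_).trans (ENNReal.ofReal_le_ofReal ?_)
    · rw [hDD]
      have : t * θ ^ 2 ≤ D * θ ^ 2 := mul_le_mul_of_nonneg_right ht2 hθ0.le
      linarith
    · rw [hDD]
      have h6 : D * θ ^ 2 / 8 ≤ -η := by linarith
      have h7 : D * θ ^ 2 / 8 * (0.7 * D) ≤ -η * lam :=
        mul_le_mul h6 (by linarith) (by positivity) (by linarith)
      have h8 : 0 < D * θ ^ 2 * D := by positivity
      linarith
    · rw [hDD, div_le_div_iff₀ (by positivity) (by positivity)]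
      have h8 : δ ^ 2 * θ * t ≤ δ ^ 2 * θ * D := mul_le_mul_of_nonneg_left ht2 (by positivity)
      have h9 : 0 < δ ^ 2 * θ * D := by positivity
      linarith

end TangentPair

/-- The four coordinate directions. -/
noncomputable def coordDirections : Finset (ℝ × ℝ) := {(1, 0), (-1, 0), (0, 1), (0, -1)}

lemma card_coordDirections_le : coordDirections.card ≤ 4 := Finset.card_le_four

lemma coordDirections_unit {e : ℝ × ℝ} (he : e ∈ coordDirections) : e.1 ^ 2 + e.2 ^ 2 = 1 := by
  simp only [coordDirections, Finset.mem_insert, Finset.mem_singleton] at he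
  rcases he with rfl | rfl | rfl | rfl <;> norm_num

lemma exists_coordDirection (a c : PlaneCircle) : ∃ e ∈ coordDirections,
    along e c - along e a ≤ 0 ∧
      (across e c - across e a) ^ 2 ≤ (along e c - along e a) ^ 2 := by
  simp only [coordDirections, Finset.mem_insert, Finset.mem_singleton, exists_eq_or_imp,
    exists_eq_left, along, across]
  rcases le_total ((c.1 1 - a.1 1) ^ 2) ((c.1 0 - a.1 0) ^ 2) with h | h
  · rcases le_total (c.1 0) (a.1 0) with h1 | h1
    · left; constructor <;> linarith
    · right; left; constructor <;> linarith
  · rcases le_total (c.1 1) (a.1 1) with h1 | h1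
    · right; right; left; constructor <;> linarith
    · right; right; right; constructor <;> linarith

lemma exists_dyadic_scale {D δ : ℝ} {N : ℕ} (hδ : 0 < δ) (hN : 1 / δ ≤ 2 ^ N) (hD : 4000 * δ < D)
    (hD1 : D ≤ 1) : ∃ i ∈ Finset.range N, (1 / 2 : ℝ) ^ i ≤ D ∧ D ≤ 2 * (1 / 2 : ℝ) ^ i := by
  obtain ⟨n, h1, h2⟩ := exists_nat_pow_near_of_lt_one (show 0 < D by linarith) hD1
    (show (0 : ℝ) < 1 / 2 by norm_num) (by norm_num)
  refine ⟨n + 1, ?_, h1.le, by rw [pow_succ]; linarith⟩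
  rw [Finset.mem_range]
  refine (pow_lt_pow_iff_right₀ (show (1 : ℝ) < 2 by norm_num)).1 (lt_of_lt_of_le ?_ hN)
  rw [lt_div_iff₀ hδ, pow_succ]
  have h3 : (1 / 2 : ℝ) ^ n * 2 ^ n = 1 := by rw [← mul_pow]; norm_num
  have h4 : (0 : ℝ) < 2 ^ n := by positivity
  have h5 : D * 2 ^ n ≤ (1 / 2 : ℝ) ^ n * 2 ^ n := by gcongr
  have h6 : 4000 * δ * 2 ^ n < D * 2 ^ n := by gcongr
  nlinarith

lemma exists_tangency_scale {δ t b : ℝ} {N : ℕ} (hδ : 0 < δ) (hN : 1 / δ ≤ 2 ^ N) (ht : 0 < t)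
    (ht1 : t ≤ 1) (hb : b ≤ 4 * t) (hδt : 2000 * δ ≤ 4 * t) : ∃ j ∈ Finset.range N,
    b ≤ t * (2 * (1 / 2 : ℝ) ^ j) ^ 2 ∧ 2000 * δ ≤ t * (2 * (1 / 2 : ℝ) ^ j) ^ 2 ∧
      (t * (2 * (1 / 2 : ℝ) ^ j) ^ 2 / 4 ≤ b ∨ t * (2 * (1 / 2 : ℝ) ^ j) ^ 2 ≤ 8000 * δ) := by
  have hlt : ∀ j : ℕ, 2000 * δ ≤ t * (2 * (1 / 2 : ℝ) ^ j) ^ 2 → j < N := by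
    intro j hj
    refine (pow_lt_pow_iff_right₀ (show (1 : ℝ) < 2 by norm_num)).1 (lt_of_lt_of_le ?_ hN)
    rw [lt_div_iff₀ hδ]
    have h3 : (1 / 2 : ℝ) ^ j * 2 ^ j = 1 := by rw [← mul_pow]; norm_num
    have h4 : (1 : ℝ) ≤ 2 ^ j := one_le_pow₀ (by norm_num)
    have h5 : (0 : ℝ) < (1 / 2) ^ j := by positivity
    have h6 : (1 / 2 : ℝ) ^ j ≤ 1 := pow_le_one₀ (by norm_num) (by norm_num)
    have h7 : t * (2 * (1 / 2 : ℝ) ^ j) ^ 2 ≤ 4 * (1 / 2) ^ j := by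
      calc t * (2 * (1 / 2 : ℝ) ^ j) ^ 2 ≤ 1 * (2 * (1 / 2 : ℝ) ^ j) ^ 2 := by gcongr
        _ = 4 * ((1 / 2) ^ j * (1 / 2) ^ j) := by ring
        _ ≤ 4 * ((1 / 2) ^ j * 1) := by gcongr
        _ = _ := by ring
    have h8 : 2000 * δ * 2 ^ j ≤ 4 * (1 / 2) ^ j * 2 ^ j :=
      mul_le_mul_of_nonneg_right (hj.trans h7) (by positivity)
    nlinarith
  let P : ℕ → Prop := fun j =>
    b ≤ t * (2 * (1 / 2 : ℝ) ^ j) ^ 2 ∧ 2000 * δ ≤ t * (2 * (1 / 2 : ℝ) ^ j) ^ 2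
  have h0 : P 0 := by constructor <;> · norm_num; linarith
  have hN' : ¬P N := fun h => lt_irrefl _ (hlt N h.2)
  obtain ⟨j, hj, hj1⟩ : ∃ j, P j ∧ ¬P (j + 1) := by
    by_contra hcon
    push Not at hcon
    exact hN' (Nat.rec h0 (fun j hj => hcon j hj) N)
  refine ⟨j, Finset.mem_range.2 (hlt j hj.2), hj.1, hj.2, ?_⟩
  have e1 : t * (2 * (1 / 2 : ℝ) ^ (j + 1)) ^ 2 = t * (2 * (1 / 2 : ℝ) ^ j) ^ 2 / 4 := by
    rw [pow_succ]; ring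
  simp only [P, e1, not_and_or, not_le] at hj1
  rcases hj1 with h | h
  · exact Or.inl h.le
  · right; linarith

/-- Two circles with intersecting annuli are close or form a tangent pair. -/
lemma exists_tangentPair {δ : ℝ} {N : ℕ} (hδ : 0 < δ) (hN : 1 / δ ≤ 2 ^ N) {a c : PlaneCircle}
    (ha : a.1 ∈ closedBall (0 : EuclideanSpace ℝ (Fin 2)) (1 / 4))
    (hc : c.1 ∈ closedBall (0 : EuclideanSpace ℝ (Fin 2)) (1 / 4))
    (hac : a.2 ≤ c.2) (hD : 4000 * δ < dist c.1 a.1) {y : EuclideanSpace ℝ (Fin 2)}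
    (hya : y ∈ annulus (10 * δ) a.1 a.2) (hyc : y ∈ annulus (10 * δ) c.1 c.2) :
    ∃ e ∈ coordDirections, ∃ i ∈ Finset.range N, ∃ j ∈ Finset.range N,
      TangentPair δ ((1 / 2) ^ i) (2 * (1 / 2) ^ j) e a c := by
  have hhalf : dist c.1 a.1 ≤ 1 / 2 := by
    have := dist_triangle_right c.1 a.1 0
    rw [mem_closedBall] at ha hc
    linarith
  obtain ⟨e, he, hξ, hζ⟩ := exists_coordDirection a c
  have hfr : (dist c.1 a.1) ^ 2 = (along e c - along e a) ^ 2 + (across e c - across e a) ^ 2 := by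
    rw [dist_sq_eq, ← frame_sq (coordDirections_unit he)]
    unfold along across
    congr 2 <;> ring
  have hya' : |dist y a.1 - a.2| ≤ 10 * δ := hya
  have hyc' : |dist y c.1 - c.2| ≤ 10 * δ := hyc
  have hξ0 : along e c - along e a < 0 := by
    refine lt_of_le_of_ne hξ fun h => ?_
    rw [h] at hζ hfr
    have : 0 < dist c.1 a.1 ^ 2 := pow_pos (by linarith) 2
    linarith
  have hlam : curv e a c ≠ 0 := by unfold curv; intro h; linarith
  have hp : CirclePair δ (along e c - along e a) (across e c - across e a) (c.2 - a.2)
    (dist c.1 a.1) (curv e a c) (tanParam e a c) (defect e a c) :=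
    { hδ := hδ, hD := by linarith, hsq := hfr, hξ := hξ, hζ := hζ, hR0 := by linarith
      hR := by
        have := dist_triangle_right y c.1 a.1
        have := (abs_le.1 hya').2
        have := (abs_le.1 hyc').1
        linarith
      hlam := rfl
      hT := by unfold tanParam; field_simp
      hη := rfl }
  obtain ⟨i, hi, hi1, hi2⟩ := exists_dyadic_scale hδ hN hD (by linarith)
  have hη := hp.abs_eta_le
  obtain ⟨j, hj, hj1, hj2, hj3⟩ := exists_tangency_scale (b := |defect e a c|) hδ hN
    (show (0 : ℝ) < (1 / 2) ^ i by positivity) (pow_le_one₀ (by norm_num) (by norm_num))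
    (by linarith) (by linarith)
  exact ⟨e, he, i, hi, j, hj, hp, hhalf, hi1, hi2, hj1, hj2, hj3⟩

/-- The cube of side `t / 32` in the space of circles containing `w`. -/
noncomputable def cubeKey (t : ℝ) (e : ℝ × ℝ) (w : PlaneCircle) : ℤ × ℤ × ℤ :=
  (⌊along e w / (t / 32)⌋, ⌊across e w / (t / 32)⌋, ⌊w.2 / (t / 32)⌋)

/-- The quadratic attached to the circle `w`. -/
def quadValue (e : ℝ × ℝ) (w : PlaneCircle) (τ : ℝ) : ℝ :=
  (w.2 + along e w) + 2 * across e w * τ + (w.2 - along e w) * τ ^ 2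

/-- The derivative of the quadratic attached to the circle `w`. -/
def quadSlope (e : ℝ × ℝ) (w : PlaneCircle) (τ : ℝ) : ℝ :=
  2 * across e w + 2 * (w.2 - along e w) * τ

/-- The position of the quadratic of `w` near `τ` in the tangency rectangle grid. -/
noncomputable def jetKey (t θ : ℝ) (e : ℝ × ℝ) (τ : ℝ) (w : PlaneCircle) : ℤ × ℤ :=
  (⌊quadValue e w τ / (t * θ ^ 2)⌋, ⌊quadSlope e w τ / (t * θ)⌋)

/-- The cube and the jet of `w`. -/
noncomputable def circleKey (t θ : ℝ) (e : ℝ × ℝ) (k : ℤ) (w : PlaneCircle) :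
    (ℤ × ℤ × ℤ) × (ℤ × ℤ) :=
  (cubeKey t e w, jetKey t θ e (k * θ) w)

/-- The index of the parameter of tangency in the grid of mesh `θ`. -/
noncomputable def tanIndex (θ : ℝ) (e : ℝ × ℝ) (a c : PlaneCircle) : ℤ := ⌊tanParam e a c / θ⌋

/-- A box containing the differences of keys of tangent pairs. -/
noncomputable def keyBox : Finset ((ℤ × ℤ × ℤ) × (ℤ × ℤ)) :=
  (Finset.Icc (-80) 80 ×ˢ Finset.Icc (-80) 80 ×ˢ Finset.Icc (-80) 80) ×ˢ
    (Finset.Icc (-80) 80 ×ˢ Finset.Icc (-80) 80)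

lemma card_keyBox : keyBox.card = 161 ^ 5 := by
  simp [keyBox, Finset.card_product]

lemma abs_tanParam_sub_le {θ : ℝ} (hθ : 0 < θ) (e : ℝ × ℝ) (a c : PlaneCircle) :
    |tanParam e a c - tanIndex θ e a c * θ| ≤ θ := by
  unfold tanIndex
  have h1 := Int.floor_le (tanParam e a c / θ)
  have h2 := Int.lt_floor_add_one (tanParam e a c / θ)
  rw [le_div_iff₀ hθ] at h1
  rw [div_lt_iff₀ hθ] at h2
  rw [abs_le]
  constructor <;> nlinarith

lemma floor_div_sub_mem {x y s b : ℝ} (hs : 0 < s) (h : |x - y| ≤ b * s) (hb : b ≤ 79) :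
    ⌊x / s⌋ - ⌊y / s⌋ ∈ Finset.Icc (-80 : ℤ) 80 := by
  have h1 : |x / s - y / s| ≤ 79 := by
    rw [← sub_div, abs_div, abs_of_pos hs, div_le_iff₀ hs]
    nlinarith
  rw [abs_le] at h1
  have := Int.floor_le (x / s)
  have := Int.lt_floor_add_one (x / s)
  have := Int.floor_le (y / s)
  have := Int.lt_floor_add_one (y / s)
  rw [Finset.mem_Icc]
  constructor
  · have : (-81 : ℝ) < ((⌊x / s⌋ - ⌊y / s⌋ : ℤ) : ℝ) := by push_cast; linarith
    have h3 : (-81 : ℤ) < ⌊x / s⌋ - ⌊y / s⌋ := by exact_mod_cast this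
    omega
  · have : ((⌊x / s⌋ - ⌊y / s⌋ : ℤ) : ℝ) < 81 := by push_cast; linarith
    have h3 : ⌊x / s⌋ - ⌊y / s⌋ < (81 : ℤ) := by exact_mod_cast this
    omega

lemma abs_sub_le_of_floor_div_eq {x y s : ℝ} (hs : 0 < s) (h : ⌊x / s⌋ = ⌊y / s⌋) :
    |x - y| ≤ s := by
  have := Int.abs_sub_lt_one_of_floor_eq_floor h
  rw [← sub_div, abs_div, abs_of_pos hs, div_lt_one hs] at this
  exact this.le

lemma quadValue_sub (e : ℝ × ℝ) (a c : PlaneCircle) (τ : ℝ) :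
    quadValue e c τ - quadValue e a τ = (c.2 - a.2) + (along e c - along e a) +
      2 * (across e c - across e a) * τ + curv e a c * τ ^ 2 := by
  unfold quadValue curv; ring

lemma quadSlope_sub (e : ℝ × ℝ) (a c : PlaneCircle) (τ : ℝ) :
    quadSlope e c τ - quadSlope e a τ =
      2 * (across e c - across e a) + 2 * curv e a c * τ := by
  unfold quadSlope curv; ring

lemma quadValue_sub_eq {e : ℝ × ℝ} {a c : PlaneCircle} (h : 0 < curv e a c) (τ : ℝ) :
    quadValue e c τ - quadValue e a τ =
      curv e a c * (τ - tanParam e a c) ^ 2 + defect e a c := by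
  have h1 : curv e a c * tanParam e a c = -(across e c - across e a) := by
    unfold tanParam; field_simp
  rw [quadValue_sub]
  unfold defect
  linear_combination (2 * τ - tanParam e a c) * h1

lemma TangentPair.exists_mem_keyBox {δ t θ : ℝ} {e : ℝ × ℝ} {a c : PlaneCircle}
    (h : TangentPair δ t θ e a c) (hθ : 0 < θ) :
    ∃ o ∈ keyBox,
      circleKey t θ e (tanIndex θ e a c) c - circleKey t θ e (tanIndex θ e a c) a = o := by
  refine exists_eq_right'.2 ?_
  have ht := h.t_pos
  have hv := h.pair.value_le ht h.dist_le hθ h.defect_le (abs_tanParam_sub_le hθ e a c)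
  have h1 := hv.1
  have h2 := hv.2
  have hξ := h.pair.abs_xi_le
  have hξ0 := h.pair.hξ
  have hζ := h.pair.abs_zeta_le
  have hR := h.pair.R_le
  have hR0 := h.pair.hR0
  have hD := h.dist_le
  simp only [keyBox, Finset.mem_product, circleKey, cubeKey, jetKey, Prod.fst_sub, Prod.snd_sub]
  refine ⟨⟨?_, ?_, ?_⟩, ?_, ?_⟩
  · exact floor_div_sub_mem (b := 79) (by positivity) (by rw [abs_of_nonpos hξ0]; linarith) le_rfl
  · exact floor_div_sub_mem (b := 79) (by positivity) (by linarith) le_rfl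
  · exact floor_div_sub_mem (b := 79) (by positivity) (by rw [abs_of_nonneg hR0]; linarith) le_rfl
  · refine floor_div_sub_mem (b := 5.2) (by positivity) ?_ (by norm_num)
    rw [quadValue_sub]; exact h1
  · refine floor_div_sub_mem (b := 8.4) (by positivity) ?_ (by norm_num)
    rw [quadSlope_sub]; exact h2

lemma exists_keyOffsets : ∃ O : Finset ((ℤ × ℤ × ℤ) × (ℤ × ℤ)), O.card = 161 ^ 5 ∧
    ∀ {δ t θ : ℝ} {e : ℝ × ℝ} {a c : PlaneCircle}, TangentPair δ t θ e a c → 0 < θ → ∃ o ∈ O,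
      circleKey t θ e (tanIndex θ e a c) c - circleKey t θ e (tanIndex θ e a c) a = o :=
  Exists.intro keyBox (And.intro card_keyBox fun h hθ => h.exists_mem_keyBox hθ)

/-- A finite set containing the differences of keys of tangent pairs. -/
noncomputable def keyOffsets : Finset ((ℤ × ℤ × ℤ) × (ℤ × ℤ)) := exists_keyOffsets.choose

lemma card_keyOffsets : keyOffsets.card = 161 ^ 5 := exists_keyOffsets.choose_spec.1

lemma TangentPair.exists_keyOffset {δ t θ : ℝ} {e : ℝ × ℝ} {a c : PlaneCircle}
    (h : TangentPair δ t θ e a c) (hθ : 0 < θ) : ∃ o ∈ keyOffsets,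
      circleKey t θ e (tanIndex θ e a c) c - circleKey t θ e (tanIndex θ e a c) a = o :=
  exists_keyOffsets.choose_spec.2 h hθ

/-- Pairs of circles with the same keys as a tangent pair are almost tangent. -/
lemma TangentPair.stable {δ t θ : ℝ} {e : ℝ × ℝ} {a c a' c' : PlaneCircle}
    (h : TangentPair δ t θ e a c) (hθ : 0 < θ) (hθ2 : θ ≤ 2)
    (ha : circleKey t θ e (tanIndex θ e a c) a' = circleKey t θ e (tanIndex θ e a c) a)
    (hc : circleKey t θ e (tanIndex θ e a c) c' = circleKey t θ e (tanIndex θ e a c) c) :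
    |tanParam e a' c' - tanIndex θ e a c * θ| ≤ 11 * θ ∧ t / 2 ≤ curv e a' c' ∧
      |defect e a' c'| ≤ 62 * (t * θ ^ 2) ∧ |tanParam e a' c'| < 26 := by
  have ht := h.t_pos
  simp only [circleKey, cubeKey, jetKey, Prod.mk.injEq] at ha hc
  obtain ⟨⟨ha1, -, ha3⟩, ha4, ha5⟩ := ha
  obtain ⟨⟨hc1, -, hc3⟩, hc4, hc5⟩ := hc
  replace ha1 := abs_le.1 (abs_sub_le_of_floor_div_eq (by positivity) ha1)
  replace ha3 := abs_le.1 (abs_sub_le_of_floor_div_eq (by positivity) ha3)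
  replace ha4 := abs_le.1 (abs_sub_le_of_floor_div_eq (by positivity) ha4)
  replace ha5 := abs_le.1 (abs_sub_le_of_floor_div_eq (by positivity) ha5)
  replace hc1 := abs_le.1 (abs_sub_le_of_floor_div_eq (by positivity) hc1)
  replace hc3 := abs_le.1 (abs_sub_le_of_floor_div_eq (by positivity) hc3)
  replace hc4 := abs_le.1 (abs_sub_le_of_floor_div_eq (by positivity) hc4)
  replace hc5 := abs_le.1 (abs_sub_le_of_floor_div_eq (by positivity) hc5)
  refine h.pair.stable (ξ' := along e c' - along e a') (ζ' := across e c' - across e a')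
    (R' := c'.2 - a'.2) (lam' := curv e a' c') ht h.le_dist h.dist_le hθ hθ2 h.defect_le
    (abs_tanParam_sub_le hθ e a c) ?_ ?_ ?_
  · rw [← quadValue_sub, ← quadValue_sub, abs_le]
    constructor <;> linarith
  · rw [← quadSlope_sub, ← quadSlope_sub, abs_le]
    constructor <;> linarith
  · unfold curv
    rw [abs_le]
    constructor <;> linarith

open Classical in
/-- The tangent pairs in `W` whose keys differ by `o`. -/
noncomputable def tangentPairs (δ t θ : ℝ) (e : ℝ × ℝ) (W : Finset PlaneCircle)
    (o : (ℤ × ℤ × ℤ) × (ℤ × ℤ)) : Finset (PlaneCircle × PlaneCircle) :=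
  {p ∈ W ×ˢ W | TangentPair δ t θ e p.1 p.2 ∧
    circleKey t θ e (tanIndex θ e p.1 p.2) p.2 - circleKey t θ e (tanIndex θ e p.1 p.2) p.1 = o}

/-- The tangency rectangle of a pair of circles. -/
noncomputable def pairKey (t θ : ℝ) (e : ℝ × ℝ) (p : PlaneCircle × PlaneCircle) :
    ℤ × (ℤ × ℤ × ℤ) × (ℤ × ℤ) :=
  (tanIndex θ e p.1 p.2, circleKey t θ e (tanIndex θ e p.1 p.2) p.1)

/-- The circles of `W` with a given key. -/
noncomputable def keyClass (t θ : ℝ) (e : ℝ × ℝ) (W : Finset PlaneCircle) (k : ℤ)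
    (K : (ℤ × ℤ × ℤ) × (ℤ × ℤ)) : Finset PlaneCircle :=
  {w ∈ W | circleKey t θ e k w = K}

/-- The circles of `W` in a given cube. -/
noncomputable def cubeClass (t : ℝ) (e : ℝ × ℝ) (W : Finset PlaneCircle) (Q : ℤ × ℤ × ℤ) :
    Finset PlaneCircle :=
  {w ∈ W | cubeKey t e w = Q}

lemma card_filter_abs_sub_le {κ : Type*} (I : Finset κ) (k : κ → ℤ) {P : κ → Prop}
    {_ : DecidablePred P} (hinj : ∀ x ∈ I, ∀ y ∈ I, P x → P y → k x = k y → x = y) {θ : ℝ}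
    (hθ : 0 < θ) (t : ℝ) (hP : ∀ x, P x → |k x * θ - t| ≤ 27 * θ) :
    ((I.filter P).card : ℝ) ≤ 55 := by
  have h1 : (I.filter P).card ≤ (Finset.Icc ⌈t / θ - 27⌉ ⌊t / θ + 27⌋).card := by
    refine Finset.card_le_card_of_injOn k ?_ ?_
    · intro x hx
      have hx' := (Finset.mem_filter.1 (Finset.mem_coe.1 hx)).2
      have h := abs_le.1 (hP x hx')
      rw [Finset.mem_coe, Finset.mem_Icc, Int.ceil_le, Int.le_floor]
      constructor
      · rw [sub_le_iff_le_add, div_le_iff₀ hθ]; linarith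
      · rw [← sub_le_iff_le_add, le_div_iff₀ hθ]; linarith
    · intro x hx y hy hxy
      rw [Finset.mem_coe, Finset.mem_filter] at hx hy
      exact hinj x hx.1 y hy.1 hx.2 hy.2 hxy
  rw [Int.card_Icc] at h1
  have h2 := Int.floor_le (t / θ + 27)
  have h3 := Int.le_ceil (t / θ - 27)
  have h4 : ⌊t / θ + 27⌋ + 1 - ⌈t / θ - 27⌉ ≤ 55 := by
    have : ((⌊t / θ + 27⌋ + 1 - ⌈t / θ - 27⌉ : ℤ) : ℝ) ≤ (55 : ℤ) := by push_cast; linarith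
    exact_mod_cast this
  have : (I.filter P).card ≤ 55 := h1.trans (by omega)
  exact_mod_cast this

lemma sum_pairKey_cube_le {δ t θ : ℝ} {e : ℝ × ℝ} (W : Finset PlaneCircle)
    (o : (ℤ × ℤ × ℤ) × (ℤ × ℤ)) (hθ : 0 < θ) (hθ2 : θ ≤ 2) (ht : 0 < t) {J U : ℕ} (hJ1 : 1 ≤ J)
    (hJ : 4 ≤ 2 ^ J * θ) (Q : ℤ × ℤ × ℤ) {n : ℝ} (hnA : ((cubeClass t e W Q).card : ℝ) ≤ n)
    (hnB : ((cubeClass t e W (Q + o.1)).card : ℝ) ≤ n) (hnU : n < 2 ^ U)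
    (I : Finset (ℤ × (ℤ × ℤ × ℤ) × (ℤ × ℤ)))
    (hI : ∀ κ ∈ I, κ.2.1 = Q ∧ ∃ p ∈ tangentPairs δ t θ e W o, pairKey t θ e p = κ) :
    ∑ κ ∈ I,
      ((keyClass t θ e W κ.1 κ.2).card * (keyClass t θ e W κ.1 (κ.2 + o)).card : ℝ) /
        √(max (keyClass t θ e W κ.1 κ.2).card (keyClass t θ e W κ.1 (κ.2 + o)).card : ℕ) ≤
      20 * 55 ^ 3 * J * U * (n * √n) := by
  refine sum_rich_le (p₀ := fun w => w.2 + along e w) (p₁ := fun w => 2 * across e w)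
    (p₂ := fun w => w.2 - along e w) (cubeClass t e W Q) (cubeClass t e W (Q + o.1)) I
    (fun κ => keyClass t θ e W κ.1 κ.2) (fun κ => keyClass t θ e W κ.1 (κ.2 + o))
    (fun κ => κ.1 * θ) (tanParam e) (curv e) (defect e) (16 * θ) (11 * θ) n 26
    (62 * (t * θ ^ 2)) (t / 2) 55 J U (by norm_num) (by norm_num) (by linarith) hJ1 (by positivity)
    ?_ (by positivity) ?_ ?_ ?_ ?_ ?_ hnA hnB hnU
  · have : 0 < t * θ ^ 2 := by positivity
    linarith
  · intro κ hκ w hw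
    simp only [keyClass, cubeClass, Finset.mem_filter] at hw ⊢
    refine ⟨hw.1, ?_⟩
    rw [← (hI κ hκ).1, ← hw.2]; rfl
  · intro κ hκ w hw
    simp only [keyClass, cubeClass, Finset.mem_filter] at hw ⊢
    refine ⟨hw.1, ?_⟩
    rw [← (hI κ hκ).1, ← Prod.fst_add, ← hw.2]; rfl
  · intro κ hκ a ha c hc
    obtain ⟨-, p, hp, rfl⟩ := hI κ hκ
    simp only [tangentPairs, Finset.mem_filter] at hp
    have ha2 := (Finset.mem_filter.1 ha).2
    have hc2 := (Finset.mem_filter.1 hc).2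
    simp only [pairKey] at ha2 hc2
    rw [← hp.2.2, add_sub_cancel] at hc2
    obtain ⟨h1, h2, h3, h4⟩ := hp.2.1.stable hθ hθ2 ha2 hc2
    exact ⟨h1, h2, h3, h4, fun s => quadValue_sub_eq (by linarith) s⟩
  · intro a s
    refine card_filter_abs_sub_le _ (fun κ => κ.1) ?_ hθ s (fun κ hκ => by linarith [hκ.2])
    rintro x - y - hx hy hxy
    simp only [keyClass, Finset.mem_filter] at hx hy hxy
    refine Prod.ext hxy ?_
    rw [← hx.1.2, ← hy.1.2, hxy]
  · intro c s
    refine card_filter_abs_sub_le _ (fun κ => κ.1) ?_ hθ s (fun κ hκ => by linarith [hκ.2])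
    rintro x - y - hx hy hxy
    simp only [keyClass, Finset.mem_filter] at hx hy hxy
    refine Prod.ext hxy ?_
    rw [← add_left_inj o, ← hx.1.2, ← hy.1.2, hxy]

lemma sum_card_fiber_le {ι κ : Type*} [DecidableEq κ] (s : Finset ι) (t : Finset κ) (g : ι → κ) :
    ∑ b ∈ t, (({a ∈ s | g a = b}).card : ℝ) ≤ s.card := by
  have h : ({a ∈ s | g a ∈ t}).card = ∑ b ∈ t, ({a ∈ {a ∈ s | g a ∈ t} | g a = b}).card :=
    Finset.card_eq_sum_card_fiberwise fun a ha => (Finset.mem_filter.1 (Finset.mem_coe.1 ha)).2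
  have h1 : ∑ b ∈ t, ({a ∈ s | g a = b}).card ≤ s.card := by
    refine le_trans (le_of_eq ?_) (Finset.card_filter_le s (fun a => g a ∈ t))
    rw [h]
    refine Finset.sum_congr rfl fun b hb => ?_
    congr 1
    ext a
    simp only [Finset.mem_filter]
    constructor
    · rintro ⟨h1, rfl⟩; exact ⟨⟨h1, hb⟩, rfl⟩
    · rintro ⟨⟨h1, -⟩, h2⟩; exact ⟨h1, h2⟩
  exact_mod_cast h1

open Classical in
/-- The sum over all tangency rectangles. -/
theorem sum_pairKey_le {δ t θ : ℝ} {e : ℝ × ℝ} (W : Finset PlaneCircle)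
    (o : (ℤ × ℤ × ℤ) × (ℤ × ℤ)) (hθ : 0 < θ) (hθ2 : θ ≤ 2) (ht : 0 < t) {J U : ℕ} (hJ1 : 1 ≤ J)
    (hJ : 4 ≤ 2 ^ J * θ) {n : ℝ} (hn : ∀ Q, ((cubeClass t e W Q).card : ℝ) ≤ n)
    (hnU : 2 * n < 2 ^ U) :
    ∑ κ ∈ (tangentPairs δ t θ e W o).image (pairKey t θ e),
      ((keyClass t θ e W κ.1 κ.2).card * (keyClass t θ e W κ.1 (κ.2 + o)).card : ℝ) /
        √(max (keyClass t θ e W κ.1 κ.2).card (keyClass t θ e W κ.1 (κ.2 + o)).card : ℕ) ≤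
      20 * 55 ^ 3 * J * U * (2 * W.card * √(2 * n)) := by
  set I := (tangentPairs δ t θ e W o).image (pairKey t θ e) with hI
  rw [← Finset.sum_fiberwise_of_maps_to (t := I.image fun κ => κ.2.1)
    (g := fun κ => κ.2.1) fun κ hκ => Finset.mem_image_of_mem _ hκ]
  have hcube : ∀ Q ∈ I.image fun κ => κ.2.1, ∑ κ ∈ I with κ.2.1 = Q,
      ((keyClass t θ e W κ.1 κ.2).card * (keyClass t θ e W κ.1 (κ.2 + o)).card : ℝ) /
        √(max (keyClass t θ e W κ.1 κ.2).card (keyClass t θ e W κ.1 (κ.2 + o)).card : ℕ) ≤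
      20 * 55 ^ 3 * J * U * (((cubeClass t e W Q).card + (cubeClass t e W (Q + o.1)).card) *
        √(2 * n)) := by
    intro Q _
    have h1 := hn Q
    have h2 := hn (Q + o.1)
    refine (sum_pairKey_cube_le W o hθ hθ2 ht hJ1 hJ Q
      (n := (cubeClass t e W Q).card + (cubeClass t e W (Q + o.1)).card)
      (le_add_of_nonneg_right (Nat.cast_nonneg _)) (le_add_of_nonneg_left (Nat.cast_nonneg _))
      (by linarith) _ fun κ hκ => ⟨(Finset.mem_filter.1 hκ).2,
        Finset.mem_image.1 (Finset.mem_filter.1 hκ).1⟩).trans ?_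
    gcongr
    linarith
  refine (Finset.sum_le_sum hcube).trans ?_
  rw [← Finset.mul_sum, ← Finset.sum_mul, Finset.sum_add_distrib]
  have h1 := sum_card_fiber_le W (I.image fun κ => κ.2.1) (cubeKey t e)
  have h2 := sum_card_fiber_le W (I.image fun κ => κ.2.1) (fun w => cubeKey t e w - o.1)
  simp only [sub_eq_iff_eq_add] at h2
  have h3 : ∑ Q ∈ I.image (fun κ => κ.2.1), ((cubeClass t e W Q).card : ℝ) +
      ∑ Q ∈ I.image (fun κ => κ.2.1), ((cubeClass t e W (Q + o.1)).card : ℝ) ≤ 2 * W.card := by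
    rw [two_mul]
    refine add_le_add (le_trans (le_of_eq ?_) h1) (le_trans (le_of_eq ?_) h2) <;>
    · unfold cubeClass; rfl
  gcongr

/-- A nonnegative measurable function with integral at most `b`. -/
structure IntegralLE (f : EuclideanSpace ℝ (Fin 2) → ℝ) (b : ℝ) : Prop where
  measurable : Measurable f
  nonneg : ∀ y, 0 ≤ f y
  bound_nonneg : 0 ≤ b
  lintegral_le : ∫⁻ y, ENNReal.ofReal (f y) ≤ ENNReal.ofReal b

namespace IntegralLE

variable {f g : EuclideanSpace ℝ (Fin 2) → ℝ} {b c : ℝ}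

lemma mono (h : IntegralLE f b) (hbc : b ≤ c) : IntegralLE f c :=
  ⟨h.measurable, h.nonneg, h.bound_nonneg.trans hbc,
    h.lintegral_le.trans (ENNReal.ofReal_le_ofReal hbc)⟩

lemma const_mul (h : IntegralLE f b) (hc : 0 ≤ c) : IntegralLE (fun y => c * f y) (c * b) := by
  refine ⟨h.measurable.const_mul c, fun y => mul_nonneg hc (h.nonneg y),
    mul_nonneg hc h.bound_nonneg, ?_⟩
  simp only [ENNReal.ofReal_mul hc]
  rw [lintegral_const_mul _ h.measurable.ennreal_ofReal]
  gcongr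
  exact h.lintegral_le

lemma add (hf : IntegralLE f b) (hg : IntegralLE g c) :
    IntegralLE (fun y => f y + g y) (b + c) := by
  refine ⟨hf.measurable.add hg.measurable, fun y => add_nonneg (hf.nonneg y) (hg.nonneg y),
    add_nonneg hf.bound_nonneg hg.bound_nonneg, ?_⟩
  simp only [ENNReal.ofReal_add (hf.nonneg _) (hg.nonneg _)]
  rw [lintegral_add_left hf.measurable.ennreal_ofReal,
    ENNReal.ofReal_add hf.bound_nonneg hg.bound_nonneg]
  exact add_le_add hf.lintegral_le hg.lintegral_le

lemma sum {ι : Type*} (s : Finset ι) {f : ι → EuclideanSpace ℝ (Fin 2) → ℝ} {b : ι → ℝ}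
    (h : ∀ i ∈ s, IntegralLE (f i) (b i)) : IntegralLE (fun y => ∑ i ∈ s, f i y) (∑ i ∈ s, b i) := by
  classical
  induction s using Finset.induction_on with
  | empty => exact ⟨by simp, by simp, by simp, by simp⟩
  | insert i s hi ih =>
    simp only [Finset.sum_insert hi]
    exact (h i (Finset.mem_insert_self i s)).add
      (ih fun j hj => h j (Finset.mem_insert_of_mem hj))

lemma indicator {s : Set (EuclideanSpace ℝ (Fin 2))} (hs : IsClosed s) (hb : 0 ≤ b)
    (h : volume s ≤ ENNReal.ofReal b) : IntegralLE (s.indicator fun _ => (1 : ℝ)) b := by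
  refine ⟨measurable_const.indicator hs.measurableSet,
    fun y => indicator_nonneg (fun _ _ => zero_le_one) y, hb, ?_⟩
  have : ∀ y, ENNReal.ofReal (s.indicator (fun _ => (1 : ℝ)) y) = s.indicator (fun _ => 1) y := by
    intro y
    by_cases hy : y ∈ s <;> simp [hy]
  simp only [this]
  rw [lintegral_indicator_const hs.measurableSet, one_mul]
  exact h

end IntegralLE

/-- The indicator function of the annulus around a circle. -/
noncomputable def annInd (δ : ℝ) (w : PlaneCircle) : EuclideanSpace ℝ (Fin 2) → ℝ :=
  (annulus (10 * δ) w.1 w.2).indicator fun _ => 1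

/-- The indicator function of an arc of the annulus around a circle. -/
noncomputable def arcInd (δ θ : ℝ) (e : ℝ × ℝ) (τ : ℝ) (w : PlaneCircle) :
    EuclideanSpace ℝ (Fin 2) → ℝ :=
  (arcSector δ θ e τ w).indicator fun _ => 1

lemma annInd_nonneg (δ : ℝ) (w : PlaneCircle) (y) : 0 ≤ annInd δ w y :=
  indicator_nonneg (fun _ _ => zero_le_one) y

lemma arcInd_nonneg (δ θ : ℝ) (e : ℝ × ℝ) (τ : ℝ) (w : PlaneCircle) (y) :
    0 ≤ arcInd δ θ e τ w y :=
  indicator_nonneg (fun _ _ => zero_le_one) y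

lemma arcInd_le_annInd (δ θ : ℝ) (e : ℝ × ℝ) (τ : ℝ) (w : PlaneCircle) (y) :
    arcInd δ θ e τ w y ≤ annInd δ w y := by
  refine indicator_le_indicator_of_subset (fun z hz => hz.1) (fun _ => zero_le_one) y

lemma annInd_mul (δ : ℝ) (a c : PlaneCircle) (y) : annInd δ a y * annInd δ c y =
    (annulus (10 * δ) a.1 a.2 ∩ annulus (10 * δ) c.1 c.2).indicator (fun _ => (1 : ℝ)) y := by
  unfold annInd
  rw [← inter_indicator_mul, mul_one]

lemma TangentPair.annInd_mul_le {δ t θ : ℝ} {e : ℝ × ℝ} {a c : PlaneCircle}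
    (h : TangentPair δ t θ e a c) (he : e.1 ^ 2 + e.2 ^ 2 = 1) (hθ : 0 < θ) (hθ2 : θ ≤ 2) {τ : ℝ}
    (hτ : |tanParam e a c - τ| ≤ θ) (ha : 1 ≤ a.2 ∧ a.2 ≤ 2) (hc : 1 ≤ c.2 ∧ c.2 ≤ 2) (y) :
    annInd δ a y * annInd δ c y ≤ arcInd δ θ e τ a y * arcInd δ θ e τ c y := by
  rw [annInd_mul]
  by_cases hy : y ∈ annulus (10 * δ) a.1 a.2 ∩ annulus (10 * δ) c.1 c.2
  · obtain ⟨h1, h2⟩ := h.mem_arcSector he hθ hθ2 hτ ha hc hy.1 hy.2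
    unfold arcInd
    rw [indicator_of_mem hy, indicator_of_mem h1, indicator_of_mem h2, mul_one]
  · rw [indicator_of_notMem hy]
    exact mul_nonneg (arcInd_nonneg ..) (arcInd_nonneg ..)

lemma le_sqrt_mul_of_le_mul {N m F β : ℝ} (hN : 0 ≤ N) (hm : 0 ≤ m) (hF : 0 ≤ F) (hβ : 0 < β)
    (h : N ≤ m * F) : N ≤ √F * (β / 2 * N + β⁻¹ / 2 * m) := by
  have h1 : √(N * m) ≤ β / 2 * N + β⁻¹ / 2 * m := by
    refine Real.sqrt_le_iff.2 ⟨by positivity, ?_⟩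
    have e : (β / 2 * N + β⁻¹ / 2 * m) ^ 2 = N * m + (β / 2 * N - β⁻¹ / 2 * m) ^ 2 := by
      field_simp; ring
    rw [e]
    exact le_add_of_nonneg_right (sq_nonneg _)
  calc N = √(N * N) := (Real.sqrt_mul_self hN).symm
    _ ≤ √(N * (m * F)) := Real.sqrt_le_sqrt (mul_le_mul_of_nonneg_left h hN)
    _ = √F * √(N * m) := by rw [← Real.sqrt_mul hF]; congr 1; ring
    _ ≤ _ := mul_le_mul_of_nonneg_left h1 (Real.sqrt_nonneg _)

lemma area_weight_le {δ t θ P Q M m₀ : ℝ} (hδ : 0 < δ) (ht : 0 < t) (hθ : 0 < θ) (hM : 0 < M)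
    (hP : 0 ≤ P) (hQ : 0 ≤ Q) (hm : m₀ * M = P * Q) :
    (θ * √t / (√δ * √M)) / 2 * (P * Q * (192000 * 8000 * δ ^ 2 / (t * θ))) +
      (θ * √t / (√δ * √M))⁻¹ / 2 * (m₀ * (192000 * δ * θ)) ≤
    192000 * 8000 * (δ * √δ / √t) * (P * Q / √M) := by
  have hd : 0 < √δ := Real.sqrt_pos.2 hδ
  have hT : 0 < √t := Real.sqrt_pos.2 ht
  have hS : 0 < √M := Real.sqrt_pos.2 hM
  have ed : √δ ^ 2 = δ := Real.sq_sqrt hδ.le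
  have eT : √t ^ 2 = t := Real.sq_sqrt ht.le
  have eS : √M ^ 2 = M := Real.sq_sqrt hM.le
  generalize √δ = d at *
  generalize √t = T at *
  generalize √M = S at *
  subst ed eT eS
  have e1 : (θ * T / (d * S)) / 2 * (P * Q * (192000 * 8000 * (d ^ 2) ^ 2 / (T ^ 2 * θ))) =
      192000 * 8000 / 2 * (d ^ 2 * d / T) * (P * Q / S) := by field_simp
  have e2 : (θ * T / (d * S))⁻¹ / 2 * (m₀ * (192000 * d ^ 2 * θ)) =
      192000 / 2 * (d ^ 2 * d / T) * (P * Q / S) := by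
    rw [← hm]; field_simp
  rw [e1, e2]
  have : 0 ≤ (d ^ 2 * d / T) * (P * Q / S) := by positivity
  linarith

open Classical in
/-- The number of tangent pairs with key `κ` whose annuli contain `y`. -/
noncomputable def overlap (δ t θ : ℝ) (e : ℝ × ℝ) (W : Finset PlaneCircle)
    (o : (ℤ × ℤ × ℤ) × (ℤ × ℤ)) (κ : ℤ × (ℤ × ℤ × ℤ) × (ℤ × ℤ))
    (y : EuclideanSpace ℝ (Fin 2)) : ℝ :=
  ∑ p ∈ tangentPairs δ t θ e W o with pairKey t θ e p = κ, annInd δ p.1 y * annInd δ p.2 y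

section

variable {δ t θ : ℝ} {e : ℝ × ℝ} {W : Finset PlaneCircle} {o : (ℤ × ℤ × ℤ) × (ℤ × ℤ)}
  {κ : ℤ × (ℤ × ℤ × ℤ) × (ℤ × ℤ)}

lemma overlap_nonneg (y) : 0 ≤ overlap δ t θ e W o κ y :=
  Finset.sum_nonneg fun _ _ => mul_nonneg (annInd_nonneg ..) (annInd_nonneg ..)

open Classical in
lemma filter_pairKey_subset : {p ∈ tangentPairs δ t θ e W o | pairKey t θ e p = κ} ⊆
    keyClass t θ e W κ.1 κ.2 ×ˢ keyClass t θ e W κ.1 (κ.2 + o) := by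
  intro p hp
  obtain ⟨hp', rfl⟩ := Finset.mem_filter.1 hp
  obtain ⟨hpW, -, ho⟩ := Finset.mem_filter.1 hp'
  rw [Finset.mem_product] at hpW
  refine Finset.mem_product.2 ⟨Finset.mem_filter.2 ⟨hpW.1, rfl⟩, Finset.mem_filter.2 ⟨hpW.2, ?_⟩⟩
  simp only [pairKey]
  rw [← ho, add_sub_cancel]

lemma overlap_le (he : e.1 ^ 2 + e.2 ^ 2 = 1) (hθ : 0 < θ) (hθ2 : θ ≤ 2)
    (hW : ∀ w ∈ W, 1 ≤ w.2 ∧ w.2 ≤ 2) (y) : overlap δ t θ e W o κ y ≤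
      (∑ a ∈ keyClass t θ e W κ.1 κ.2, arcInd δ θ e (κ.1 * θ) a y) *
        ∑ c ∈ keyClass t θ e W κ.1 (κ.2 + o), arcInd δ θ e (κ.1 * θ) c y := by
  classical
  rw [Finset.sum_mul_sum, ← Finset.sum_product']
  refine le_trans (Finset.sum_le_sum ?_) (Finset.sum_le_sum_of_subset_of_nonneg
    filter_pairKey_subset fun _ _ _ => mul_nonneg (arcInd_nonneg ..) (arcInd_nonneg ..))
  intro p hp
  obtain ⟨hp', rfl⟩ := Finset.mem_filter.1 hp
  obtain ⟨hpW, hT, -⟩ := Finset.mem_filter.1 hp'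
  rw [Finset.mem_product] at hpW
  exact hT.annInd_mul_le he hθ hθ2 (abs_tanParam_sub_le hθ e _ _) (hW _ hpW.1) (hW _ hpW.2) y

lemma integralLE_overlap (he : e.1 ^ 2 + e.2 ^ 2 = 1) (hδ : 0 < δ) (hδ1 : δ < 1) (ht : 0 < t)
    (hθ : 0 < θ) (hθ2 : θ ≤ 2) (hW : ∀ w ∈ W, 1 ≤ w.2 ∧ w.2 ≤ 2) :
    IntegralLE (overlap δ t θ e W o κ) ((keyClass t θ e W κ.1 κ.2).card *
      (keyClass t θ e W κ.1 (κ.2 + o)).card * (192000 * 8000 * δ ^ 2 / (t * θ))) := by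
  classical
  refine (IntegralLE.sum {p ∈ tangentPairs δ t θ e W o | pairKey t θ e p = κ}
    (b := fun _ => 192000 * 8000 * δ ^ 2 / (t * θ)) ?_).mono ?_
  · intro p hp
    obtain ⟨hpW, hT, -⟩ := Finset.mem_filter.1 (Finset.mem_filter.1 hp).1
    rw [Finset.mem_product] at hpW
    simp only [annInd_mul]
    exact IntegralLE.indicator ((isClosed_annulus _ _ _).inter (isClosed_annulus _ _ _))
      (by positivity) (hT.volume_inter_le he hδ1 hθ hθ2 (hW _ hpW.1) (hW _ hpW.2))
  · rw [Finset.sum_const, nsmul_eq_mul]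
    refine mul_le_mul_of_nonneg_right ?_ (by positivity)
    have := Finset.card_le_card (filter_pairKey_subset (δ := δ) (t := t) (θ := θ) (e := e) (W := W)
      (o := o) (κ := κ))
    rw [Finset.card_product] at this
    exact_mod_cast this

lemma integralLE_sum_arcInd (he : e.1 ^ 2 + e.2 ^ 2 = 1) (hδ : 0 < δ) (hδ1 : δ < 1)
    (hθ : 0 < θ) (hW : ∀ w ∈ W, 1 ≤ w.2 ∧ w.2 ≤ 2) (τ : ℝ) {S : Finset PlaneCircle} (hS : S ⊆ W) :
    IntegralLE (fun y => ∑ a ∈ S, arcInd δ θ e τ a y) (S.card * (192000 * δ * θ)) := by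
  rw [← nsmul_eq_mul, ← Finset.sum_const]
  refine IntegralLE.sum _ fun a ha => ?_
  exact IntegralLE.indicator (isClosed_sector _ _ _ _ _ _) (by positivity)
    (volume_arcSector_le δ θ e τ a hδ hδ1 hθ he (hW a (hS ha)))

lemma sum_arcInd_le (τ : ℝ) {S : Finset PlaneCircle} (hS : S ⊆ W) (y) :
    ∑ a ∈ S, arcInd δ θ e τ a y ≤ ∑ w ∈ W, annInd δ w y :=
  (Finset.sum_le_sum fun _ _ => arcInd_le_annInd ..).trans
    (Finset.sum_le_sum_of_subset_of_nonneg hS fun _ _ _ => annInd_nonneg ..)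

lemma exists_overlap_majorant (he : e.1 ^ 2 + e.2 ^ 2 = 1) (hδ : 0 < δ) (hδ1 : δ < 1) (ht : 0 < t)
    (hθ : 0 < θ) (hθ2 : θ ≤ 2) (hW : ∀ w ∈ W, 1 ≤ w.2 ∧ w.2 ≤ 2)
    (hκ : (keyClass t θ e W κ.1 κ.2).Nonempty) :
    ∃ H, IntegralLE H (192000 * 8000 * (δ * √δ / √t) *
      (((keyClass t θ e W κ.1 κ.2).card * (keyClass t θ e W κ.1 (κ.2 + o)).card : ℝ) /
        √(max (keyClass t θ e W κ.1 κ.2).card (keyClass t θ e W κ.1 (κ.2 + o)).card : ℕ))) ∧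
      ∀ y, overlap δ t θ e W o κ y ≤ √(∑ w ∈ W, annInd δ w y) * H y := by
  have hA : keyClass t θ e W κ.1 κ.2 ⊆ W := Finset.filter_subset _ _
  have hC : keyClass t θ e W κ.1 (κ.2 + o) ⊆ W := Finset.filter_subset _ _
  have hN := integralLE_overlap (o := o) (κ := κ) he hδ hδ1 ht hθ hθ2 hW
  have hle := overlap_le (δ := δ) (t := t) (o := o) (κ := κ) he hθ hθ2 hW
  have hxA := integralLE_sum_arcInd he hδ hδ1 hθ hW (κ.1 * θ) hA
  have hxC := integralLE_sum_arcInd he hδ hδ1 hθ hW (κ.1 * θ) hC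
  have hFA := sum_arcInd_le (δ := δ) (θ := θ) (e := e) (κ.1 * θ) hA
  have hFC := sum_arcInd_le (δ := δ) (θ := θ) (e := e) (κ.1 * θ) hC
  have hN0 := overlap_nonneg (δ := δ) (t := t) (θ := θ) (e := e) (W := W) (o := o) (κ := κ)
  have hP := Finset.card_pos.2 hκ
  generalize keyClass t θ e W κ.1 κ.2 = A at *
  generalize keyClass t θ e W κ.1 (κ.2 + o) = C at *
  have hM : (0 : ℝ) < (max A.card C.card : ℕ) := Nat.cast_pos.2 (lt_of_lt_of_le hP (le_max_left _ _))
  have hβ : 0 < θ * √t / (√δ * √(max A.card C.card : ℕ)) := by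
    have h1 := Real.sqrt_pos.2 hM
    have h2 := Real.sqrt_pos.2 ht
    have h3 := Real.sqrt_pos.2 hδ
    exact div_pos (mul_pos hθ h2) (mul_pos h3 h1)
  have hF0 : ∀ y, 0 ≤ ∑ w ∈ W, annInd δ w y := fun y => Finset.sum_nonneg fun _ _ => annInd_nonneg ..
  rcases le_total A.card C.card with h | h
  · refine ⟨_, ((hN.const_mul (half_pos hβ).le).add (hxA.const_mul
      (half_pos (inv_pos.2 hβ)).le)).mono (area_weight_le hδ ht hθ hM (Nat.cast_nonneg _)
      (Nat.cast_nonneg _) (by rw [max_eq_right h])), fun y => ?_⟩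
    exact le_sqrt_mul_of_le_mul (hN0 y) (hxA.nonneg y) (hF0 y) hβ
      ((hle y).trans (mul_le_mul_of_nonneg_left (hFC y) (hxA.nonneg y)))
  · refine ⟨_, ((hN.const_mul (half_pos hβ).le).add (hxC.const_mul
      (half_pos (inv_pos.2 hβ)).le)).mono (area_weight_le hδ ht hθ hM (Nat.cast_nonneg _)
      (Nat.cast_nonneg _) (by rw [max_eq_left h, mul_comm])), fun y => ?_⟩
    refine le_sqrt_mul_of_le_mul (hN0 y) (hxC.nonneg y) (hF0 y) hβ ((hle y).trans ?_)
    rw [mul_comm]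
    exact mul_le_mul_of_nonneg_left (hFA y) (hxC.nonneg y)

open Classical in
/-- The contribution of the tangent pairs at given scales. -/
theorem exists_tangent_majorant (he : e.1 ^ 2 + e.2 ^ 2 = 1) (hδ : 0 < δ) (hδ1 : δ < 1) (ht : 0 < t)
    (hθ : 0 < θ) (hθ2 : θ ≤ 2) (hW : ∀ w ∈ W, 1 ≤ w.2 ∧ w.2 ≤ 2) {J U : ℕ} (hJ1 : 1 ≤ J)
    (hJ : 4 ≤ 2 ^ J * θ) {n : ℝ} (hn : ∀ Q, ((cubeClass t e W Q).card : ℝ) ≤ n)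
    (hnU : 2 * n < 2 ^ U) :
    ∃ H, IntegralLE H (192000 * 8000 * (δ * √δ / √t) *
      (20 * 55 ^ 3 * J * U * (2 * W.card * √(2 * n)))) ∧
      ∀ y, ∑ p ∈ tangentPairs δ t θ e W o, annInd δ p.1 y * annInd δ p.2 y ≤
        √(∑ w ∈ W, annInd δ w y) * H y := by
  have h := fun κ (hκ : κ ∈ (tangentPairs δ t θ e W o).image (pairKey t θ e)) =>
    exists_overlap_majorant (o := o) (κ := κ) he hδ hδ1 ht hθ hθ2 hW (by
      obtain ⟨p, hp, rfl⟩ := Finset.mem_image.1 hκ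
      obtain ⟨hpW, -, -⟩ := Finset.mem_filter.1 hp
      exact ⟨p.1, Finset.mem_filter.2 ⟨(Finset.mem_product.1 hpW).1, rfl⟩⟩)
  choose! H hH hle using h
  refine ⟨_, (IntegralLE.sum _ hH).mono ?_, fun y => ?_⟩
  · rw [← Finset.mul_sum]
    exact mul_le_mul_of_nonneg_left (sum_pairKey_le W o hθ hθ2 ht hJ1 hJ hn hnU) (by positivity)
  · rw [Finset.mul_sum, ← Finset.sum_fiberwise_of_maps_to (fun p hp => Finset.mem_image_of_mem
      (pairKey t θ e) hp)]
    exact Finset.sum_le_sum fun κ hκ => hle κ hκ y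

end

open Classical in
/-- The circles of `W` at distance at most `ρ` from `w`. -/
noncomputable def nearCircles (W : Finset PlaneCircle) (w : PlaneCircle) (ρ : ℝ) :
    Finset PlaneCircle :=
  {c ∈ W | dist c.1 w.1 ≤ ρ ∧ |c.2 - w.2| ≤ ρ}

/-- The directions, scales and key differences of tangent pairs. -/
noncomputable def tangencyTypes (N : ℕ) :
    Finset ((ℝ × ℝ) × ℕ × ℕ × ((ℤ × ℤ × ℤ) × (ℤ × ℤ))) :=
  coordDirections ×ˢ Finset.range N ×ˢ Finset.range N ×ˢ keyOffsets

/-- The tangent pairs of a given type. -/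
noncomputable def typePairs (δ : ℝ) (W : Finset PlaneCircle)
    (q : (ℝ × ℝ) × ℕ × ℕ × ((ℤ × ℤ × ℤ) × (ℤ × ℤ))) : Finset (PlaneCircle × PlaneCircle) :=
  tangentPairs δ ((1 / 2) ^ q.2.1) (2 * (1 / 2) ^ q.2.2.1) q.1 W q.2.2.2

lemma card_tangencyTypes_le (N : ℕ) : ((tangencyTypes N).card : ℝ) ≤ 4 * 161 ^ 5 * N ^ 2 := by
  have h : (tangencyTypes N).card ≤ 4 * (N * (N * 161 ^ 5)) := by
    rw [tangencyTypes, Finset.card_product, Finset.card_product, Finset.card_product,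
      Finset.card_range, card_keyOffsets]
    exact Nat.mul_le_mul_right _ card_coordDirections_le
  have h1 : ((tangencyTypes N).card : ℝ) ≤ ((4 * (N * (N * 161 ^ 5)) : ℕ) : ℝ) := by exact_mod_cast h
  refine h1.trans (le_of_eq ?_)
  push_cast
  ring

lemma annInd_le_one (δ : ℝ) (w : PlaneCircle) (y) : annInd δ w y ≤ 1 :=
  indicator_le' (fun _ _ => le_rfl) (fun _ _ => zero_le_one) y

lemma mem_annulus_of_annInd_ne_zero {δ : ℝ} {w : PlaneCircle} {y} (h : annInd δ w y ≠ 0) :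
    y ∈ annulus (10 * δ) w.1 w.2 := by
  by_contra hy
  exact h (indicator_of_notMem hy _)

lemma cubeClass_subset_nearCircles {t : ℝ} (ht : 0 < t) {e : ℝ × ℝ} (he : e.1 ^ 2 + e.2 ^ 2 = 1)
    (W : Finset PlaneCircle) {w₀ : PlaneCircle} {Q} (h0 : w₀ ∈ cubeClass t e W Q) :
    cubeClass t e W Q ⊆ nearCircles W w₀ t := by
  intro c hc
  simp only [cubeClass, Finset.mem_filter] at h0 hc
  refine Finset.mem_filter.2 ⟨hc.1, ?_⟩
  have h := hc.2.trans h0.2.symm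
  simp only [cubeKey, Prod.mk.injEq] at h
  obtain ⟨h1, h2, h3⟩ := h
  replace h1 := abs_sub_le_of_floor_div_eq (by positivity) h1
  replace h2 := abs_sub_le_of_floor_div_eq (by positivity) h2
  replace h3 := abs_sub_le_of_floor_div_eq (by positivity) h3
  refine ⟨abs_le_of_sq_le_sq' ?_ ht.le |>.2, by linarith⟩
  have e1 : dist c.1 w₀.1 ^ 2 = (along e c - along e w₀) ^ 2 + (across e c - across e w₀) ^ 2 := by
    rw [dist_sq_eq, ← frame_sq he]
    unfold along across
    congr 2 <;> ring
  rw [e1, ← sq_abs (along e c - _), ← sq_abs (across e c - _)]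
  have h4 := pow_le_pow_left₀ (abs_nonneg _) h1 2
  have h5 := pow_le_pow_left₀ (abs_nonneg _) h2 2
  have h6 : 0 < t ^ 2 := by positivity
  nlinarith

lemma sum_mul_sum_le_two_mul {ι : Type*} (s : Finset ι) (r f : ι → ℝ) (hf : ∀ i, 0 ≤ f i) :
    (∑ i ∈ s, f i) * ∑ i ∈ s, f i ≤
      2 * ∑ a ∈ s, ∑ c ∈ s, if r a ≤ r c then f a * f c else 0 := by
  rw [Finset.sum_mul_sum, two_mul]
  nth_rewrite 2 [Finset.sum_comm]
  rw [← Finset.sum_add_distrib]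
  refine Finset.sum_le_sum fun a _ => ?_
  rw [← Finset.sum_add_distrib]
  refine Finset.sum_le_sum fun c _ => ?_
  have h := mul_nonneg (hf a) (hf c)
  have h' := mul_nonneg (hf c) (hf a)
  rcases le_total (r a) (r c) with h1 | h1
  · rw [if_pos h1]
    split_ifs <;> linarith
  · rw [if_pos h1, mul_comm (f c)]
    split_ifs <;> linarith

open Classical in
lemma annInd_mul_le_add {δ : ℝ} {N : ℕ} (hδ : 0 < δ) (hN : 1 / δ ≤ 2 ^ N) {W : Finset PlaneCircle}
    (hW : ∀ w ∈ W, w.1 ∈ closedBall (0 : EuclideanSpace ℝ (Fin 2)) (1 / 4)) (y)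
    {a c : PlaneCircle} (ha : a ∈ W) (hc : c ∈ W) :
    (if a.2 ≤ c.2 then annInd δ a y * annInd δ c y else 0) ≤
      (if dist c.1 a.1 ≤ 4020 * δ ∧ |c.2 - a.2| ≤ 4020 * δ then annInd δ a y else 0) +
      ∑ q ∈ tangencyTypes N, if (a, c) ∈ typePairs δ W q then annInd δ a y * annInd δ c y else 0 := by
  have h0 := mul_nonneg (annInd_nonneg δ a y) (annInd_nonneg δ c y)
  have hs : 0 ≤ ∑ q ∈ tangencyTypes N,
      if (a, c) ∈ typePairs δ W q then annInd δ a y * annInd δ c y else 0 :=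
    Finset.sum_nonneg fun q _ => by split_ifs <;> simp [h0]
  have hs' : 0 ≤ if dist c.1 a.1 ≤ 4020 * δ ∧ |c.2 - a.2| ≤ 4020 * δ then annInd δ a y else 0 := by
    split_ifs
    exacts [annInd_nonneg .., le_rfl]
  by_cases hac : a.2 ≤ c.2
  swap
  · rw [if_neg hac]; linarith
  rw [if_pos hac]
  by_cases hz : annInd δ a y * annInd δ c y = 0
  · rw [hz] at hs ⊢; linarith
  have hya := mem_annulus_of_annInd_ne_zero (left_ne_zero_of_mul hz)
  have hyc := mem_annulus_of_annInd_ne_zero (right_ne_zero_of_mul hz)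
  rcases le_or_gt (dist c.1 a.1) (4000 * δ) with hD | hD
  · have hR : |c.2 - a.2| ≤ 4020 * δ := by
      have hya' : |dist y a.1 - a.2| ≤ 10 * δ := hya
      have hyc' : |dist y c.1 - c.2| ≤ 10 * δ := hyc
      have := dist_triangle_right y c.1 a.1
      rw [abs_of_nonneg (sub_nonneg.2 hac)]
      have := dist_triangle y a.1 c.1
      rw [dist_comm a.1] at this
      linarith [(abs_le.1 hya').2, (abs_le.1 hyc').1]
    rw [if_pos ⟨by linarith, hR⟩]
    have := mul_le_mul_of_nonneg_left (annInd_le_one δ c y) (annInd_nonneg δ a y)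
    linarith
  · obtain ⟨e, he, i, hi, j, hj, hT⟩ := exists_tangentPair hδ hN (hW a ha) (hW c hc) hac hD hya hyc
    refine le_trans ?_ (le_add_of_nonneg_left hs')
    obtain ⟨o, hk, ho⟩ := hT.exists_keyOffset (by positivity)
    have hq : (e, i, j, o) ∈ tangencyTypes N :=
      Finset.mk_mem_product he (Finset.mk_mem_product hi (Finset.mk_mem_product hj hk))
    have hmem : (a, c) ∈ typePairs δ W (e, i, j, o) :=
      Finset.mem_filter.2 ⟨Finset.mk_mem_product ha hc, hT, ho⟩
    refine le_trans (le_of_eq (if_pos hmem).symm) (Finset.single_le_sum (f := fun q =>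
      if (a, c) ∈ typePairs δ W q then annInd δ a y * annInd δ c y else 0) (fun q _ => ?_) hq)
    split_ifs
    exacts [h0, le_rfl]

lemma typePairs_subset (δ : ℝ) (W : Finset PlaneCircle) (q) : typePairs δ W q ⊆ W ×ˢ W := by
  classical exact Finset.filter_subset _ _

/-- The square of the multiplicity is controlled by close pairs and tangent pairs. -/
lemma sq_sum_annInd_le {δ K : ℝ} {N : ℕ} (hδ : 0 < δ) (hN : 1 / δ ≤ 2 ^ N) {W : Finset PlaneCircle}
    (hW : ∀ w ∈ W, w.1 ∈ closedBall (0 : EuclideanSpace ℝ (Fin 2)) (1 / 4))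
    (hnear : ∀ w ∈ W, ((nearCircles W w (4020 * δ)).card : ℝ) ≤ K) (y) :
    (∑ w ∈ W, annInd δ w y) * ∑ w ∈ W, annInd δ w y ≤ 2 * (K * ∑ w ∈ W, annInd δ w y) +
      2 * ∑ q ∈ tangencyTypes N, ∑ p ∈ typePairs δ W q, annInd δ p.1 y * annInd δ p.2 y := by
  classical
  refine (sum_mul_sum_le_two_mul W (fun w => w.2) _ fun w => annInd_nonneg δ w y).trans ?_
  rw [← mul_add]
  refine mul_le_mul_of_nonneg_left ?_ zero_le_two
  refine (Finset.sum_le_sum fun a ha => Finset.sum_le_sum fun c hc =>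
    annInd_mul_le_add hδ hN hW y ha hc).trans ?_
  simp only [Finset.sum_add_distrib]
  refine add_le_add ?_ (le_of_eq ?_)
  · rw [Finset.mul_sum]
    refine Finset.sum_le_sum fun a ha => ?_
    rw [← Finset.sum_filter, Finset.sum_const, nsmul_eq_mul]
    exact mul_le_mul_of_nonneg_right (hnear a ha) (annInd_nonneg ..)
  · rw [← Finset.sum_product', Finset.sum_comm]
    refine Finset.sum_congr rfl fun q _ => ?_
    exact (Finset.sum_subset_zero_on_sdiff (typePairs_subset δ W q)
      (fun p hp => if_neg (Finset.mem_sdiff.1 hp).2) fun p hp => (if_pos hp).symm).symm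

lemma mul_sqrt_le_of_sq_le {F K G : ℝ} (hF : 0 ≤ F) (hG : 0 ≤ G)
    (h : F * F ≤ 2 * (K * F) + 2 * (√F * G)) : F * √F ≤ √(4 * K) * F + 4 * G := by
  have hs := Real.sqrt_nonneg F
  rcases le_or_gt F (4 * K) with h1 | h1
  · have h2 : F * √F ≤ F * √(4 * K) := mul_le_mul_of_nonneg_left (Real.sqrt_le_sqrt h1) hF
    linarith
  · have h3 : 0 ≤ √(4 * K) * F := mul_nonneg (Real.sqrt_nonneg _) hF
    rcases hF.eq_or_lt with h0 | h0
    · rw [← h0]; simp; positivity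
    · have h4 : K * F ≤ F * F / 4 := by nlinarith
      have h5 : √F * (F * √F) ≤ √F * (4 * G) := by
        have : √F * √F = F := Real.mul_self_sqrt hF
        calc √F * (F * √F) = F * (√F * √F) := by ring
          _ = F * F := by rw [this]
          _ ≤ √F * (4 * G) := by linarith
      have h6 := le_of_mul_le_mul_left h5 (Real.sqrt_pos.2 h0)
      linarith

lemma tangency_weight_eq {δ t K : ℝ} (hδ : 0 < δ) (ht : 0 < t) (hK : 0 ≤ K) :
    δ * √δ / √t * √(2 * (K * t / δ)) ≤ 2 * (δ * √K) := by
  have e1 : 2 * (K * t / δ) = 2 * K * (t / δ) := by ring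
  have hd : 0 < √δ := Real.sqrt_pos.2 hδ
  have hT : 0 < √t := Real.sqrt_pos.2 ht
  rw [e1, Real.sqrt_mul (by positivity), Real.sqrt_div ht.le, Real.sqrt_mul (by norm_num)]
  have h2 : √2 ≤ 2 := Real.sqrt_le_iff.2 ⟨by norm_num, by norm_num⟩
  calc δ * √δ / √t * (√2 * √K * (√t / √δ)) = √2 * (δ * √K) := by field_simp
    _ ≤ _ := mul_le_mul_of_nonneg_right h2 (by positivity)

lemma card_cubeClass_le {δ K t : ℝ} (hδ : 0 < δ) (hK : 0 ≤ K) (ht : δ ≤ t) {e : ℝ × ℝ}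
    (he : e.1 ^ 2 + e.2 ^ 2 = 1) {W : Finset PlaneCircle}
    (hloc : ∀ w ∈ W, ∀ ρ, δ ≤ ρ → ((nearCircles W w ρ).card : ℝ) ≤ K * ρ / δ) (Q) :
    ((cubeClass t e W Q).card : ℝ) ≤ K * t / δ := by
  have ht0 : 0 < t := hδ.trans_le ht
  rcases (cubeClass t e W Q).eq_empty_or_nonempty with h | ⟨w, hw⟩
  · rw [h, Finset.card_empty, Nat.cast_zero]; positivity
  · refine le_trans ?_ (hloc w (Finset.mem_filter.1 hw).1 t ht)
    exact_mod_cast Finset.card_le_card (cubeClass_subset_nearCircles ht0 he W hw)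

lemma le_half_pow {δ : ℝ} {N i : ℕ} (hδ : 0 < δ) (hN : (2 : ℝ) ^ N ≤ 2 / δ) (hi : i < N) :
    δ ≤ (1 / 2) ^ i := by
  have h1 : (2 : ℝ) ^ (i + 1) ≤ 2 ^ N := pow_le_pow_right₀ (by norm_num) hi
  have h2 : (2 : ℝ) ^ i ≤ 1 / δ := by
    have h3 : (2 : ℝ) ^ i * 2 ≤ 2 / δ := by rw [← pow_succ]; exact h1.trans hN
    have h4 : 2 / δ = 1 / δ * 2 := by ring
    linarith
  rw [one_div_pow, le_div_iff₀ (by positivity)]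
  rw [le_div_iff₀ hδ] at h2
  linarith

lemma four_le_two_pow_mul {N j : ℕ} (hj : j < N) : (4 : ℝ) ≤ 2 ^ N * (2 * (1 / 2) ^ j) := by
  have h1 : (2 : ℝ) ^ (j + 1) ≤ 2 ^ N := pow_le_pow_right₀ (by norm_num) hj
  have h2 : (2 : ℝ) ^ j * (1 / 2) ^ j = 1 := by rw [← mul_pow]; norm_num
  have h3 : (0 : ℝ) < 2 * (1 / 2) ^ j := by positivity
  calc (4 : ℝ) = 4 * (2 ^ j * (1 / 2) ^ j) := by rw [h2]; norm_num
    _ = 2 ^ (j + 1) * (2 * (1 / 2) ^ j) := by ring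
    _ ≤ _ := mul_le_mul_of_nonneg_right h1 h3.le

section

variable {δ K : ℝ} {N U : ℕ} {W : Finset PlaneCircle}

lemma exists_typePairs_majorant (hδ : 0 < δ) (hδ1 : δ < 1) (hK : 0 ≤ K) (hN' : (2 : ℝ) ^ N ≤ 2 / δ)
    (hU : 2 * (K / δ) < 2 ^ U) (hW : ∀ w ∈ W, 1 ≤ w.2 ∧ w.2 ≤ 2)
    (hloc : ∀ w ∈ W, ∀ ρ, δ ≤ ρ → ((nearCircles W w ρ).card : ℝ) ≤ K * ρ / δ)
    {q} (hq : q ∈ tangencyTypes N) :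
    ∃ H, IntegralLE H (192000 * 8000 * 20 * 55 ^ 3 * 4 * (N * U * (W.card * (δ * √K)))) ∧
      ∀ y, ∑ p ∈ typePairs δ W q, annInd δ p.1 y * annInd δ p.2 y ≤
        √(∑ w ∈ W, annInd δ w y) * H y := by
  obtain ⟨e, i, j, o⟩ := q
  rw [tangencyTypes] at hq
  have hq1 := Finset.mem_product.1 hq
  have hq2 := Finset.mem_product.1 hq1.2
  have he : e.1 ^ 2 + e.2 ^ 2 = 1 := coordDirections_unit hq1.1
  have hi : i < N := Finset.mem_range.1 hq2.1
  have hj : j < N := Finset.mem_range.1 (Finset.mem_product.1 hq2.2).1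
  have ht : (0 : ℝ) < (1 / 2) ^ i := by positivity
  have ht1 : (1 / 2 : ℝ) ^ i ≤ 1 := pow_le_one₀ (by norm_num) (by norm_num)
  have hθ1 : 2 * (1 / 2 : ℝ) ^ j ≤ 2 := by
    have : (1 / 2 : ℝ) ^ j ≤ 1 := pow_le_one₀ (by norm_num) (by norm_num)
    linarith
  obtain ⟨H, hH, hle⟩ := exists_tangent_majorant (o := o) (W := W) (J := N) (U := U) he hδ hδ1 ht
    (show (0 : ℝ) < 2 * (1 / 2) ^ j by positivity) hθ1 hW (by omega) (four_le_two_pow_mul hj)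
    (card_cubeClass_le hδ hK (le_half_pow hδ hN' hi) he hloc) (by
      refine lt_of_le_of_lt ?_ hU
      have : K * (1 / 2) ^ i / δ ≤ K / δ := div_le_div_of_nonneg_right (by nlinarith) hδ.le
      linarith)
  refine ⟨H, hH.mono ?_, hle⟩
  have h := tangency_weight_eq hδ ht hK
  have h' := mul_le_mul_of_nonneg_left h
    (show (0 : ℝ) ≤ 192000 * 8000 * 20 * 55 ^ 3 * 2 * (N * U * W.card) by positivity)
  refine le_trans (le_of_eq ?_) (h'.trans (le_of_eq ?_)) <;> ring

lemma integralLE_sum_annInd (hδ : 0 < δ) (hδ1 : δ < 1) (hW : ∀ w ∈ W, 1 ≤ w.2 ∧ w.2 ≤ 2) :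
    IntegralLE (fun y => ∑ w ∈ W, annInd δ w y) (W.card * (4800 * δ)) := by
  rw [← nsmul_eq_mul, ← Finset.sum_const]
  exact IntegralLE.sum _ fun w hw => IntegralLE.indicator (isClosed_annulus _ _ _) (by positivity)
    (volume_annulus_le δ hδ hδ1 _ _ (hW w hw).1 (hW w hw).2)

/-- The main estimate for the power `3 / 2` of the multiplicity. -/
theorem exists_majorant (hδ : 0 < δ) (hδ1 : δ < 1) (hK : 0 ≤ K) (hN1 : 1 ≤ N) (hU1 : 1 ≤ U)
    (hN : 1 / δ ≤ 2 ^ N) (hN' : (2 : ℝ) ^ N ≤ 2 / δ)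
    (hU : 2 * (K / δ) < 2 ^ U) (hW : ∀ w ∈ W, 1 ≤ w.2 ∧ w.2 ≤ 2)
    (hball : ∀ w ∈ W, w.1 ∈ closedBall (0 : EuclideanSpace ℝ (Fin 2)) (1 / 4))
    (hloc : ∀ w ∈ W, ∀ ρ, δ ≤ ρ → ((nearCircles W w ρ).card : ℝ) ≤ K * ρ / δ) :
    ∃ H, IntegralLE H (10 ^ 30 * (N ^ 3 * U * (W.card * (δ * √K)))) ∧
      ∀ y, (∑ w ∈ W, annInd δ w y) * √(∑ w ∈ W, annInd δ w y) ≤ H y := by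
  have h := fun q (hq : q ∈ tangencyTypes N) =>
    exists_typePairs_majorant (W := W) hδ hδ1 hK hN' hU hW hloc hq
  choose! H hH hle using h
  have hsum := IntegralLE.sum (tangencyTypes N) hH
  refine ⟨_, (((integralLE_sum_annInd hδ hδ1 hW).const_mul (Real.sqrt_nonneg (4 * (K * 4020)))).add
    (hsum.const_mul (show (0 : ℝ) ≤ 4 by norm_num))).mono ?_, fun y => ?_⟩
  · rw [Finset.sum_const, nsmul_eq_mul]
    have hcard := card_tangencyTypes_le N
    have hX : (0 : ℝ) ≤ W.card * (δ * √K) := by positivity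
    have h1 : √(4 * (K * 4020)) ≤ 127 * √K := by
      refine Real.sqrt_le_iff.2 ⟨by positivity, ?_⟩
      rw [mul_pow, Real.sq_sqrt hK]
      linarith
    have h2 : √(4 * (K * 4020)) * (W.card * (4800 * δ)) ≤ 609600 * (W.card * (δ * √K)) := by
      refine (mul_le_mul_of_nonneg_right h1 (by positivity)).trans (le_of_eq ?_)
      ring
    have h3 : ((tangencyTypes N).card : ℝ) *
        (192000 * 8000 * 20 * 55 ^ 3 * 4 * (N * U * (W.card * (δ * √K)))) ≤
        4 * 161 ^ 5 * N ^ 2 * (192000 * 8000 * 20 * 55 ^ 3 * 4 * (N * U * (W.card * (δ * √K)))) :=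
      mul_le_mul_of_nonneg_right hcard (by positivity)
    generalize (W.card : ℝ) * (δ * √K) = X at *
    have h4 : X ≤ N ^ 3 * U * X := by
      have hN2 : (1 : ℝ) ≤ N := by exact_mod_cast hN1
      have hU2 : (1 : ℝ) ≤ U := by exact_mod_cast hU1
      have : (1 : ℝ) * 1 ≤ N ^ 3 * U :=
        mul_le_mul (one_le_pow₀ hN2) hU2 zero_le_one (by positivity)
      nlinarith
    have h5 : 4 * 161 ^ 5 * (N : ℝ) ^ 2 * (192000 * 8000 * 20 * 55 ^ 3 * 4 * (N * U * X)) =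
      4 * 161 ^ 5 * (192000 * 8000 * 20 * 55 ^ 3 * 4) * (N ^ 3 * U * X) := by ring
    rw [h5] at h3
    generalize (N : ℝ) ^ 3 * U * X = Y at *
    refine (add_le_add h2 (mul_le_mul_of_nonneg_left h3 (by norm_num))).trans ?_
    norm_num
    linarith
  · have hF : 0 ≤ ∑ w ∈ W, annInd δ w y := Finset.sum_nonneg fun _ _ => annInd_nonneg ..
    refine mul_sqrt_le_of_sq_le hF (hsum.nonneg y) ((sq_sum_annInd_le hδ hN hball (K := K * 4020)
      (fun w hw => (hloc w hw _ (by linarith)).trans (le_of_eq (by field_simp))) y).trans ?_)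
    have : ∑ q ∈ tangencyTypes N, ∑ p ∈ typePairs δ W q, annInd δ p.1 y * annInd δ p.2 y ≤
        √(∑ w ∈ W, annInd δ w y) * ∑ q ∈ tangencyTypes N, H q y := by
      rw [Finset.mul_sum]
      exact Finset.sum_le_sum fun q hq => hle q hq y
    linarith

end

/-- The finite set of circles with centers `x ∈ X` and radii in `R x`. -/
noncomputable def circlesOf (X : Finset (EuclideanSpace ℝ (Fin 2)))
    (R : EuclideanSpace ℝ (Fin 2) → Finset ℝ) : Finset PlaneCircle :=
  (X.sigma R).map ⟨fun p => (p.1, p.2), fun p q h => by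
    obtain ⟨h1, h2⟩ := Prod.mk.inj h
    exact Sigma.ext h1 (heq_of_eq h2)⟩

section

variable {X : Finset (EuclideanSpace ℝ (Fin 2))} {R : EuclideanSpace ℝ (Fin 2) → Finset ℝ}

lemma mem_circlesOf {w : PlaneCircle} : w ∈ circlesOf X R ↔ w.1 ∈ X ∧ w.2 ∈ R w.1 := by
  obtain ⟨x, r⟩ := w
  simp only [circlesOf, Finset.mem_map, Finset.mem_sigma]
  constructor
  · rintro ⟨⟨a, b⟩, ⟨h1, h2⟩, h3⟩
    obtain ⟨rfl, rfl⟩ := Prod.mk.inj h3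
    exact ⟨h1, h2⟩
  · rintro ⟨h1, h2⟩
    exact ⟨⟨x, r⟩, ⟨h1, h2⟩, rfl⟩

lemma annSum_eq_sum_annInd (δ : ℝ) (y) :
    annSum δ X R y = ∑ w ∈ circlesOf X R, annInd δ w y := by
  rw [circlesOf, Finset.sum_map, Finset.sum_sigma]
  rfl

lemma card_circlesOf {m : ℕ} (h : ∀ x ∈ X, (R x).card = m) :
    (circlesOf X R).card = X.card * m := by
  rw [circlesOf, Finset.card_map, Finset.card_sigma, Finset.sum_congr rfl h, Finset.sum_const,
    smul_eq_mul]

/-- A set of multiples of `δ` inside an interval of length `L` has at most `L / δ + 1` elements. -/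
lemma card_le_of_multiples {δ a L : ℝ} (hδ : 0 < δ) (hL : 0 ≤ L) {S : Finset ℝ}
    (hS : ∀ r ∈ S, r ∈ Set.Icc a (a + L) ∧ ∃ k : ℤ, r = δ * k) : (S.card : ℝ) ≤ L / δ + 1 := by
  have hsub : S ⊆ (Finset.Icc ⌈a / δ⌉ ⌊(a + L) / δ⌋).image fun k : ℤ => δ * k := by
    intro r hr
    obtain ⟨⟨h1, h2⟩, k, rfl⟩ := hS r hr
    refine Finset.mem_image.2 ⟨k, Finset.mem_Icc.2 ⟨Int.ceil_le.2 ?_, Int.le_floor.2 ?_⟩, rfl⟩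
    · rw [div_le_iff₀ hδ]; linarith
    · rw [le_div_iff₀ hδ]; linarith
  have h1 := (Finset.card_le_card hsub).trans Finset.card_image_le
  rw [Int.card_Icc] at h1
  have h2 : (S.card : ℝ) ≤ ((⌊(a + L) / δ⌋ + 1 - ⌈a / δ⌉).toNat : ℝ) := by exact_mod_cast h1
  refine h2.trans ?_
  have h3 : (((⌊(a + L) / δ⌋ + 1 - ⌈a / δ⌉).toNat : ℤ) : ℝ) ≤ L / δ + 1 := by
    rw [Int.toNat_eq_max]
    push_cast
    refine max_le ?_ (by positivity)
    have := Int.floor_le ((a + L) / δ)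
    have := Int.le_ceil (a / δ)
    have e : (a + L) / δ = a / δ + L / δ := add_div ..
    linarith
  exact_mod_cast h3

lemma le_rpow_mul_rpow {n m z α : ℝ} (hn : 0 ≤ n) (h0 : 0 ≤ α) (h1 : α ≤ 1)
    (hm : n ≤ m) (hz : n ≤ z) : n ≤ m ^ α * z ^ (1 - α) := by
  rcases hn.eq_or_lt with rfl | hn
  · exact mul_nonneg (Real.rpow_nonneg hm _) (Real.rpow_nonneg hz _)
  calc n = n ^ α * n ^ (1 - α) := by rw [← Real.rpow_add hn]; simp
    _ ≤ _ := mul_le_mul (Real.rpow_le_rpow hn.le hm h0) (Real.rpow_le_rpow hn.le hz (by linarith))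
      (by positivity) (Real.rpow_nonneg (hn.le.trans hm) _)

variable {δ α C : ℝ} {m : ℕ}

lemma ncard_inter_closedBall_le (hδ : 0 < δ) (hδ1 : δ < 1) (hC : 0 ≤ C) (hα : 0 ≤ α)
    (hX : (X : Set (EuclideanSpace ℝ (Fin 2))) ⊆ closedBall 0 (1 / 4)) (hKT : IsKatzTao δ α C X)
    {x} (hx : x ∈ X) {ρ : ℝ} (hρ : δ ≤ ρ) :
    (((X : Set (EuclideanSpace ℝ (Fin 2))) ∩ closedBall x ρ).ncard : ℝ) ≤ C * (ρ / δ) ^ α := by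
  rcases le_or_gt ρ 1 with h | h
  · exact hKT x ρ hρ h
  · have hsub : (X : Set (EuclideanSpace ℝ (Fin 2))) ∩ closedBall x ρ ⊆ X ∩ closedBall x 1 := by
      rintro z ⟨hz, -⟩
      refine ⟨hz, ?_⟩
      have h1 := mem_closedBall.1 (hX hz)
      have h2 := mem_closedBall.1 (hX hx)
      rw [mem_closedBall]
      linarith [dist_triangle_right z x 0]
    have h1 : (((X : Set (EuclideanSpace ℝ (Fin 2))) ∩ closedBall x ρ).ncard : ℝ) ≤
        ((X : Set (EuclideanSpace ℝ (Fin 2))) ∩ closedBall x 1).ncard := by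
      exact_mod_cast Set.ncard_le_ncard hsub (X.finite_toSet.inter_of_left _)
    refine h1.trans ((hKT x 1 hδ1.le le_rfl).trans ?_)
    gcongr

lemma card_nearCircles_circlesOf_le (hδ : 0 < δ) (hδ1 : δ < 1) (hC : 0 ≤ C) (hα : 0 ≤ α)
    (hα1 : α ≤ 1)
    (hX : (X : Set (EuclideanSpace ℝ (Fin 2))) ⊆ closedBall 0 (1 / 4)) (hKT : IsKatzTao δ α C X)
    (hR : ∀ x ∈ X, (R x).card = m ∧ ∀ r ∈ R x, r ∈ Set.Icc (1 : ℝ) 2 ∧ ∃ k : ℤ, r = δ * k)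
    {w} (hw : w ∈ circlesOf X R) {ρ : ℝ} (hρ : δ ≤ ρ) :
    ((nearCircles (circlesOf X R) w ρ).card : ℝ) ≤ 3 * C * (m : ℝ) ^ α * ρ / δ := by
  classical
  have hρ0 : 0 < ρ := hδ.trans_le hρ
  have hq : 1 ≤ ρ / δ := (one_le_div hδ).2 hρ
  set Y := X.filter fun x => x ∈ closedBall w.1 ρ with hY
  have hYc : (Y.card : ℝ) ≤ C * (ρ / δ) ^ α := by
    have h := ncard_inter_closedBall_le hδ hδ1 hC hα hX hKT (mem_circlesOf.1 hw).1 hρ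
    have e : (X : Set (EuclideanSpace ℝ (Fin 2))) ∩ closedBall w.1 ρ = (Y : Set _) := by
      ext z; simp [hY]
    rwa [e, Set.ncard_coe_finset] at h
  set T : EuclideanSpace ℝ (Fin 2) → Finset ℝ := fun x => (R x).filter fun r => |r - w.2| ≤ ρ
  have hsub : nearCircles (circlesOf X R) w ρ ⊆ circlesOf Y T := by
    intro c hc
    obtain ⟨h1, h2, h3⟩ := Finset.mem_filter.1 hc
    obtain ⟨h4, h5⟩ := mem_circlesOf.1 h1
    exact mem_circlesOf.2 ⟨Finset.mem_filter.2 ⟨h4, mem_closedBall.2 h2⟩,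
      Finset.mem_filter.2 ⟨h5, h3⟩⟩
  have hT : ∀ x ∈ Y, ((T x).card : ℝ) ≤ (m : ℝ) ^ α * (3 * (ρ / δ)) ^ (1 - α) := by
    intro x hx
    obtain ⟨h1, h2⟩ := hR x (Finset.mem_filter.1 hx).1
    refine le_rpow_mul_rpow (Nat.cast_nonneg _) hα hα1 ?_ ?_
    · rw [← h1]
      exact_mod_cast Finset.card_filter_le _ _
    · refine (card_le_of_multiples (a := w.2 - ρ) (L := 2 * ρ) hδ (by positivity) ?_).trans ?_
      · intro r hr
        obtain ⟨h3, h4⟩ := Finset.mem_filter.1 hr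
        obtain ⟨h5, h6⟩ := abs_le.1 h4
        exact ⟨⟨by linarith, by linarith⟩, (h2 r h3).2⟩
      · have : 2 * ρ / δ = 2 * (ρ / δ) := by ring
        linarith
  have hcard : ((circlesOf Y T).card : ℝ) = ∑ x ∈ Y, ((T x).card : ℝ) := by
    rw [circlesOf, Finset.card_map, Finset.card_sigma]; push_cast; rfl
  have hq0 : 0 < ρ / δ := by positivity
  calc ((nearCircles (circlesOf X R) w ρ).card : ℝ) ≤ (circlesOf Y T).card := by
        exact_mod_cast Finset.card_le_card hsub
    _ ≤ Y.card * ((m : ℝ) ^ α * (3 * (ρ / δ)) ^ (1 - α)) := by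
        rw [hcard, ← nsmul_eq_mul]; exact Finset.sum_le_card_nsmul _ _ _ hT
    _ ≤ C * (ρ / δ) ^ α * ((m : ℝ) ^ α * (3 * (ρ / δ) ^ (1 - α))) := by
        refine mul_le_mul hYc (mul_le_mul_of_nonneg_left ?_ (by positivity)) (by positivity)
          (by positivity)
        rw [Real.mul_rpow (by norm_num) hq0.le]
        refine mul_le_mul_of_nonneg_right ?_ (by positivity)
        calc (3 : ℝ) ^ (1 - α) ≤ 3 ^ (1 : ℝ) :=
              Real.rpow_le_rpow_of_exponent_le (by norm_num) (by linarith)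
          _ = 3 := Real.rpow_one 3
    _ = 3 * C * (m : ℝ) ^ α * ((ρ / δ) ^ α * (ρ / δ) ^ (1 - α)) := by ring
    _ = 3 * C * (m : ℝ) ^ α * ρ / δ := by
        rw [← Real.rpow_add hq0]; simp; ring

lemma card_radii_mul_le (hδ : 0 < δ) (hδ1 : δ < 1) {S : Finset ℝ}
    (hS : ∀ r ∈ S, r ∈ Set.Icc (1 : ℝ) 2 ∧ ∃ k : ℤ, r = δ * k) : (S.card : ℝ) * δ ≤ 2 := by
  have h := card_le_of_multiples (a := 1) (L := 1) hδ zero_le_one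
    (fun r hr => by rw [one_add_one_eq_two]; exact hS r hr)
  calc (S.card : ℝ) * δ ≤ (1 / δ + 1) * δ := mul_le_mul_of_nonneg_right h hδ.le
    _ = 1 + δ := by field_simp
    _ ≤ 2 := by linarith

end

lemma IntegralLE.eLpNorm_le {F H : EuclideanSpace ℝ (Fin 2) → ℝ} {b : ℝ} (h : IntegralLE H b)
    (hF : ∀ y, 0 ≤ F y) (hle : ∀ y, F y * √(F y) ≤ H y) :
    eLpNorm F (ENNReal.ofReal (3 / 2)) volume ≤ ENNReal.ofReal (b ^ ((2 : ℝ) / 3)) := by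
  rw [eLpNorm_eq_lintegral_rpow_enorm_toReal (by simp) ENNReal.ofReal_ne_top,
    ENNReal.toReal_ofReal (by norm_num), ← ENNReal.ofReal_rpow_of_nonneg h.bound_nonneg (by norm_num)]
  rw [show (1 : ℝ) / (3 / 2) = 2 / 3 by norm_num]
  refine ENNReal.rpow_le_rpow (le_trans (lintegral_mono fun y => ?_) h.lintegral_le) (by norm_num)
  rw [Real.enorm_eq_ofReal (hF y), ENNReal.ofReal_rpow_of_nonneg (hF y) (by norm_num)]
  refine ENNReal.ofReal_le_ofReal (le_trans (le_of_eq ?_) (hle y))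
  rw [show (3 : ℝ) / 2 = 1 + 1 / 2 by norm_num,
    Real.rpow_add_of_nonneg (hF y) (by norm_num) (by norm_num), Real.rpow_one, Real.sqrt_eq_rpow]

lemma exists_two_pow_near {δ : ℝ} (hδ : 0 < δ) (hδ1 : δ < 1) :
    ∃ N : ℕ, 1 ≤ N ∧ 1 / δ ≤ 2 ^ N ∧ (2 : ℝ) ^ N ≤ 2 / δ := by
  obtain ⟨n, h1, h2⟩ := exists_nat_pow_near ((one_le_div hδ).2 hδ1.le) one_lt_two
  refine ⟨n + 1, by omega, h2.le, ?_⟩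
  rw [pow_succ, show 2 / δ = 1 / δ * 2 by ring]
  exact mul_le_mul_of_nonneg_right h1 zero_le_two

lemma two_pow_scale_rpow_le {ε : ℝ} (hε : 0 < ε) : ∃ B, 0 < B ∧ ∀ δ : ℝ, 0 < δ → ∀ N : ℕ,
    (2 : ℝ) ^ N ≤ 2 / δ → ((N : ℝ) ^ 4) ^ ((2 : ℝ) / 3) ≤ B * δ ^ (-ε) := by
  have hη : 0 < 3 * ε / 8 := by positivity
  generalize hη' : 3 * ε / 8 = η at hη
  have hl : 0 < Real.log 2 := Real.log_pos one_lt_two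
  refine ⟨(2 ^ η / (η * Real.log 2)) ^ ((8 : ℝ) / 3), by positivity, fun δ hδ N hN => ?_⟩
  have h1 : N * Real.log 2 ≤ (2 / δ) ^ η / η := by
    rw [← Real.log_pow]
    exact (Real.log_le_log (by positivity) hN).trans (Real.log_le_rpow_div (by positivity) hη)
  have h2 : (N : ℝ) ≤ 2 ^ η / (η * Real.log 2) * δ ^ (-η) := by
    rw [Real.div_rpow zero_le_two hδ.le] at h1
    rw [Real.rpow_neg hδ.le]
    calc (N : ℝ) = N * Real.log 2 / Real.log 2 := by field_simp
      _ ≤ 2 ^ η / δ ^ η / η / Real.log 2 := div_le_div_of_nonneg_right h1 hl.le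
      _ = _ := by field_simp
  calc ((N : ℝ) ^ 4) ^ ((2 : ℝ) / 3) = (N : ℝ) ^ ((8 : ℝ) / 3) := by
        rw [← Real.rpow_natCast_mul (Nat.cast_nonneg _)]; norm_num
    _ ≤ (2 ^ η / (η * Real.log 2) * δ ^ (-η)) ^ ((8 : ℝ) / 3) :=
        Real.rpow_le_rpow (Nat.cast_nonneg _) h2 (by norm_num)
    _ = _ := by
        rw [Real.mul_rpow (by positivity) (by positivity), ← Real.rpow_mul hδ.le, ← hη']
        congr 2
        ring

lemma rpow_le_two_mul_rpow {x a b : ℝ} (hx : 0 < x) (hx2 : x ≤ 2) (hab : b ≤ a) (hab1 : a ≤ b + 1) :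
    x ^ a ≤ 2 * x ^ b := by
  calc x ^ a = x ^ (a - b) * x ^ b := by rw [← Real.rpow_add hx]; congr 1; ring
    _ ≤ 2 * x ^ b := by
      refine mul_le_mul_of_nonneg_right ?_ (by positivity)
      calc x ^ (a - b) ≤ 2 ^ (a - b) := Real.rpow_le_rpow hx.le hx2 (by linarith)
        _ ≤ 2 ^ (1 : ℝ) := Real.rpow_le_rpow_of_exponent_le one_le_two (by linarith)
        _ = 2 := Real.rpow_one 2

lemma majorant_bound_le {α s C δ ε B n m : ℝ} {N U u : ℕ} (hα1 : α ≤ 1) (hs1 : 1 ≤ s)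
    (hsα : s * (1 - α) ≤ 3) (hC : 1 ≤ C) (hδ : 0 < δ) (hn : 0 ≤ n) (hm : 0 < m)
    (hmδ : m * δ ≤ 2) (hU : (N : ℝ) ^ 3 * U ≤ u * N ^ 4) (hB : 0 ≤ B)
    (hN : ((N : ℝ) ^ 4) ^ ((2 : ℝ) / 3) ≤ B * δ ^ (-ε)) :
    (10 ^ 30 * (N ^ 3 * U * (n * m * (δ * √(3 * C * m ^ α))))) ^ ((2 : ℝ) / 3) ≤
      2 * (10 ^ 30 * √(3 * C) * u) ^ ((2 : ℝ) / 3) * B * δ ^ (-ε) * (m * δ) ^ (1 - 1 / s) *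
        δ ^ (-(α / 3)) * n ^ ((2 : ℝ) / 3) := by
  have hmα : √(m ^ α) ^ ((2 : ℝ) / 3) = m ^ (α / 3) := by
    rw [Real.sqrt_eq_rpow, ← Real.rpow_mul hm.le, ← Real.rpow_mul hm.le]
    congr 1; ring
  have hpow : (m * δ) ^ ((2 : ℝ) / 3) * m ^ (α / 3) ≤
      2 * (m * δ) ^ (1 - 1 / s) * δ ^ (-(α / 3)) := by
    have e : m ^ (α / 3) = (m * δ) ^ (α / 3) * δ ^ (-(α / 3)) := by
      rw [Real.mul_rpow hm.le hδ.le, mul_assoc, ← Real.rpow_add hδ]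
      simp
    rw [e, ← mul_assoc, ← Real.rpow_add (by positivity)]
    refine mul_le_mul_of_nonneg_right (rpow_le_two_mul_rpow (by positivity) hmδ ?_ ?_)
      (by positivity)
    · have hs : 0 < s := by linarith
      have : (1 - α) / 3 ≤ 1 / s := by
        rw [div_le_div_iff₀ (by norm_num) hs]; linarith
      linarith
    · have : 1 / s ≤ 1 := by rw [div_le_one (by linarith)]; exact hs1
      linarith
  calc (10 ^ 30 * (N ^ 3 * U * (n * m * (δ * √(3 * C * m ^ α))))) ^ ((2 : ℝ) / 3)
      ≤ ((10 ^ 30 * √(3 * C) * u) * N ^ 4 * (m * δ) * √(m ^ α) * n) ^ ((2 : ℝ) / 3) := by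
        refine Real.rpow_le_rpow (by positivity) ?_ (by norm_num)
        rw [Real.sqrt_mul (by positivity)]
        have h := mul_le_mul_of_nonneg_left hU
          (show 0 ≤ 10 ^ 30 * √(3 * C) * (m * δ) * √(m ^ α) * n by positivity)
        refine le_trans (le_of_eq ?_) (h.trans (le_of_eq ?_)) <;> ring
    _ = (10 ^ 30 * √(3 * C) * u) ^ ((2 : ℝ) / 3) * ((N : ℝ) ^ 4) ^ ((2 : ℝ) / 3) *
          ((m * δ) ^ ((2 : ℝ) / 3) * m ^ (α / 3)) * n ^ ((2 : ℝ) / 3) := by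
        rw [Real.mul_rpow (by positivity) (by positivity),
          Real.mul_rpow (by positivity) (by positivity),
          Real.mul_rpow (by positivity) (by positivity),
          Real.mul_rpow (by positivity) (by positivity), hmα]
        ring
    _ ≤ (10 ^ 30 * √(3 * C) * u) ^ ((2 : ℝ) / 3) * (B * δ ^ (-ε)) *
          (2 * (m * δ) ^ (1 - 1 / s) * δ ^ (-(α / 3))) * n ^ ((2 : ℝ) / 3) := by
        gcongr
    _ = _ := by ring

lemma two_mul_div_lt_two_pow {α C δ m : ℝ} {N u : ℕ} (hα1 : α ≤ 1) (hC : 1 ≤ C)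
    (hδ : 0 < δ) (hm : 1 ≤ m) (hmδ : m * δ ≤ 2) (hN : 1 / δ ≤ 2 ^ N) (hu : 12 * C < 2 ^ u) :
    2 * (3 * C * m ^ α / δ) < 2 ^ (u + 2 * N) := by
  have h1 : m ^ α ≤ 2 / δ := by
    calc m ^ α ≤ m ^ (1 : ℝ) := Real.rpow_le_rpow_of_exponent_le hm hα1
      _ = m := Real.rpow_one m
      _ ≤ 2 / δ := by rwa [le_div_iff₀ hδ]
  have h2 : 0 < 1 / δ := by positivity
  calc 2 * (3 * C * m ^ α / δ) ≤ 2 * (3 * C * (2 / δ) / δ) := by gcongr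
    _ = 12 * C * ((1 / δ) * (1 / δ)) := by ring
    _ < 2 ^ u * ((1 / δ) * (1 / δ)) := mul_lt_mul_of_pos_right hu (by positivity)
    _ ≤ 2 ^ u * (2 ^ N * 2 ^ N) := by gcongr
    _ = 2 ^ (u + 2 * N) := by ring

end CircleTangency

open CircleTangency

/-- Case (1) of the discretized dual estimate: for `α ∈ (0,1]` and `s(1-α) ≤ 3`, the
`L^{3/2}` norm of the sum of indicators of annuli is `≲ δ^{-ε} (mδ)^{1/s'} δ^{-α/3} (#X)^{2/3}`,
where `1/s' = 1 - 1/s` is the conjugate exponent of `s`. -/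
theorem stmt11 (α s : ℝ) (hα0 : 0 < α) (hα1 : α ≤ 1) (hs1 : 1 ≤ s)
    (hsα : s * (1 - α) ≤ 3) (C₀ : ℝ) (hC₀ : 1 ≤ C₀) :
    ∀ ε : ℝ, 0 < ε → ∃ A : ℝ, 0 < A ∧
      ∀ δ : ℝ, 0 < δ → δ < 1 →
      ∀ X : Finset (EuclideanSpace ℝ (Fin 2)), InLattice δ X →
        (X : Set (EuclideanSpace ℝ (Fin 2))) ⊆
          Metric.closedBall (0 : EuclideanSpace ℝ (Fin 2)) (1/4) →
        IsKatzTao δ α C₀ X →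
      ∀ m : ℕ, 1 ≤ m →
      ∀ R : EuclideanSpace ℝ (Fin 2) → Finset ℝ,
        (∀ x ∈ X, (R x).card = m ∧
          ∀ r ∈ R x, r ∈ Set.Icc (1 : ℝ) 2 ∧ ∃ k : ℤ, r = δ * k) →
        eLpNorm (annSum δ X R) (ENNReal.ofReal (3 / 2)) volume
          ≤ ENNReal.ofReal (A * δ ^ (-ε) * (m * δ) ^ (1 - 1 / s) * δ ^ (-(α / 3)) *
              (X.card : ℝ) ^ ((2 : ℝ) / 3)) := by
  intro ε hε
  obtain ⟨B, hB, hNB⟩ := two_pow_scale_rpow_le hε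
  obtain ⟨u, hu⟩ := pow_unbounded_of_one_lt (12 * C₀) one_lt_two
  refine ⟨2 * (10 ^ 30 * √(3 * C₀) * (u + 2 : ℕ)) ^ ((2 : ℝ) / 3) * B, by positivity, ?_⟩
  intro δ hδ hδ1 X _ hball hKT m hm R hR
  rcases X.eq_empty_or_nonempty with rfl | ⟨x₀, hx₀⟩
  · have : annSum δ ∅ R = 0 := by ext y; simp [annSum]
    rw [this, eLpNorm_zero]
    exact zero_le
  have hmδ : (m : ℝ) * δ ≤ 2 := by
    have h := card_radii_mul_le hδ hδ1 (hR x₀ hx₀).2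
    rwa [(hR x₀ hx₀).1] at h
  have hm1 : (1 : ℝ) ≤ m := by exact_mod_cast hm
  obtain ⟨N, hN1, hN, hN'⟩ := exists_two_pow_near hδ hδ1
  have hN1' : (1 : ℝ) ≤ N := by exact_mod_cast hN1
  obtain ⟨H, hH, hle⟩ := exists_majorant (W := circlesOf X R) (U := u + 2 * N)
    (K := 3 * C₀ * (m : ℝ) ^ α) hδ hδ1 (by positivity) hN1 (by omega) hN hN'
    (two_mul_div_lt_two_pow hα1 hC₀ hδ hm1 hmδ hN hu)
    (fun w hw => ((hR w.1 (mem_circlesOf.1 hw).1).2 w.2 (mem_circlesOf.1 hw).2).1)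
    (fun w hw => hball (mem_circlesOf.1 hw).1)
    (fun w hw ρ hρ => card_nearCircles_circlesOf_le hδ hδ1 (by linarith) hα0.le hα1 hball hKT hR
      hw hρ)
  simp only [← annSum_eq_sum_annInd] at hle
  refine (hH.eLpNorm_le (fun y => ?_) hle).trans (ENNReal.ofReal_le_ofReal ?_)
  · rw [annSum_eq_sum_annInd]
    exact Finset.sum_nonneg fun _ _ => annInd_nonneg ..
  · rw [card_circlesOf fun x hx => (hR x hx).1]
    push_cast
    have hU : (N : ℝ) ^ 3 * (u + 2 * N : ℕ) ≤ (u + 2 : ℕ) * N ^ 4 := by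
      have : (u : ℝ) ≤ u * N := le_mul_of_one_le_right (Nat.cast_nonneg _) hN1'
      calc (N : ℝ) ^ 3 * (u + 2 * N : ℕ) ≤ N ^ 3 * (u * N + 2 * N) := by
            push_cast; gcongr
        _ = _ := by push_cast; ring
    have h := majorant_bound_le hα1 hs1 hsα hC₀ hδ (Nat.cast_nonneg X.card)
      (show (0 : ℝ) < m by linarith) hmδ hU hB.le (hNB δ hδ N hN')
    push_cast at h
    exact h
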